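/- arXiv:math/0601454 — 2 statements merged into one kernel-verified Lean document; each statement's English description precedes it below -/
import Mathlib

section
/- Let n ≥ 1 and let Q₁,…,Qₙ be pairwise distinct smooth conics in the complex projective plane ℙ² for which there exist two distinct points p, q ∈ ℙ² such that for all i ≠ j the set-theoretic intersection Qᵢ ∩ Qⱼ equals {p, q} and Qᵢ and Qⱼ are tangent both at p and at q (their tangent lines at p coincide and their tangent lines at q coincide). Then the fundamental group π₁(ℙ² ∖ (Q₁ ∪ ⋯ ∪ Qₙ)) is isomorphic to the presented group ⟨a₁,…,aₙ | (a₁a₂⋯aₙ)² = e⟩, i.e. to the quotient of the free group on generators a₁,…,aₙ by the normal closure of the single word (a₁a₂⋯aₙ)². -/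
open MvPolynomial

noncomputable section

/-- The complex projective plane, with the quotient topology. -/
instance : TopologicalSpace (Projectivization ℂ (Fin 3 → ℂ)) :=
  @instTopologicalSpaceQuotient _ (projectivizationSetoid ℂ (Fin 3 → ℂ)) _

abbrev P2 : Type := Projectivization ℂ (Fin 3 → ℂ)

/-- The gradient of a polynomial in three variables. -/
def gradP (P : MvPolynomial (Fin 3) ℂ) (v : Fin 3 → ℂ) : Fin 3 → ℂ :=
  fun i => eval v (pderiv i P)

/-- The zero locus in `ℙ²` of a (homogeneous) polynomial in three variables. -/
def zeroLocusP2 (P : MvPolynomial (Fin 3) ℂ) : Set P2 :=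
  {x | eval x.rep P = 0}

/-- A smooth conic: the zero locus of a homogeneous polynomial of degree 2 whose
gradient vanishes only at the origin. -/
def IsSmoothConic (Q : Set P2) : Prop :=
  ∃ P : MvPolynomial (Fin 3) ℂ, P.IsHomogeneous 2 ∧
    (∀ v : Fin 3 → ℂ, v ≠ 0 → gradP P v ≠ 0) ∧ Q = zeroLocusP2 P

/-- The tangent line at a point of the conic defined by `P`. -/
def tangentLineAt (P : MvPolynomial (Fin 3) ℂ) (p : P2) : Set P2 :=
  {x | ∑ i, gradP P p.rep i * x.rep i = 0}

/-- Two smooth conics are tangent at a common point `p` if their tangent lines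
at `p` coincide. -/
def TangentAt (Q Q' : Set P2) (p : P2) : Prop :=
  p ∈ Q ∧ p ∈ Q' ∧
    ∀ P P' : MvPolynomial (Fin 3) ℂ,
      P.IsHomogeneous 2 → (∀ v : Fin 3 → ℂ, v ≠ 0 → gradP P v ≠ 0) → Q = zeroLocusP2 P →
      P'.IsHomogeneous 2 → (∀ v : Fin 3 → ℂ, v ≠ 0 → gradP P' v ≠ 0) → Q' = zeroLocusP2 P' →
      tangentLineAt P p = tangentLineAt P' p

/-- The single relator `(a₁ a₂ ⋯ aₙ)²`. -/
def relAn (n : ℕ) : Set (FreeGroup (Fin n)) :=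
  {((List.ofFn fun i : Fin n => FreeGroup.of i).prod) ^ 2}

section CocycleBundle

open Path.Homotopic (Quotient)
open scoped unitInterval

/-- A property of path classes that is stable under concatenation and holds for paths inside the
members of an open cover holds for all path classes. -/
theorem Path.induction_open_cover {X ι : Type*} [TopologicalSpace X] {U : ι → Set X}
    (hU : ∀ i, IsOpen (U i)) (hcov : ∀ x, ∃ i, x ∈ U i)
    (P : ∀ {x x' : X}, Path.Homotopic.Quotient x x' → Prop)
    (htrans : ∀ {x y z : X} (a : Path.Homotopic.Quotient x y) (b : Path.Homotopic.Quotient y z),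
      P a → P b → P (a.trans b))
    (hloc : ∀ i {x y : U i} (γ : Path x y),
      P ((Path.Homotopic.Quotient.mk γ).map ⟨Subtype.val, continuous_subtype_val⟩))
    {x x' : X} (c : Path.Homotopic.Quotient x x') : P c := by
  obtain ⟨γ, rfl⟩ := Path.Homotopic.Quotient.mk_surjective c
  obtain ⟨t, t0, tmono, ⟨N, hN⟩, ht⟩ :=
    exists_monotone_Icc_subset_open_cover_unitInterval (c := fun i => γ ⁻¹' (U i))
      (fun i => (hU i).preimage γ.continuous)
      (fun s _ => Set.mem_iUnion.2 (hcov (γ s)))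
  have hlift : ∀ i (s s' : I), s ≤ s' → Set.Icc s s' ⊆ γ ⁻¹' (U i) →
      P (Path.Homotopic.Quotient.mk (γ.subpath s s')) := by
    intro i s s' hs hsub
    have hmem : ∀ r, γ.subpath s s' r ∈ U i := by
      intro r
      have : γ.subpath s s' r ∈ Set.range (γ.subpath s s') := ⟨r, rfl⟩
      rw [Path.range_subpath_of_le _ _ _ hs] at this
      obtain ⟨q, hq, hq'⟩ := this
      rw [← hq']; exact hsub hq
    let γ' : Path (⟨γ s, hsub ⟨le_rfl, hs⟩⟩ : U i) ⟨γ s', hsub ⟨hs, le_rfl⟩⟩ :=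
      { toFun := fun r => ⟨γ.subpath s s' r, hmem r⟩
        continuous_toFun := by fun_prop
        source' := by simp
        target' := by simp }
    exact hloc i γ'
  have hind : ∀ n, P (Path.Homotopic.Quotient.mk (γ.subpath 0 (t n))) := by
    intro n
    induction n with
    | zero =>
      obtain ⟨i, hi⟩ := hcov (γ 0)
      rw [t0]
      exact hlift i 0 0 le_rfl (by simpa using hi)
    | succ n ih =>
      obtain ⟨i, hi⟩ := ht n
      have h1 := htrans _ _ ih (hlift i _ _ (tmono n.le_succ) hi)
      rw [← Path.Homotopic.Quotient.mk_trans,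
        Path.Homotopic.Quotient.eq.2 ⟨Path.Homotopy.subpathTransSubpath γ 0 (t n) (t (n + 1))⟩] at h1
      exact h1
  have h1 := hind N
  rw [hN N le_rfl, Path.subpath_zero_one, Path.Homotopic.Quotient.mk_cast] at h1
  have hcast : ∀ {a b a' b' : X} (c : Path.Homotopic.Quotient a b) (ha : a' = a) (hb : b' = b),
      P (c.cast ha hb) → P c := by
    intro a b a' b' c ha hb
    subst ha hb
    simp
  exact hcast _ _ _ h1

section Cocycle

variable {X ι G : Type} [TopologicalSpace X] [Group G] {U : ι → Set X}

/-- The principal bundle with discrete structure group glued from a locally constant cocycle. -/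
def cocycleBundle [TopologicalSpace G] [DiscreteTopology G] (hU : ∀ i, IsOpen (U i))
    (hcov : ∀ x, ∃ i, x ∈ U i) (g : ι → ι → X → G)
    (hcoc : ∀ i j k x, x ∈ U i → x ∈ U j → x ∈ U k → g i j x * g j k x = g i k x)
    (hloc : ∀ i j x, x ∈ U i → x ∈ U j → ∀ᶠ x' in nhds x, g i j x' = g i j x) :
    FiberBundleCore ι X G where
  baseSet := U
  isOpen_baseSet := hU
  indexAt x := (hcov x).choose
  mem_baseSet_at x := (hcov x).choose_spec
  coordChange i j x a := g j i x * a
  coordChange_self i x hx v := by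
    have := hcoc i i i x hx hx hx
    rw [mul_eq_left] at this
    rw [this, one_mul]
  continuousOn_coordChange i j := by
    rintro ⟨x, a⟩ ⟨⟨hi, hj⟩, -⟩
    refine (ContinuousAt.mul ?_ continuousAt_snd).continuousWithinAt
    have h2 : ContinuousAt (g j i) x :=
      (continuousAt_const (y := g j i x)).congr ((hloc j i x hj hi).mono fun _ h => h.symm)
    exact h2.comp_of_eq continuousAt_fst rfl
  coordChange_comp i j k x := by
    rintro ⟨⟨hi, hj⟩, hk⟩ v
    rw [← mul_assoc, hcoc k j i x hk hj hi]

variable (hsc : ∀ i, SimplyConnectedSpace (U i)) {y : X} (hy : ∀ i, y ∈ U i)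

/-- The class of the paths inside the simply connected set `U i` from the base point to `x`. -/
def pathIn (i : ι) (x : U i) : Path.Homotopic.Quotient y (x : X) :=
  have := hsc i
  (Path.Homotopic.Quotient.mk (PathConnectedSpace.somePath (⟨y, hy i⟩ : U i) x)).map
    ⟨Subtype.val, continuous_subtype_val⟩

theorem pathIn_trans (i : ι) {x x' : U i} (c : Path.Homotopic.Quotient x x') :
    (pathIn hsc hy i x).trans (c.map ⟨Subtype.val, continuous_subtype_val⟩) =
      pathIn hsc hy i x' := by
  have := hsc i
  unfold pathIn
  obtain ⟨c, rfl⟩ := Path.Homotopic.Quotient.mk_surjective c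
  rw [← Path.Homotopic.Quotient.mk_map, ← Path.Homotopic.Quotient.mk_map,
    ← Path.Homotopic.Quotient.mk_map, ← Path.Homotopic.Quotient.mk_trans]
  have h := SimplyConnectedSpace.paths_homotopic
    ((PathConnectedSpace.somePath (⟨y, hy i⟩ : U i) x).trans c)
    (PathConnectedSpace.somePath (⟨y, hy i⟩ : U i) x')
  have h2 := h.map (⟨Subtype.val, continuous_subtype_val⟩ : C(U i, X))
  rw [Path.Homotopic.Quotient.eq]
  rw [Path.map_trans] at h2
  exact h2

theorem pathIn_base (i : ι) : pathIn hsc hy i ⟨y, hy i⟩ = .refl y := by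
  have := hsc i
  unfold pathIn
  rw [← Path.Homotopic.Quotient.mk_map, ← Path.Homotopic.Quotient.mk_refl]
  have h := (SimplyConnectedSpace.paths_homotopic
    (PathConnectedSpace.somePath (⟨y, hy i⟩ : U i) ⟨y, hy i⟩) (Path.refl _)).map
    (⟨Subtype.val, continuous_subtype_val⟩ : C(U i, X))
  exact Path.Homotopic.Quotient.eq.2 h

open Classical in
/-- The cocycle with values in the fundamental group given by the loops that go to `x` inside
`U i` and come back inside `U j`. -/
def loopCocycle (i j : ι) (x : X) : (FundamentalGroup X y)ᵐᵒᵖ :=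
  if hx : x ∈ U i ∧ x ∈ U j then
    .op ((pathIn hsc hy i ⟨x, hx.1⟩).trans (pathIn hsc hy j ⟨x, hx.2⟩).symm)
  else 1

theorem loopCocycle_eq {i j : ι} {x : X} (hi : x ∈ U i) (hj : x ∈ U j) :
    loopCocycle hsc hy i j x =
      .op ((pathIn hsc hy i ⟨x, hi⟩).trans (pathIn hsc hy j ⟨x, hj⟩).symm) :=
  dif_pos ⟨hi, hj⟩

theorem op_trans (a b : Path.Homotopic.Quotient y y) :
    (MulOpposite.op (a.trans b) : (FundamentalGroup X y)ᵐᵒᵖ) =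
      MulOpposite.op (α := FundamentalGroup X y) a * MulOpposite.op (α := FundamentalGroup X y) b :=
  rfl

theorem loopCocycle_mul (i j k : ι) (x : X) (hi : x ∈ U i) (hj : x ∈ U j) (hk : x ∈ U k) :
    loopCocycle hsc hy i j x * loopCocycle hsc hy j k x = loopCocycle hsc hy i k x := by
  rw [loopCocycle_eq hsc hy hi hj, loopCocycle_eq hsc hy hj hk, loopCocycle_eq hsc hy hi hk,
    ← op_trans]
  congr 1
  grind

theorem loopCocycle_base (i j : ι) : loopCocycle hsc hy i j y = 1 := by
  rw [loopCocycle_eq hsc hy (hy i) (hy j), pathIn_base, pathIn_base]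
  refine congrArg MulOpposite.op (?_ : _ = Path.Homotopic.Quotient.refl y)
  grind

theorem loopCocycle_joinedIn (i j : ι) (x x' : X) (h : JoinedIn (U i ∩ U j) x x') :
    loopCocycle hsc hy i j x = loopCocycle hsc hy i j x' := by
  obtain ⟨γ, hγ⟩ := h
  have hx := γ.source ▸ hγ 0
  have hx' := γ.target ▸ hγ 1
  rw [loopCocycle_eq hsc hy hx.1 hx.2, loopCocycle_eq hsc hy hx'.1 hx'.2]
  let γi : Path (⟨x, hx.1⟩ : U i) ⟨x', hx'.1⟩ :=
    { toFun := fun r => ⟨γ r, (hγ r).1⟩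
      continuous_toFun := by fun_prop
      source' := by simp
      target' := by simp }
  let γj : Path (⟨x, hx.2⟩ : U j) ⟨x', hx'.2⟩ :=
    { toFun := fun r => ⟨γ r, (hγ r).2⟩
      continuous_toFun := by fun_prop
      source' := by simp
      target' := by simp }
  have hi := pathIn_trans hsc hy i (.mk γi)
  have hj := pathIn_trans hsc hy j (.mk γj)
  have hγi : (Path.Homotopic.Quotient.mk γi).map ⟨Subtype.val, continuous_subtype_val⟩ =
    Path.Homotopic.Quotient.mk γ := rfl
  have hγj : (Path.Homotopic.Quotient.mk γj).map ⟨Subtype.val, continuous_subtype_val⟩ =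
    Path.Homotopic.Quotient.mk γ := rfl
  rw [← hi, ← hj, hγi, hγj]
  congr 1
  have hsymm : ∀ {a b c : X} (p : Path.Homotopic.Quotient a b) (q : Path.Homotopic.Quotient b c),
      (p.trans q).symm = q.symm.trans p.symm := by
    intro a b c p q
    obtain ⟨p, rfl⟩ := Path.Homotopic.Quotient.mk_surjective p
    obtain ⟨q, rfl⟩ := Path.Homotopic.Quotient.mk_surjective q
    simp only [← Path.Homotopic.Quotient.mk_trans, ← Path.Homotopic.Quotient.mk_symm,
      Path.trans_symm]
  rw [hsymm, Path.Homotopic.Quotient.trans_assoc, ← Path.Homotopic.Quotient.trans_assoc _ _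
    (pathIn hsc hy j ⟨x, hx.2⟩).symm]
  simp

theorem trans_eq_insert {z z' : X} (a b : Path.Homotopic.Quotient y z)
    (c : Path.Homotopic.Quotient z z') (d : Path.Homotopic.Quotient y z') :
    a.trans c = ((a.trans b.symm).trans ((b.trans c).trans d.symm)).trans d := by
  simp only [Path.Homotopic.Quotient.trans_assoc, Path.Homotopic.Quotient.symm_trans,
    Path.Homotopic.Quotient.trans_refl]
  rw [← Path.Homotopic.Quotient.trans_assoc b.symm, Path.Homotopic.Quotient.symm_trans,
    Path.Homotopic.Quotient.refl_trans]

/-- If a group carries a universal locally constant cocycle for a cover by simply connected open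
sets with a common point, then it is the fundamental group. -/
theorem fundamentalGroup_of_universal_cocycle (hU : ∀ i, IsOpen (U i))
    (hcov : ∀ x, ∃ i, x ∈ U i) (hsc : ∀ i, SimplyConnectedSpace (U i)) (hy : ∀ i, y ∈ U i)
    (g : ι → ι → X → G)
    (hcoc : ∀ i j k x, x ∈ U i → x ∈ U j → x ∈ U k → g i j x * g j k x = g i k x)
    (hloc : ∀ i j x, x ∈ U i → x ∈ U j → ∀ᶠ x' in nhds x, g i j x' = g i j x)
    (hgy : ∀ i j, g i j y = 1)
    (hgen : Subgroup.closure {a | ∃ i j x, x ∈ U i ∧ x ∈ U j ∧ g i j x = a} = ⊤)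
    (huniv : ∀ (K : Type) [Group K] (h : ι → ι → X → K),
      (∀ i j k x, x ∈ U i → x ∈ U j → x ∈ U k → h i j x * h j k x = h i k x) →
      (∀ i j x x', JoinedIn (U i ∩ U j) x x' → h i j x = h i j x') →
      (∀ i j, h i j y = 1) →
      ∃ s : G →* K, ∀ i j x, x ∈ U i → x ∈ U j → s (g i j x) = h i j x) (x : X) :
    Nonempty (FundamentalGroup X x ≃* G) := by
  obtain ⟨s, hs⟩ := huniv (FundamentalGroup X y)ᵐᵒᵖ (loopCocycle hsc hy) (loopCocycle_mul hsc hy)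
    (loopCocycle_joinedIn hsc hy) (loopCocycle_base hsc hy)
  let φ : G → Path.Homotopic.Quotient y y := fun a => (s a).unop
  have hφ : ∀ a b, φ (a * b) = (φ a).trans (φ b) := fun a b => by
    simp only [φ, map_mul]; rfl
  have hφ1 : φ 1 = .refl y := by simp only [φ, map_one]; rfl
  have hφg : ∀ i j x (hi : x ∈ U i) (hj : x ∈ U j), φ (g i j x) =
      (pathIn hsc hy i ⟨x, hi⟩).trans (pathIn hsc hy j ⟨x, hj⟩).symm := fun i j x hi hj => by
    simp only [φ, hs i j x hi hj, loopCocycle_eq hsc hy hi hj]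
    rfl
  have hsurj : Function.Surjective s := by
    intro k
    have key := Path.induction_open_cover hU hcov
      (fun {x x'} c => ∀ i j (hi : x ∈ U i) (hj : x' ∈ U j), ∃ a : G,
        (pathIn hsc hy i ⟨x, hi⟩).trans c = (φ a).trans (pathIn hsc hy j ⟨x', hj⟩))
      (by
        intro x x' x'' c c' hc hc' i j hi hj
        obtain ⟨k, hk⟩ := hcov x'
        obtain ⟨a, ha⟩ := hc i k hi hk
        obtain ⟨b, hb⟩ := hc' k j hk hj
        refine ⟨a * b, ?_⟩
        rw [hφ]
        grind)
      (by
        intro k x x' γ i j hi hj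
        refine ⟨g i k x * g k j x', ?_⟩
        rw [hφ, hφg i k x hi x.2, hφg k j x' x'.2 hj]
        have h := trans_eq_insert (pathIn hsc hy i ⟨x, hi⟩) (pathIn hsc hy k x)
          ((Path.Homotopic.Quotient.mk γ).map ⟨Subtype.val, continuous_subtype_val⟩)
          (pathIn hsc hy j ⟨x', hj⟩)
        rw [pathIn_trans] at h
        exact h) (x := y) (x' := y) k.unop
    obtain ⟨i, hi⟩ := hcov y
    obtain ⟨a, ha⟩ := key i i hi hi
    refine ⟨a, ?_⟩
    rw [pathIn_base] at ha
    apply MulOpposite.unop_injective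
    change φ a = _
    simpa using ha.symm
  have hinj : Function.Injective s := by
    let : TopologicalSpace G := ⊥
    have : DiscreteTopology G := ⟨rfl⟩
    let Z := cocycleBundle hU hcov g hcoc hloc
    have cov : IsCoveringMap Z.proj :=
      IsFiberBundle.isCoveringMap fun x => ⟨Z.localTriv (Z.indexAt x), Z.mem_baseSet_at x⟩
    let e : ∀ (i : ι) (a : G) (x : X), Z.TotalSpace := fun i a x =>
      ⟨x, g (Z.indexAt x) i x * a⟩
    have he : ∀ i j a x, x ∈ U i → x ∈ U j → e i (g i j x * a) x = e j a x := by
      intro i j a x hi hj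
      simp only [e]
      congr 1
      rw [← mul_assoc, hcoc _ _ _ x (Z.mem_baseSet_at x) hi hj]
    have hcont : ∀ i a, ContinuousOn (e i a) (U i) := by
      intro i a
      have h1 := (Z.localTriv i).toOpenPartialHomeomorph.continuousOn_symm
      have h2 : ContinuousOn (fun x : X => (x, a)) (U i) := by fun_prop
      refine (h1.comp h2 ?_).congr ?_
      · intro x hx
        exact (Z.mem_localTriv_target i (x, a)).2 hx
      · intro x hx
        exact (Z.localTriv_symm_apply i (x, a)).symm
    have hmono : ∀ i a (x x' : U i) (c : Path.Homotopic.Quotient x x'),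
        (cov.monodromy (c.map ⟨Subtype.val, continuous_subtype_val⟩) ⟨e i a x, rfl⟩).1 =
          e i a x' := by
      intro i a x x' c
      have h1 := cov.monodromy_map (c.map ⟨fun z : U i => e i a z,
        continuousOn_iff_continuous_domRestrict.1 (hcont i a)⟩)
      rw [← Path.Homotopic.Quotient.map_comp] at h1
      exact congrArg Subtype.val h1
    have hpath : ∀ i a (x : U i),
        (cov.monodromy (pathIn hsc hy i x) ⟨e i a y, rfl⟩).1 = e i a x := fun i a x => hmono i a _ x _
    have hg1 : ∀ i x, x ∈ U i → g i i x = 1 := fun i x hi =>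
      mul_eq_left.1 (hcoc i i i x hi hi hi)
    have hbase : ∀ i j a, e i a y = e j a y := fun i j a => by
      rw [← he i j a y (hy i) (hy j), hgy, one_mul]
    have hinv : ∀ i j x, x ∈ U i → x ∈ U j → g j i x = (g i j x)⁻¹ := fun i j x hi hj => by
      rw [eq_inv_iff_mul_eq_one, hcoc j i j x hj hi hj, hg1 j x hj]
    obtain ⟨i₀, -⟩ := hcov y
    let m : G → Prop := fun b => ∀ a, (cov.monodromy (φ b) ⟨e i₀ a y, rfl⟩).1 = e i₀ (b⁻¹ * a) y
    have hm : ∀ b, m b := by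
      have hmul : ∀ b c, m b → m c → m (b * c) := by
        intro b c hb hc a
        rw [hφ, cov.monodromy_trans_apply]
        have h1 : cov.monodromy (φ b) ⟨e i₀ a y, rfl⟩ = ⟨e i₀ (b⁻¹ * a) y, rfl⟩ :=
          Subtype.ext (hb a)
        rw [h1, hc]
        simp [mul_assoc]
      have hone : m 1 := by
        intro a
        rw [hφ1, cov.monodromy_refl]
        simp
      have hinv' : ∀ b, m b → m b⁻¹ := by
        intro b hb a
        have h1 : cov.monodromy (φ b) ⟨e i₀ (b * a) y, rfl⟩ = ⟨e i₀ a y, rfl⟩ :=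
          Subtype.ext (by rw [hb]; simp)
        rw [← h1, ← cov.monodromy_trans_apply, ← hφ]
        simp [hφ1, cov.monodromy_refl]
      intro b
      have hb : b ∈ Subgroup.closure {a | ∃ i j x, x ∈ U i ∧ x ∈ U j ∧ g i j x = a} := by
        rw [hgen]; trivial
      induction hb using Subgroup.closure_induction with
      | mem b hb =>
        obtain ⟨i, j, x, hi, hj, rfl⟩ := hb
        intro a
        rw [hφg i j x hi hj, cov.monodromy_trans_apply]
        have h1 : cov.monodromy (pathIn hsc hy i ⟨x, hi⟩) ⟨e i₀ a y, rfl⟩ = 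
            cov.monodromy (pathIn hsc hy j ⟨x, hj⟩) ⟨e i₀ ((g i j x)⁻¹ * a) y, rfl⟩ := by
          apply Subtype.ext
          have h2 := hpath i a ⟨x, hi⟩
          have h3 := hpath j ((g i j x)⁻¹ * a) ⟨x, hj⟩
          simp only [hbase i i₀, hbase j i₀] at h2 h3
          rw [h2, h3, ← he j i a x hj hi, hinv i j x hi hj]
        rw [h1, ← cov.monodromy_trans_apply, Path.Homotopic.Quotient.trans_symm,
          cov.monodromy_refl]
        rfl
      | one => exact hone
      | mul b c _ _ hb hc => exact hmul b c hb hc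
      | inv b _ hb => exact hinv' b hb
    rw [injective_iff_map_eq_one]
    intro b hb
    have hφb : φ b = .refl y := by simp only [φ, hb]; rfl
    have h1 := hm b b
    rw [hφb, cov.monodromy_refl] at h1
    have h2 : (e i₀ b y).2 = (e i₀ (b⁻¹ * b) y).2 := congrArg (fun z : Z.TotalSpace => z.2) h1
    simp only [e, inv_mul_cancel, mul_one] at h2
    exact mul_eq_left.1 h2
  have eG : G ≃* FundamentalGroup X y :=
    (MulEquiv.ofBijective s ⟨hinj, hsurj⟩).trans (MulEquiv.inv' _).symm
  obtain ⟨i, hi⟩ := hcov x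
  have := hsc i
  have γ : Path x y := ((PathConnectedSpace.somePath (⟨x, hi⟩ : U i) ⟨y, hy i⟩).map
    continuous_subtype_val)
  exact ⟨(FundamentalGroup.fundamentalGroupMulEquivOfPath γ).trans eG.symm⟩

end Cocycle

end CocycleBundle

/-- The group `⟨a₁, …, aₘ₊₁ | (a₁ ⋯ aₘ₊₁)²⟩` is generated by `a₁, …, aₘ` and an element of order
two, subject to no other relations. -/
theorem exists_generators_relAn (m : ℕ) :
    ∃ (α : Fin (m + 1) → PresentedGroup (relAn (m + 1))) (τ : PresentedGroup (relAn (m + 1))),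
      α (Fin.last m) = 1 ∧ τ * τ = 1 ∧ Subgroup.closure (insert τ (Set.range α)) = ⊤ ∧
      ∀ (K : Type) [Group K] (α' : Fin (m + 1) → K) (τ' : K), α' (Fin.last m) = 1 → τ' * τ' = 1 →
        ∃ s : PresentedGroup (relAn (m + 1)) →* K, (∀ i, s (α i) = α' i) ∧ s τ = τ' := by
  let a : Fin (m + 1) → PresentedGroup (relAn (m + 1)) := PresentedGroup.of
  let τ : PresentedGroup (relAn (m + 1)) := (List.ofFn a).prod
  let α : Fin (m + 1) → PresentedGroup (relAn (m + 1)) := fun i => if i = Fin.last m then 1 else a i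
  have hprod : ∀ {H : Type} [Group H] (f : Fin (m + 1) → H),
      (List.ofFn f).prod = (List.ofFn fun i : Fin m => f i.castSucc).prod * f (Fin.last m) := by
    intro H _ f
    rw [List.ofFn_succ']
    simp
  have hαa : ∀ i : Fin m, α i.castSucc = a i.castSucc := fun i => by
    simp [α, Fin.castSucc_ne_last]
  refine ⟨α, τ, by simp [α], ?_, ?_, ?_⟩
  · have h := PresentedGroup.one_of_mem (rels := relAn (m + 1)) (Set.mem_singleton _)
    rw [map_pow, map_list_prod, pow_two, List.map_ofFn] at h
    exact h
  · rw [eq_top_iff, ← PresentedGroup.closure_range_of, Subgroup.closure_le]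
    have hα : ∀ i, α i ∈ Subgroup.closure (insert τ (Set.range α)) := fun i =>
      Subgroup.subset_closure (Or.inr ⟨i, rfl⟩)
    have hτ : τ ∈ Subgroup.closure (insert τ (Set.range α)) :=
      Subgroup.subset_closure (Or.inl rfl)
    rintro _ ⟨i, rfl⟩
    induction i using Fin.lastCases with
    | last =>
      have h : a (Fin.last m) = ((List.ofFn fun i : Fin m => a i.castSucc).prod)⁻¹ * τ := by
        simp only [τ]
        rw [hprod a, inv_mul_cancel_left]
      change a _ ∈ _
      rw [h]
      refine mul_mem (inv_mem (list_prod_mem ?_)) hτ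
      intro x hx
      obtain ⟨j, rfl⟩ := List.mem_ofFn.1 hx
      rw [← hαa]
      exact hα _
    | cast i =>
      change a _ ∈ _
      rw [← hαa]
      exact hα _
  · intro K _ α' τ' hα' hτ'
    let f : Fin (m + 1) → K := Fin.lastCases ((List.ofFn fun i : Fin m => α' i.castSucc).prod⁻¹ * τ')
      fun i => α' i.castSucc
    have hf : (List.ofFn f).prod = τ' := by
      rw [hprod]
      simp [f]
    have hrel : ∀ r ∈ relAn (m + 1), FreeGroup.lift f r = 1 := by
      rintro _ rfl
      rw [map_pow, map_list_prod, List.map_ofFn]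
      have : (FreeGroup.lift f) ∘ (fun i : Fin (m + 1) => FreeGroup.of i) = f := by
        funext i; simp
      rw [this, hf, pow_two, hτ']
    have hs : ∀ i, PresentedGroup.toGroup hrel (a i) = f i := fun i => PresentedGroup.toGroup.of hrel
    refine ⟨PresentedGroup.toGroup hrel, fun i => ?_, ?_⟩
    · induction i using Fin.lastCases with
      | last => simp [α, hα']
      | cast i => rw [hαa, hs]; simp [f]
    · simp only [τ]
      rw [map_list_prod, List.map_ofFn, ← hf]
      congr 2
      funext i
      exact hs i

section ProjectivePlane

theorem isOpenQuotientMap_mk :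
    IsOpenQuotientMap (Projectivization.mk' ℂ : {v : Fin 3 → ℂ // v ≠ 0} → P2) := by
  refine ⟨fun x => ⟨⟨x.rep, x.rep_nonzero⟩, x.mk_rep⟩, continuous_quot_mk, ?_⟩
  intro O hO
  have hq : Topology.IsQuotientMap (Projectivization.mk' ℂ : {v : Fin 3 → ℂ // v ≠ 0} → P2) :=
    isQuotientMap_quot_mk
  rw [← hq.isOpen_preimage]
  have h : Projectivization.mk' ℂ ⁻¹' ((Projectivization.mk' ℂ : {v : Fin 3 → ℂ // v ≠ 0} → P2) '' O) =
      ⋃ a : ℂˣ, (fun v : {v : Fin 3 → ℂ // v ≠ 0} =>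
        (⟨(a : ℂ) • v.1, smul_ne_zero a.ne_zero v.2⟩ : {v : Fin 3 → ℂ // v ≠ 0})) ⁻¹' O := by
    ext v
    simp only [Set.mem_preimage, Set.mem_image, Set.mem_iUnion]
    constructor
    · rintro ⟨w, hw, hwv⟩
      obtain ⟨a, ha⟩ := (Projectivization.mk_eq_mk_iff ℂ w.1 v.1 w.2 v.2).1 hwv
      refine ⟨a, ?_⟩
      convert hw using 1
      exact Subtype.ext ha
    · rintro ⟨a, ha⟩
      exact ⟨_, ha, (Projectivization.mk_eq_mk_iff ℂ _ v.1 _ v.2).2 ⟨a, rfl⟩⟩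
  rw [h]
  refine isOpen_iUnion fun a => hO.preimage ?_
  fun_prop

theorem exists_rep_mk (v : Fin 3 → ℂ) (hv : v ≠ 0) :
    ∃ a : ℂ, a ≠ 0 ∧ (Projectivization.mk ℂ v hv).rep = a • v := by
  obtain ⟨a, ha⟩ := Projectivization.exists_smul_eq_mk_rep ℂ v hv
  exact ⟨a, a.ne_zero, ha.symm⟩

/-- The quotient of two homogeneous coordinates. -/
def coordRatio (i j : Fin 3) (x : P2) : ℂ := x.rep i / x.rep j

theorem coordRatio_mk (i j : Fin 3) (v : Fin 3 → ℂ) (hv : v ≠ 0) :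
    coordRatio i j (Projectivization.mk ℂ v hv) = v i / v j := by
  obtain ⟨a, ha, h⟩ := exists_rep_mk v hv
  simp only [coordRatio, h, Pi.smul_apply, smul_eq_mul]
  exact mul_div_mul_left _ _ ha

theorem rep_mk_eq_zero_iff (j : Fin 3) (v : Fin 3 → ℂ) (hv : v ≠ 0) :
    (Projectivization.mk ℂ v hv).rep j = 0 ↔ v j = 0 := by
  obtain ⟨a, ha, h⟩ := exists_rep_mk v hv
  simp [h, ha]

theorem isOpen_rep_ne_zero (j : Fin 3) : IsOpen {x : P2 | x.rep j ≠ 0} := by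
  rw [← isOpenQuotientMap_mk.isQuotientMap.isOpen_preimage]
  have : (Projectivization.mk' ℂ : {v : Fin 3 → ℂ // v ≠ 0} → P2) ⁻¹' {x : P2 | x.rep j ≠ 0} =
      {v | v.1 j ≠ 0} := by
    ext v
    exact (rep_mk_eq_zero_iff j v.1 v.2).not
  rw [this]
  exact isOpen_ne_fun ((continuous_apply j).comp continuous_subtype_val) continuous_const

theorem continuousAt_coordRatio (i j : Fin 3) {x : P2} (hx : x.rep j ≠ 0) :
    ContinuousAt (coordRatio i j) x := by
  have h : x = Projectivization.mk' ℂ ⟨x.rep, x.rep_nonzero⟩ := x.mk_rep.symm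
  rw [h, ← isOpenQuotientMap_mk.continuousAt_comp_iff]
  have : coordRatio i j ∘ (Projectivization.mk' ℂ : {v : Fin 3 → ℂ // v ≠ 0} → P2) =
      fun v => v.1 i / v.1 j := by
    ext v
    exact coordRatio_mk i j v.1 v.2
  rw [this]
  exact ((continuous_apply i).comp continuous_subtype_val).continuousAt.div
    ((continuous_apply j).comp continuous_subtype_val).continuousAt hx

/-- The point `[1 : t : z]`. -/
def chartX (t z : ℂ) : P2 := Projectivization.mk ℂ ![1, t, z] fun h => by simpa using congrFun h 0

/-- The point `[a : b : 1]`. -/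
def chartZ (a b : ℂ) : P2 := Projectivization.mk ℂ ![a, b, 1] fun h => by simpa using congrFun h 2

theorem continuous_chartX : Continuous fun p : ℂ × ℂ => chartX p.1 p.2 := by
  have h : Continuous fun p : ℂ × ℂ => (⟨![1, p.1, p.2], fun h => by simpa using congrFun h 0⟩ :
    {v : Fin 3 → ℂ // v ≠ 0}) := Continuous.subtype_mk (by
      refine continuous_pi fun i => ?_
      fin_cases i <;> simp <;> fun_prop) _
  exact isOpenQuotientMap_mk.continuous.comp h

theorem continuous_chartZ : Continuous fun p : ℂ × ℂ => chartZ p.1 p.2 := by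
  have h : Continuous fun p : ℂ × ℂ => (⟨![p.1, p.2, 1], fun h => by simpa using congrFun h 2⟩ :
    {v : Fin 3 → ℂ // v ≠ 0}) := Continuous.subtype_mk (by
      refine continuous_pi fun i => ?_
      fin_cases i <;> simp <;> fun_prop) _
  exact isOpenQuotientMap_mk.continuous.comp h

theorem chartX_coordRatio {x : P2} (hx : x.rep 0 ≠ 0) :
    chartX (coordRatio 1 0 x) (coordRatio 2 0 x) = x := by
  conv_rhs => rw [← x.mk_rep]
  refine (Projectivization.mk_eq_mk_iff' ℂ _ _ _ _).2 ⟨(x.rep 0)⁻¹, ?_⟩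
  ext i
  fin_cases i <;> simp [coordRatio, hx, div_eq_inv_mul]

theorem chartZ_coordRatio {x : P2} (hx : x.rep 2 ≠ 0) :
    chartZ (coordRatio 0 2 x) (coordRatio 1 2 x) = x := by
  conv_rhs => rw [← x.mk_rep]
  refine (Projectivization.mk_eq_mk_iff' ℂ _ _ _ _).2 ⟨(x.rep 2)⁻¹, ?_⟩
  ext i
  fin_cases i <;> simp [coordRatio, hx, div_eq_inv_mul]

theorem coordRatio_chartX (t z : ℂ) (i j : Fin 3) :
    coordRatio i j (chartX t z) = ![1, t, z] i / ![1, t, z] j := coordRatio_mk _ _ _ _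

theorem coordRatio_chartZ (a b : ℂ) (i j : Fin 3) :
    coordRatio i j (chartZ a b) = ![a, b, 1] i / ![a, b, 1] j := coordRatio_mk _ _ _ _

theorem rep_chartX (t z : ℂ) (j : Fin 3) : (chartX t z).rep j = 0 ↔ ![1, t, z] j = 0 :=
  rep_mk_eq_zero_iff _ _ _

theorem rep_chartZ (a b : ℂ) (j : Fin 3) : (chartZ a b).rep j = 0 ↔ ![a, b, 1] j = 0 :=
  rep_mk_eq_zero_iff _ _ _

end ProjectivePlane

/-- A retract of a contractible space is contractible. -/
theorem contractibleSpace_of_retract {S U : Type*} [TopologicalSpace S] [TopologicalSpace U]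
    [ContractibleSpace S] (a : C(S, U)) (b : C(U, S)) (h : ∀ u, a (b u) = u) :
    ContractibleSpace U := by
  rw [contractible_iff_id_nullhomotopic]
  have h1 : ContinuousMap.id U = (a.comp (ContinuousMap.id S)).comp b := by
    ext u; exact (h u).symm
  rw [h1]
  exact ((id_nullhomotopic S).comp_right a).comp_left b

section SlitPlane

open Complex

theorem one_sub_div_mem_slitPlane_iff {w d : ℂ} (hw : w ≠ 0) (hd : d ≠ 0) :
    1 - w / d ∈ slitPlane ↔ (arg w = arg d → ‖w‖ < ‖d‖) := by
  have hd' : 0 < ‖d‖ := norm_pos_iff.2 hd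
  by_cases h : arg w = arg d
  · have h1 : w / d = ((‖w‖ / ‖d‖ : ℝ) : ℂ) := by
      have h2 := (arg_eq_arg_iff hd hw).1 h.symm
      rw [div_eq_iff hd, ofReal_div, h2]
    rw [h1, ← ofReal_one, ← ofReal_sub, ofReal_mem_slitPlane, sub_pos, div_lt_one hd']
    simp [h]
  · simp only [h, false_imp_iff, iff_true]
    by_contra hs
    rw [mem_slitPlane_iff] at hs
    push Not at hs
    have h1 : w / d = ((w / d).re : ℂ) := by
      apply Complex.ext
      · simp
      · have := hs.2
        simp at this ⊢
        exact this
    have h2 : 1 ≤ (w / d).re := by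
      have := hs.1
      simp only [sub_re, one_re] at this
      linarith
    apply h
    rw [div_eq_iff hd] at h1
    rw [h1, arg_real_mul _ (by linarith)]

theorem sq_mem_slitPlane {z : ℂ} : z ^ 2 ∈ slitPlane ↔ z.re ≠ 0 := by
  rw [mem_slitPlane_iff, pow_two, mul_re, mul_im]
  constructor
  · intro h h0
    rw [h0] at h
    rcases h with h | h
    · nlinarith [mul_self_nonneg z.im]
    · simp at h
  · intro h
    by_cases h1 : z.im = 0
    · left
      rw [h1]
      have := mul_self_pos.2 h
      linarith
    · right
      rw [mul_comm z.im, ← two_mul]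
      positivity

theorem one_sub_sq_mul_mem_slitPlane {c : ℂ} (h : 1 - c ∈ slitPlane) {s : ℝ} (h0 : 0 ≤ s)
    (h1 : s ≤ 1) : 1 - (s : ℂ) ^ 2 * c ∈ slitPlane := by
  have h2 := starConvex_one_slitPlane h (a := 1 - s ^ 2) (b := s ^ 2) (by nlinarith)
    (by positivity) (by ring)
  convert h2 using 1
  simp
  ring

end SlitPlane

section Sectors

variable {ι : Type*}

/-- The angle `φ` lies below `θ i`, above `-π` and above all `θ j` smaller than `θ i`. -/
def InSector (θ : ι → ℝ) (i : ι) (φ : ℝ) : Prop :=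
  -Real.pi < φ ∧ φ < θ i ∧ ∀ j, θ j < θ i → θ j < φ

variable {θ : ι → ℝ}

theorem InSector.unique (hθ : Function.Injective θ) {i k : ι} {φ : ℝ} (hi : InSector θ i φ)
    (hk : InSector θ k φ) : i = k := by
  apply hθ
  by_contra h
  rcases lt_or_gt_of_ne h with h | h
  · exact (hk.2.2 i h).not_gt hi.2.1
  · exact (hi.2.2 k h).not_gt hk.2.1

theorem InSector.ne {i : ι} {φ : ℝ} (hi : InSector θ i φ) (j : ι) : φ ≠ θ j := by
  intro h
  exact (hi.2.2 j (h ▸ hi.2.1)).ne h.symm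

theorem InSector.combo {i : ι} {φ ψ : ℝ} (hφ : InSector θ i φ) (hψ : InSector θ i ψ) {a b : ℝ}
    (ha : 0 ≤ a) (hb : 0 ≤ b) (hab : a + b = 1) : InSector θ i (a * φ + b * ψ) := by
  have h1 : ∀ c, c < φ → c < ψ → c < a * φ + b * ψ := fun c h h' =>
    convex_Ioi (𝕜 := ℝ) c h h' ha hb hab
  have h2 : ∀ c, φ < c → ψ < c → a * φ + b * ψ < c := fun c h h' =>
    convex_Iio (𝕜 := ℝ) c h h' ha hb hab
  exact ⟨h1 _ hφ.1 hψ.1, h2 _ hφ.2.1 hψ.2.1, fun j hj => h1 _ (hφ.2.2 j hj) (hψ.2.2 j hj)⟩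

variable [Finite ι]

theorem InSector.eventually {i : ι} {φ : ℝ} (hi : InSector θ i φ) :
    ∀ᶠ ψ in nhds φ, InSector θ i ψ := by
  refine (eventually_gt_nhds hi.1).and ((eventually_lt_nhds hi.2.1).and ?_)
  rw [Filter.eventually_all]
  intro j
  by_cases h : θ j < θ i
  · exact (eventually_gt_nhds (hi.2.2 j h)).mono fun _ h _ => h
  · exact Filter.Eventually.of_forall fun _ h' => absurd h' h

theorem exists_inSector (i : ι) (hi : -Real.pi < θ i) : ∃ φ, InSector θ i φ := by
  have h : ∀ᶠ φ in nhdsWithin (θ i) (Set.Iio (θ i)), InSector θ i φ := by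
    refine ((eventually_gt_nhds hi).filter_mono nhdsWithin_le_nhds).and
      (eventually_mem_nhdsWithin.and ?_)
    rw [Filter.eventually_all]
    intro j
    by_cases h : θ j < θ i
    · exact ((eventually_gt_nhds h).filter_mono nhdsWithin_le_nhds).mono fun _ h _ => h
    · exact Filter.Eventually.of_forall fun _ h' => absurd h' h
  exact h.exists

theorem exists_inSector_of_ne {φ : ℝ} (h0 : -Real.pi < φ) {k : ι} (hk : φ < θ k)
    (h : ∀ i, φ ≠ θ i) : ∃ i, InSector θ i φ := by
  classical
  have := Fintype.ofFinite ι
  obtain ⟨i, hi, hmin⟩ := Finset.exists_min_image (Finset.univ.filter fun i => φ < θ i) θ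
    ⟨k, by simpa using hk⟩
  simp only [Finset.mem_filter, Finset.mem_univ, true_and] at hi hmin
  refine ⟨i, h0, hi, fun j hj => ?_⟩
  by_contra hc
  have := hmin j (lt_of_le_of_ne (not_lt.1 hc) (h j))
  linarith

end Sectors

section Pencil

open Complex

variable {ι : Type}

/-- The complement of the conics `x y = dᵢ z²`. -/
def pencilCompl (d : ι → ℂ) : Set P2 := {x | ∀ i, x.rep 0 * x.rep 1 ≠ d i * x.rep 2 ^ 2}

/-- The parameter `x y / z²` of the pencil. -/
def pencilParam (x : P2) : ℂ := coordRatio 0 2 x * coordRatio 1 2 x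

/-- The direction of the half plane used for a chart: `1` or `I`. -/
def axisDir (b : Bool) : ℂ := if b then I else 1

/-- Three simply connected open sets covering the complement of the conics `x y = dᵢ z²` when the
`dᵢ` have distinct arguments. -/
def pencilCover (d : ι → ℂ) : Option Bool → Set P2
  | none => {x | x.rep 2 ≠ 0 ∧ ∀ i, 1 - pencilParam x / d i ∈ slitPlane}
  | some b => {x | x.rep 0 ≠ 0 ∧ coordRatio 1 0 x / axisDir b ^ 2 ∈ slitPlane ∧
      ∀ i, 1 - coordRatio 2 0 x ^ 2 / coordRatio 1 0 x * d i ∈ slitPlane}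

theorem axisDir_ne_zero (b : Bool) : axisDir b ≠ 0 := by
  cases b <;> simp [axisDir]

theorem ne_zero_of_div_mem_slitPlane {t c : ℂ} (h : t / c ∈ slitPlane) : t ≠ 0 := by
  rintro rfl
  simp at h

theorem isOpen_pencilCover [Finite ι] (d : ι → ℂ) (o : Option Bool) :
    IsOpen (pencilCover d o) := by
  rw [isOpen_iff_eventually]
  cases o with
  | none =>
    rintro x ⟨h2, h⟩
    have hw : ContinuousAt pencilParam x :=
      (continuousAt_coordRatio 0 2 h2).mul (continuousAt_coordRatio 1 2 h2)
    refine ((isOpen_rep_ne_zero 2).eventually_mem h2).and (Filter.eventually_all.2 fun i => ?_)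
    exact (continuousAt_const.sub (hw.div_const _)).eventually_mem (isOpen_slitPlane.mem_nhds (h i))
  | some b =>
    rintro x ⟨h0, ht, h⟩
    have h1 := continuousAt_coordRatio 1 0 h0
    have h2 := continuousAt_coordRatio 2 0 h0
    refine ((isOpen_rep_ne_zero 0).eventually_mem h0).and
      (((h1.div_const _).eventually_mem (isOpen_slitPlane.mem_nhds ht)).and
      (Filter.eventually_all.2 fun i => ?_))
    exact (continuousAt_const.sub (((h2.pow 2).div h1
      (ne_zero_of_div_mem_slitPlane ht)).mul_const _)).eventually_mem
      (isOpen_slitPlane.mem_nhds (h i))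

theorem re_exp_half_log_pos {w : ℂ} (hw : w ∈ slitPlane) : 0 < (exp (log w / 2)).re := by
  rw [exp_re]
  refine mul_pos (Real.exp_pos _) (Real.cos_pos_of_mem_Ioo ?_)
  have h1 := neg_pi_lt_arg w
  have h2 := lt_of_le_of_ne (arg_le_pi w) (slitPlane_arg_ne_pi hw)
  have h3 : (log w / 2).im = arg w / 2 := by
    rw [← log_im]
    simp
  rw [h3]
  constructor <;> linarith

theorem exp_half_log_sq {w : ℂ} (hw : w ≠ 0) : exp (log w / 2) ^ 2 = w := by
  rw [← exp_nat_mul, Nat.cast_ofNat, mul_div_cancel₀ _ two_ne_zero, exp_log hw]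

instance contractibleSpace_pencilCover (d : ι → ℂ) (o : Option Bool) :
    ContractibleSpace (pencilCover d o) := by
  cases o with
  | none =>
    let S : Set (ℂ × ℂ) := {p | ∀ i, 1 - p.1 * p.2 / d i ∈ slitPlane}
    have hS : StarConvex ℝ 0 S := by
      rw [starConvex_zero_iff]
      intro p hp a ha0 ha1 i
      convert one_sub_sq_mul_mem_slitPlane (hp i) ha0 ha1 using 2
      simp
      ring
    have : ContractibleSpace S := hS.contractibleSpace ⟨0, fun i => by simp⟩
    refine contractibleSpace_of_retract (S := S)
      ⟨fun p => ⟨chartZ p.1.1 p.1.2, ?_, fun i => ?_⟩, ?_⟩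
      ⟨fun x => ⟨(coordRatio 0 2 x.1, coordRatio 1 2 x.1), fun i => ?_⟩, ?_⟩ fun x => ?_
    · simp [rep_chartZ]
    · simpa [pencilParam, coordRatio_chartZ] using p.2 i
    · exact (continuous_chartZ.comp continuous_subtype_val).subtype_mk _
    · exact x.2.2 i
    · refine Continuous.subtype_mk (continuous_iff_continuousAt.2 fun x => ?_) _
      exact ((continuousAt_coordRatio 0 2 x.2.1).comp continuousAt_subtype_val).prodMk
        ((continuousAt_coordRatio 1 2 x.2.1).comp continuousAt_subtype_val)
    · exact Subtype.ext (chartZ_coordRatio x.2.1)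
  | some b =>
    have hu := axisDir_ne_zero b
    let S : Set (ℂ × ℂ) :=
      {v | 0 < (v / axisDir b).re} ×ˢ {z | ∀ i, 1 - z ^ 2 * d i ∈ slitPlane}
    have hS : StarConvex ℝ (axisDir b, 0) S := by
      refine StarConvex.prod ?_ ?_
      · intro v hv s r hs hr hsr
        have h : ((s • axisDir b + r • v) / axisDir b).re = s + r * (v / axisDir b).re := by
          rw [add_div, real_smul, real_smul, mul_div_assoc, mul_div_assoc, div_self hu,
            add_re, re_ofReal_mul, re_ofReal_mul, one_re, mul_one]
        have hv' : 0 < (v / axisDir b).re := hv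
        change 0 < ((s • axisDir b + r • v) / axisDir b).re
        rw [h]
        rcases hs.eq_or_lt with h0 | h0
        · have : r = 1 := by linarith
          subst this
          linarith
        · positivity
      · rw [starConvex_zero_iff]
        intro z hz a ha0 ha1 i
        convert one_sub_sq_mul_mem_slitPlane (hz i) ha0 ha1 using 2
        simp
        ring
    have : ContractibleSpace S := hS.contractibleSpace
      ⟨(axisDir b, 0), by simp [S, hu]⟩
    let r : P2 → ℂ := fun x => axisDir b * exp (log (coordRatio 1 0 x / axisDir b ^ 2) / 2)
    have hr0 : ∀ x, r x ≠ 0 := fun x => mul_ne_zero hu (exp_ne_zero _)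
    have hr : ∀ x ∈ pencilCover d (some b), r x ^ 2 = coordRatio 1 0 x := by
      rintro x ⟨-, h, -⟩
      simp only [r]
      rw [mul_pow, exp_half_log_sq (slitPlane_ne_zero h), mul_div_cancel₀ _ (pow_ne_zero 2 hu)]
    have hrc : ∀ x ∈ pencilCover d (some b), ContinuousAt r x := by
      rintro x ⟨h0, h, -⟩
      exact continuousAt_const.mul (continuous_exp.continuousAt.comp
        ((((continuousAt_coordRatio 1 0 h0).div_const _).clog h).div_const _))
    refine contractibleSpace_of_retract (S := S)
      ⟨fun p => ⟨chartX (p.1.1 ^ 2) (p.1.1 * p.1.2), ?_, ?_, fun i => ?_⟩, ?_⟩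
      ⟨fun x => ⟨(r x.1, coordRatio 2 0 x.1 / r x.1), ?_, fun i => ?_⟩, ?_⟩ fun x => ?_
    · simp [rep_chartX]
    · have h : 0 < (p.1.1 / axisDir b).re := p.2.1
      simpa [coordRatio_chartX, ← div_pow, sq_mem_slitPlane] using h.ne'
    · have h : 0 < (p.1.1 / axisDir b).re := p.2.1
      have h0 : p.1.1 ≠ 0 := by
        intro h0
        simp [h0] at h
      have h1 : 1 - p.1.2 ^ 2 * d i ∈ slitPlane := p.2.2 i
      simpa [coordRatio_chartX, mul_pow, h0] using h1
    · refine Continuous.subtype_mk (continuous_chartX.comp (?_ : Continuous fun p : S =>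
        ((p.1.1 ^ 2, p.1.1 * p.1.2) : ℂ × ℂ))) _
      fun_prop
    · change 0 < (r x.1 / axisDir b).re
      simp only [r]
      rw [mul_div_cancel_left₀ _ hu]
      exact re_exp_half_log_pos x.2.2.1
    · change 1 - (coordRatio 2 0 x.1 / r x.1) ^ 2 * d i ∈ slitPlane
      rw [div_pow, hr x.1 x.2]
      exact x.2.2.2 i
    · refine Continuous.subtype_mk (continuous_iff_continuousAt.2 fun x => ?_) _
      have h1 := (hrc x.1 x.2).comp continuousAt_subtype_val
      have h2 := (continuousAt_coordRatio 2 0 x.2.1).comp (continuousAt_subtype_val (x := x))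
      exact h1.prodMk (h2.div h1 (hr0 x.1))
    · refine Subtype.ext ?_
      change chartX (r x.1 ^ 2) (r x.1 * (coordRatio 2 0 x.1 / r x.1)) = x.1
      rw [hr x.1 x.2, mul_div_cancel₀ _ (hr0 _), chartX_coordRatio x.2.1]

end Pencil

section PencilOverlap

open Complex

variable {ι : Type} {d : ι → ℂ}

theorem coordRatio_one_eq {x : P2} (h0 : x.rep 0 ≠ 0) (h2 : x.rep 2 ≠ 0) :
    coordRatio 1 0 x = coordRatio 2 0 x ^ 2 * pencilParam x := by
  simp only [pencilParam, coordRatio]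
  field_simp

theorem pencilCover_subset (hd : ∀ i, d i ≠ 0) (o : Option Bool) :
    pencilCover d o ⊆ pencilCompl d := by
  intro x hx i hi
  cases o with
  | none =>
    have h := hx.2 i
    have h1 : pencilParam x / d i = 1 := by
      have h2 := hx.1
      have h3 := hd i
      simp only [pencilParam, coordRatio]
      field_simp
      linear_combination hi
    simp [h1] at h
  | some b =>
    have h := hx.2.2 i
    have ht := ne_zero_of_div_mem_slitPlane hx.2.1
    have h1 : coordRatio 2 0 x ^ 2 / coordRatio 1 0 x * d i = 1 := by
      have h0 := hx.1
      have h3 : x.rep 1 ≠ 0 := fun h3 => ht (by simp [coordRatio, h3])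
      simp only [coordRatio]
      field_simp
      linear_combination -hi
    simp [h1] at h

theorem exists_mem_pencilCover [Nonempty ι] (hd : ∀ i, d i ≠ 0)
    (harg : Function.Injective fun i => arg (d i))
    {x : P2} (hx : x ∈ pencilCompl d) : ∃ o, x ∈ pencilCover d o := by
  have hsome : x.rep 0 * x.rep 1 ≠ 0 →
      (∀ i, 1 - coordRatio 2 0 x ^ 2 / coordRatio 1 0 x * d i ∈ slitPlane) →
      ∃ o, x ∈ pencilCover d o := by
    intro h h'
    have h0 := left_ne_zero_of_mul h
    have ht : coordRatio 1 0 x ≠ 0 := div_ne_zero (right_ne_zero_of_mul h) h0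
    rcases mem_slitPlane_or_neg_mem_slitPlane ht with h1 | h1
    · exact ⟨some false, h0, by simpa [axisDir] using h1, h'⟩
    · exact ⟨some true, h0, by simpa [axisDir, div_neg] using h1, h'⟩
  by_cases h2 : x.rep 2 = 0
  · apply hsome
    · intro h
      exact hx (Classical.arbitrary ι) (by rw [h, h2]; simp)
    · intro i
      simp [coordRatio, h2]
  by_cases hn : ∀ i, 1 - pencilParam x / d i ∈ slitPlane
  · exact ⟨none, h2, hn⟩
  push Not at hn
  obtain ⟨i, hi⟩ := hn
  have hw : pencilParam x ≠ 0 := by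
    intro hw
    simp [hw] at hi
  have h01 : x.rep 0 * x.rep 1 ≠ 0 := by
    intro h
    apply hw
    rw [pencilParam, coordRatio, coordRatio, div_mul_div_comm, h, zero_div]
  have h0 := left_ne_zero_of_mul h01
  rw [one_sub_div_mem_slitPlane_iff hw (hd i)] at hi
  push Not at hi
  refine hsome h01 fun j => ?_
  have hz : coordRatio 2 0 x ≠ 0 := div_ne_zero h2 h0
  have h3 : coordRatio 2 0 x ^ 2 / coordRatio 1 0 x * d j = d j / pencilParam x := by
    rw [coordRatio_one_eq h0 h2]
    field_simp
  rw [h3, one_sub_div_mem_slitPlane_iff (hd j) hw]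
  intro hj
  have hij : j = i := harg (hj.trans hi.1)
  subst hij
  refine lt_of_le_of_ne hi.2 fun h => ?_
  have h4 : d j = pencilParam x := Complex.ext_norm_arg h hj
  apply hx j
  rw [h4, pencilParam, coordRatio, coordRatio]
  field_simp

/-- A square root of `y / x` determined by a square root of `x y / z²`. -/
def rootParam (x : P2) : ℂ := coordRatio 2 0 x * exp (log (pencilParam x) / 2)

/-- The point with `log (x y / z²) = L` and square root `v` of `y / x`. -/
def overlapPoint (L v : ℂ) : P2 := chartX (v ^ 2) (v * exp (-(L / 2)))

theorem continuous_overlapPoint : Continuous fun p : ℂ × ℂ => overlapPoint p.1 p.2 :=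
  continuous_chartX.comp (f := fun p : ℂ × ℂ => ((p.2 ^ 2, p.2 * exp (-(p.1 / 2))) : ℂ × ℂ))
    (by fun_prop)

theorem rootParam_sq {x : P2} (h0 : x.rep 0 ≠ 0) (h2 : x.rep 2 ≠ 0) (hw : pencilParam x ≠ 0) :
    rootParam x ^ 2 = coordRatio 1 0 x := by
  rw [rootParam, mul_pow, exp_half_log_sq hw, coordRatio_one_eq h0 h2]

theorem overlapPoint_rootParam {x : P2} (h0 : x.rep 0 ≠ 0) (h2 : x.rep 2 ≠ 0)
    (hw : pencilParam x ≠ 0) : overlapPoint (log (pencilParam x)) (rootParam x) = x := by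
  rw [overlapPoint, rootParam_sq h0 h2 hw, rootParam, mul_assoc, ← exp_add, add_neg_cancel,
    exp_zero, mul_one, chartX_coordRatio h0]

theorem pencilParam_ne_zero_of_mem {b : Bool} {x : P2} (h2 : x.rep 2 ≠ 0)
    (hx : x ∈ pencilCover d (some b)) : pencilParam x ≠ 0 := by
  have := ne_zero_of_div_mem_slitPlane hx.2.1
  rw [coordRatio_one_eq hx.1 h2] at this
  exact right_ne_zero_of_mul this

theorem rootParam_div_re_ne_zero {b : Bool} {x : P2} (h2 : x.rep 2 ≠ 0)
    (hx : x ∈ pencilCover d (some b)) : (rootParam x / axisDir b).re ≠ 0 := by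
  rw [← sq_mem_slitPlane, div_pow,
    rootParam_sq hx.1 h2 (pencilParam_ne_zero_of_mem h2 hx)]
  exact hx.2.1

theorem arg_pencilParam_ne (hd : ∀ i, d i ≠ 0) {b : Bool} {x : P2} (hx : x ∈ pencilCover d none)
    (hx' : x ∈ pencilCover d (some b)) (i : ι) : arg (pencilParam x) ≠ arg (d i) := by
  intro h
  have hw := pencilParam_ne_zero_of_mem hx.1 hx'
  have h1 := (one_sub_div_mem_slitPlane_iff hw (hd i)).1 (hx.2 i) h
  have hz : coordRatio 2 0 x ≠ 0 := div_ne_zero hx.1 hx'.1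
  have h3 : coordRatio 2 0 x ^ 2 / coordRatio 1 0 x * d i = d i / pencilParam x := by
    rw [coordRatio_one_eq hx'.1 hx.1]
    field_simp
  have h2 := hx'.2.2 i
  rw [h3] at h2
  exact lt_asymm h1 ((one_sub_div_mem_slitPlane_iff (hd i) hw).1 h2 h.symm)

theorem exists_inSector_of_mem [Finite ι] (hd : ∀ i, d i ≠ 0) {k : ι} (hk : arg (d k) = Real.pi)
    {b : Bool} {x : P2} (hx : x ∈ pencilCover d none) (hx' : x ∈ pencilCover d (some b)) :
    ∃ i, InSector (fun i => arg (d i)) i (arg (pencilParam x)) := by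
  have h := arg_pencilParam_ne hd hx hx'
  refine exists_inSector_of_ne (k := k) (neg_pi_lt_arg _) (lt_of_le_of_ne ?_ (h k)) h
  simp only [hk]
  exact arg_le_pi _

section OverlapPoint

variable {i : ι} {L v : ℂ}

theorem pencilParam_overlapPoint (hv : v ≠ 0) : pencilParam (overlapPoint L v) = exp L := by
  have h : exp L = exp (L / 2) ^ 2 := by rw [← exp_nat_mul]; congr 1; push_cast; ring
  simp [pencilParam, overlapPoint, coordRatio_chartX, exp_neg, h]
  field_simp

theorem log_pencilParam_overlapPoint (hL : InSector (fun i => arg (d i)) i L.im)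
    (hv : v ≠ 0) :
    log (pencilParam (overlapPoint L v)) = L := by
  rw [pencilParam_overlapPoint hv, log_exp hL.1 (hL.2.1.le.trans (arg_le_pi _))]

theorem rootParam_overlapPoint (hL : InSector (fun i => arg (d i)) i L.im)
    (hv : v ≠ 0) : rootParam (overlapPoint L v) = v := by
  rw [rootParam, log_pencilParam_overlapPoint hL hv, overlapPoint, coordRatio_chartX]
  simp [mul_assoc, ← exp_add]

theorem overlapPoint_mem_none (hL : InSector (fun i => arg (d i)) i L.im)
    (hd : ∀ i, d i ≠ 0) (hv : v ≠ 0) :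
    overlapPoint L v ∈ pencilCover d none := by
  refine ⟨by simp [overlapPoint, rep_chartX, hv], fun j => ?_⟩
  rw [pencilParam_overlapPoint hv, one_sub_div_mem_slitPlane_iff (exp_ne_zero _) (hd j)]
  intro h
  rw [← log_im, log_exp hL.1 (hL.2.1.le.trans (arg_le_pi _))] at h
  exact absurd h (hL.ne j)

theorem overlapPoint_mem_some (hL : InSector (fun i => arg (d i)) i L.im)
    (hd : ∀ i, d i ≠ 0) {b : Bool} (hv : (v / axisDir b).re ≠ 0) :
    overlapPoint L v ∈ pencilCover d (some b) := by
  have hv0 : v ≠ 0 := by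
    rintro rfl
    simp at hv
  refine ⟨by simp [overlapPoint, rep_chartX], ?_, fun j => ?_⟩
  · simpa [overlapPoint, coordRatio_chartX, ← div_pow, sq_mem_slitPlane] using hv
  · have h : exp L = exp (L / 2) ^ 2 := by rw [← exp_nat_mul]; congr 1; push_cast; ring
    have h1 : coordRatio 2 0 (overlapPoint L v) ^ 2 / coordRatio 1 0 (overlapPoint L v) * d j =
        d j / exp L := by
      simp [overlapPoint, coordRatio_chartX, exp_neg, h]
      field_simp
    rw [h1, one_sub_div_mem_slitPlane_iff (hd j) (exp_ne_zero _)]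
    intro h
    rw [← log_im (exp L), log_exp hL.1 (hL.2.1.le.trans (arg_le_pi _))] at h
    exact absurd h.symm (hL.ne j)

end OverlapPoint

end PencilOverlap

section PencilPaths

open Complex

theorem JoinedIn.of_convex_image {E A : Type*} [AddCommGroup E] [Module ℝ E] [TopologicalSpace E]
    [ContinuousAdd E] [ContinuousSMul ℝ E] [TopologicalSpace A] {S : Set E} (hS : Convex ℝ S)
    {f : E → A} (hf : Continuous f) {F : Set A} (hF : ∀ p ∈ S, f p ∈ F) {p q : E} (hp : p ∈ S)
    (hq : q ∈ S) : JoinedIn F (f p) (f q) :=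
  (((hS.isPathConnected ⟨p, hp⟩).joinedIn p hp q hq).map hf).mono (Set.image_subset_iff.2 hF)

theorem JoinedIn.preimage_val {A : Type*} [TopologicalSpace A] {Y F : Set A} (hF : F ⊆ Y)
    {x x' : Y} (h : JoinedIn F (x : A) x') : JoinedIn (Subtype.val ⁻¹' F : Set Y) x x' := by
  obtain ⟨γ, hγ⟩ := h
  exact ⟨{ toFun := fun t => ⟨γ t, hF (hγ t)⟩
           continuous_toFun := by fun_prop
           source' := by simp
           target' := by simp }, hγ⟩

theorem div_axisDir_re (v : ℂ) (b : Bool) : (v / axisDir b).re = if b then v.im else v.re := by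
  cases b <;> simp [axisDir]

theorem mem_slitPlane_div_axisDir_sq {t : ℂ} (ht : t.im ≠ 0) (b : Bool) :
    t / axisDir b ^ 2 ∈ slitPlane := by
  cases b <;> simp [axisDir, mem_slitPlane_iff, div_neg, ht]

variable {ι : Type} {d : ι → ℂ}

theorem im_ne_zero_of_mem_inter {x : P2} (hx : x ∈ pencilCover d (some false))
    (hx' : x ∈ pencilCover d (some true)) : (coordRatio 1 0 x).im ≠ 0 := by
  have h1 := hx.2.1
  have h2 := hx'.2.1
  simp only [axisDir, mem_slitPlane_iff] at h1 h2
  intro h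
  simp [h, div_neg] at h1 h2
  linarith

theorem joinedIn_none_some (hd : ∀ i, d i ≠ 0) {b : Bool} {x x' : P2}
    (hx : x ∈ pencilCover d none ∩ pencilCover d (some b))
    (hx' : x' ∈ pencilCover d none ∩ pencilCover d (some b)) {i : ι}
    (hi : InSector (fun i => arg (d i)) i (arg (pencilParam x)))
    (hi' : InSector (fun i => arg (d i)) i (arg (pencilParam x')))
    (hs : (rootParam x / axisDir b).re < 0 ↔ (rootParam x' / axisDir b).re < 0) :
    JoinedIn (pencilCover d none ∩ pencilCover d (some b)) x x' := by
  obtain ⟨s, h, h'⟩ : ∃ s : ℝ, 0 < s * (rootParam x / axisDir b).re ∧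
      0 < s * (rootParam x' / axisDir b).re := by
    have h1 := rootParam_div_re_ne_zero hx.1.1 hx.2
    have h2 := rootParam_div_re_ne_zero hx'.1.1 hx'.2
    by_cases h : (rootParam x / axisDir b).re < 0
    · exact ⟨-1, by linarith, by linarith [hs.1 h]⟩
    · exact ⟨1, by linarith [lt_of_le_of_ne (not_lt.1 h) h1.symm],
        by linarith [lt_of_le_of_ne (not_lt.1 (mt hs.2 h)) h2.symm]⟩
  let S : Set (ℂ × ℂ) :=
    {p | InSector (fun i => arg (d i)) i p.1.im ∧ 0 < s * (p.2 / axisDir b).re}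
  have hS : Convex ℝ S := by
    rintro p hp q hq a c ha hc hac
    constructor
    · have := hp.1.combo hq.1 ha hc hac
      simpa using this
    · have h1 := convex_Ioi (𝕜 := ℝ) (0 : ℝ) hp.2 hq.2 ha hc hac
      have h2 : s * ((a • p + c • q).2 / axisDir b).re =
          a • (s * (p.2 / axisDir b).re) + c • (s * (q.2 / axisDir b).re) := by
        simp only [div_axisDir_re]
        cases b <;> simp <;> ring
      exact h2 ▸ h1
  have hw := pencilParam_ne_zero_of_mem hx.1.1 hx.2
  have hw' := pencilParam_ne_zero_of_mem hx'.1.1 hx'.2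
  rw [← overlapPoint_rootParam hx.2.1 hx.1.1 hw, ← overlapPoint_rootParam hx'.2.1 hx'.1.1 hw']
  refine JoinedIn.of_convex_image hS continuous_overlapPoint (fun p hp => ?_)
    (p := (log (pencilParam x), rootParam x)) (q := (log (pencilParam x'), rootParam x'))
    ⟨by simpa [log_im] using hi, h⟩ ⟨by simpa [log_im] using hi', h'⟩
  have h1 : (p.2 / axisDir b).re ≠ 0 := right_ne_zero_of_mul hp.2.ne'
  have h2 : p.2 ≠ 0 := by
    intro h2
    simp [h2] at h1
  exact ⟨overlapPoint_mem_none hp.1 hd h2, overlapPoint_mem_some hp.1 hd h1⟩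

theorem joinedIn_some_some {x x' : P2}
    (hx : x ∈ pencilCover d (some false) ∩ pencilCover d (some true))
    (hx' : x' ∈ pencilCover d (some false) ∩ pencilCover d (some true))
    (hs : (coordRatio 1 0 x).im < 0 ↔ (coordRatio 1 0 x').im < 0) :
    JoinedIn (pencilCover d (some false) ∩ pencilCover d (some true)) x x' := by
  have key : ∀ {x}, x ∈ pencilCover d (some false) ∩ pencilCover d (some true) →
      JoinedIn (pencilCover d (some false) ∩ pencilCover d (some true)) x
        (chartX (coordRatio 1 0 x) 0) := by
    intro x hx
    have h := JoinedIn.of_convex_image (convex_Icc (0 : ℝ) 1)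
      (f := fun s : ℝ => chartX (coordRatio 1 0 x) (s * coordRatio 2 0 x))
      (continuous_chartX.comp (f := fun s : ℝ =>
        ((coordRatio 1 0 x, s * coordRatio 2 0 x) : ℂ × ℂ)) (by fun_prop))
      (F := pencilCover d (some false) ∩ pencilCover d (some true)) (p := 1) (q := 0)
      (fun s hs => ?_) (by simp) (by simp)
    · simpa [chartX_coordRatio hx.1.1] using h
    · have h2 : ∀ i, 1 - (s * coordRatio 2 0 x) ^ 2 / coordRatio 1 0 x * d i ∈ slitPlane := by
        intro i
        convert one_sub_sq_mul_mem_slitPlane (hx.1.2.2 i) hs.1 hs.2 using 2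
        ring
      refine ⟨⟨by simp [rep_chartX], ?_, ?_⟩, ⟨by simp [rep_chartX], ?_, ?_⟩⟩
      · simpa [coordRatio_chartX] using hx.1.2.1
      · simpa [coordRatio_chartX] using h2
      · simpa [coordRatio_chartX] using hx.2.2.1
      · simpa [coordRatio_chartX] using h2
  refine (key hx).trans (JoinedIn.trans ?_ (key hx').symm)
  obtain ⟨s, h, h'⟩ : ∃ s : ℝ, 0 < s * (coordRatio 1 0 x).im ∧ 0 < s * (coordRatio 1 0 x').im := by
    have h1 := im_ne_zero_of_mem_inter hx.1 hx.2
    have h2 := im_ne_zero_of_mem_inter hx'.1 hx'.2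
    by_cases h : (coordRatio 1 0 x).im < 0
    · exact ⟨-1, by linarith, by linarith [hs.1 h]⟩
    · exact ⟨1, by linarith [lt_of_le_of_ne (not_lt.1 h) h1.symm],
        by linarith [lt_of_le_of_ne (not_lt.1 (mt hs.2 h)) h2.symm]⟩
  have hS : Convex ℝ {t : ℂ | 0 < s * t.im} := by
    intro p hp q hq a c ha hc hac
    have h1 := convex_Ioi (𝕜 := ℝ) (0 : ℝ) hp hq ha hc hac
    have h2 : s * (a • p + c • q).im = a • (s * p.im) + c • (s * q.im) := by
      simp
      ring
    change 0 < s * (a • p + c • q).im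
    rw [h2]
    exact h1
  refine JoinedIn.of_convex_image hS (f := fun t => chartX t 0)
    (continuous_chartX.comp (f := fun t : ℂ => ((t, 0) : ℂ × ℂ)) (by fun_prop))
    (fun t ht => ?_) h h'
  have ht' : t.im ≠ 0 := right_ne_zero_of_mul (ne_of_gt ht)
  have h1 := mem_slitPlane_div_axisDir_sq ht'
  exact ⟨⟨by simp [rep_chartX], by simpa [coordRatio_chartX] using h1 false,
      by simp [coordRatio_chartX]⟩,
    ⟨by simp [rep_chartX], by simpa [coordRatio_chartX] using h1 true,
      by simp [coordRatio_chartX]⟩⟩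

end PencilPaths

section PencilCocycle

open Complex

variable {ι : Type} {d : ι → ℂ}

open Classical in
/-- The index of the sector containing an angle. -/
def sectorLabel [Nonempty ι] (θ : ι → ℝ) (φ : ℝ) : ι :=
  if h : ∃ i, InSector θ i φ then h.choose else Classical.arbitrary ι

theorem InSector.sectorLabel_eq [Nonempty ι] {θ : ι → ℝ} (hθ : Function.Injective θ) {i : ι} {φ : ℝ}
    (hi : InSector θ i φ) : sectorLabel θ φ = i := by
  have h : ∃ i, InSector θ i φ := ⟨i, hi⟩
  rw [sectorLabel, dif_pos h]
  exact h.choose_spec.unique hθ hi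

section Frame

variable [Nonempty ι] {G : Type} [Group G] (d) (α : ι → G) (τ : G)

open Classical in
/-- The sections over the sets of `pencilCover` whose quotients form the universal cocycle. -/
def pencilFrame : Option Bool → P2 → G
  | none, _ => 1
  | some b, x =>
    if x.rep 2 = 0 then if b = true ∧ (coordRatio 1 0 x).im < 0 then τ else 1
    else α (sectorLabel (fun i => arg (d i)) (arg (pencilParam x))) *
      if (rootParam x / axisDir b).re < 0 then τ else 1

/-- The transition functions between the sections `pencilFrame`. -/
def pencilCocycle (o o' : Option Bool) (x : P2) : G :=
  (pencilFrame d α τ o x)⁻¹ * pencilFrame d α τ o' x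

variable {d α τ}

theorem pencilCocycle_mul (o o' o'' : Option Bool) (x : P2) :
    pencilCocycle d α τ o o' x * pencilCocycle d α τ o' o'' x = pencilCocycle d α τ o o'' x := by
  simp [pencilCocycle, mul_assoc]

theorem pencilCocycle_self (o : Option Bool) (x : P2) : pencilCocycle d α τ o o x = 1 := by
  simp [pencilCocycle]

theorem pencilCocycle_inv (o o' : Option Bool) (x : P2) :
    (pencilCocycle d α τ o o' x)⁻¹ = pencilCocycle d α τ o' o x := by
  simp [pencilCocycle]

open Classical in
theorem pencilCocycle_none_some (harg : Function.Injective fun i => arg (d i)) {b : Bool} {x : P2}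
    (h2 : x.rep 2 ≠ 0) {i : ι} (hi : InSector (fun i => arg (d i)) i (arg (pencilParam x))) :
    pencilCocycle d α τ none (some b) x =
      α i * if (rootParam x / axisDir b).re < 0 then τ else 1 := by
  simp [pencilCocycle, pencilFrame, h2, hi.sectorLabel_eq harg]

open Classical in
theorem pencilCocycle_some_some (hτ : τ * τ = 1) {x : P2}
    (hx : x ∈ pencilCover d (some false)) (hx' : x ∈ pencilCover d (some true)) :
    pencilCocycle d α τ (some false) (some true) x =
      if (coordRatio 1 0 x).im < 0 then τ else 1 := by
  by_cases h2 : x.rep 2 = 0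
  · simp [pencilCocycle, pencilFrame, h2]
  have hv := rootParam_sq hx.1 h2 (pencilParam_ne_zero_of_mem h2 hx)
  have h1 := rootParam_div_re_ne_zero h2 hx
  have h1' := rootParam_div_re_ne_zero h2 hx'
  simp only [pencilCocycle, pencilFrame, h2, if_false, ← hv]
  generalize rootParam x = v at *
  simp only [div_axisDir_re, sq, mul_im] at *
  have hτ' : τ⁻¹ = τ := inv_eq_of_mul_eq_one_left hτ
  simp only [Bool.false_eq_true, if_false, if_true, ne_eq] at h1 h1' ⊢
  have h3 : v.re * v.im + v.im * v.re < 0 ↔ (v.re < 0 ↔ ¬ v.im < 0) := by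
    rcases lt_or_gt_of_ne h1 with h | h <;> rcases lt_or_gt_of_ne h1' with h' | h' <;>
    simp only [h, h', not_lt.2 h.le, not_lt.2 h'.le] <;> simp <;> nlinarith
  by_cases h : v.re < 0 <;> by_cases h' : v.im < 0 <;> simp [h3, h, h', hτ', hτ]

theorem eventually_pencilCocycle [Finite ι] (hd : ∀ i, d i ≠ 0)
    (harg : Function.Injective fun i => arg (d i)) {k : ι} (hk : arg (d k) = Real.pi)
    (hτ : τ * τ = 1) (o o' : Option Bool) {x : P2} (hx : x ∈ pencilCover d o)
    (hx' : x ∈ pencilCover d o') :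
    ∀ᶠ z in nhds x, pencilCocycle d α τ o o' z = pencilCocycle d α τ o o' x := by
  have hsymm : ∀ {o o' : Option Bool},
      (∀ᶠ z in nhds x, pencilCocycle d α τ o o' z = pencilCocycle d α τ o o' x) →
      ∀ᶠ z in nhds x, pencilCocycle d α τ o' o z = pencilCocycle d α τ o' o x := fun h =>
    h.mono fun z hz => by rw [← pencilCocycle_inv, hz, pencilCocycle_inv]
  have hself : ∀ o : Option Bool,
      ∀ᶠ z in nhds x, pencilCocycle d α τ o o z = pencilCocycle d α τ o o x := fun o =>
    Filter.Eventually.of_forall fun z => by rw [pencilCocycle_self, pencilCocycle_self]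
  have hsign : ∀ {f : P2 → ℝ}, ContinuousAt f x → f x ≠ 0 →
      ∀ᶠ z in nhds x, (f z < 0 ↔ f x < 0) := by
    intro f hf h0
    rcases lt_or_gt_of_ne h0 with h | h
    · filter_upwards [hf.eventually_lt_const h] with z hz using iff_of_true hz h
    · filter_upwards [hf.eventually_const_lt h] with z hz using iff_of_false hz.not_gt h.not_gt
  have hnone : ∀ {b : Bool}, x ∈ pencilCover d none → x ∈ pencilCover d (some b) →
      ∀ᶠ z in nhds x, pencilCocycle d α τ none (some b) z =
        pencilCocycle d α τ none (some b) x := by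
    intro b hx hx'
    obtain ⟨i, hi⟩ := exists_inSector_of_mem hd hk hx hx'
    have hw : pencilParam x ∈ slitPlane := by
      rw [mem_slitPlane_iff_arg]
      exact ⟨hk ▸ arg_pencilParam_ne hd hx hx' k, pencilParam_ne_zero_of_mem hx.1 hx'⟩
    have hwc : ContinuousAt pencilParam x :=
      (continuousAt_coordRatio 0 2 hx.1).mul (continuousAt_coordRatio 1 2 hx.1)
    have hvc : ContinuousAt rootParam x := (continuousAt_coordRatio 2 0 hx'.1).mul
      (continuous_exp.continuousAt.comp ((hwc.clog hw).div_const 2))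
    have hac : ContinuousAt (fun z => arg (pencilParam z)) x :=
      ContinuousAt.comp (g := arg) (continuousAt_arg hw) hwc
    filter_upwards [(isOpen_rep_ne_zero 2).eventually_mem hx.1, hac.eventually hi.eventually,
      hsign (f := fun z => (rootParam z / axisDir b).re)
        (continuous_re.continuousAt.comp (hvc.div_const _))
        (rootParam_div_re_ne_zero hx.1 hx')] with z h1 h2 h3
    rw [pencilCocycle_none_some harg h1 h2, pencilCocycle_none_some harg hx.1 hi]
    simp only [h3]
  have hsome : x ∈ pencilCover d (some false) → x ∈ pencilCover d (some true) →
      ∀ᶠ z in nhds x, pencilCocycle d α τ (some false) (some true) z =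
        pencilCocycle d α τ (some false) (some true) x := by
    intro hx hx'
    filter_upwards [(isOpen_pencilCover d _).eventually_mem hx,
      (isOpen_pencilCover d _).eventually_mem hx',
      hsign (f := fun z => (coordRatio 1 0 z).im)
        (continuous_im.continuousAt.comp (continuousAt_coordRatio 1 0 hx.1))
        (im_ne_zero_of_mem_inter hx hx')] with z h1 h2 h3
    rw [pencilCocycle_some_some hτ h1 h2, pencilCocycle_some_some hτ hx hx']
    simp only [h3]
  match o, o' with
  | none, none => exact hself _
  | none, some _ => exact hnone hx hx'
  | some _, none => exact hsymm (hnone hx' hx)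
  | some false, some false => exact hself _
  | some false, some true => exact hsome hx hx'
  | some true, some false => exact hsymm (hsome hx' hx)
  | some true, some true => exact hself _

end Frame

open Classical in
theorem exists_eq_of_cocycle (hd : ∀ i, d i ≠ 0) {k : ι}
    {L : ι → ℂ} (hL : ∀ i, InSector (fun i => arg (d i)) i (L i).im)
    {K : Type} [Group K] {h : Option Bool → Option Bool → P2 → K}
    (hmul : ∀ o o' o'' x, x ∈ pencilCover d o → x ∈ pencilCover d o' → x ∈ pencilCover d o'' →
      h o o' x * h o' o'' x = h o o'' x)
    (hjoin : ∀ o o' x x', JoinedIn (pencilCover d o ∩ pencilCover d o') x x' →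
      h o o' x = h o o' x')
    (hbase : ∀ o o', h o o' (overlapPoint (L k) (1 + I)) = 1) :
    ∃ (α : ι → K) (τ : K), α k = 1 ∧ τ * τ = 1 ∧
      (∀ b x i, x ∈ pencilCover d none → x ∈ pencilCover d (some b) →
        InSector (fun i => arg (d i)) i (arg (pencilParam x)) →
        h none (some b) x = α i * if (rootParam x / axisDir b).re < 0 then τ else 1) ∧
      ∀ x, x ∈ pencilCover d (some false) → x ∈ pencilCover d (some true) →
        h (some false) (some true) x = if (coordRatio 1 0 x).im < 0 then τ else 1 := by
  have hmem0 : ∀ i {v : ℂ}, v.re ≠ 0 → overlapPoint (L i) v ∈ pencilCover d none := by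
    intro i v hv
    refine overlapPoint_mem_none (hL i) hd ?_
    rintro rfl
    simp at hv
  have hmem : ∀ i b {v : ℂ}, v.re ≠ 0 → v.im ≠ 0 →
      overlapPoint (L i) v ∈ pencilCover d (some b) := by
    intro i b v hv hv'
    refine overlapPoint_mem_some (hL i) hd ?_
    rw [div_axisDir_re]
    split_ifs <;> assumption
  have him : ∀ i (v : ℂ), (coordRatio 1 0 (overlapPoint (L i) v)).im = 2 * (v.re * v.im) := by
    intro i v
    simp [overlapPoint, coordRatio_chartX, sq]
    ring
  have hsome : ∀ {x}, x ∈ pencilCover d (some false) → x ∈ pencilCover d (some true) →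
      ∀ i (v : ℂ), v.re ≠ 0 → v.im ≠ 0 → ((coordRatio 1 0 x).im < 0 ↔ v.re * v.im < 0) →
      h (some false) (some true) x = h (some false) (some true) (overlapPoint (L i) v) := by
    intro x hx hx' i v hv hv' hs
    refine hjoin _ _ _ _ (joinedIn_some_some ⟨hx, hx'⟩ ⟨hmem i _ hv hv', hmem i _ hv hv'⟩ ?_)
    rw [hs, him]
    constructor <;> intro <;> linarith
  have hnone : ∀ {b x i}, x ∈ pencilCover d none → x ∈ pencilCover d (some b) →
      InSector (fun i => arg (d i)) i (arg (pencilParam x)) →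
      ∀ (v : ℂ), v.re ≠ 0 → v.im ≠ 0 →
      ((rootParam x / axisDir b).re < 0 ↔ (v / axisDir b).re < 0) →
      h none (some b) x = h none (some b) (overlapPoint (L i) v) := by
    intro b x i hx hx' hi v hv hv' hs
    have hv0 : v ≠ 0 := by
      rintro rfl
      simp at hv
    refine hjoin _ _ _ _ (joinedIn_none_some hd ⟨hx, hx'⟩ ⟨hmem0 i hv, hmem i _ hv hv'⟩ hi ?_ ?_)
    · rw [← log_im, log_pencilParam_overlapPoint (hL i) hv0]
      exact hL i
    · rw [hs, rootParam_overlapPoint (hL i) hv0]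
  have hsector : ∀ i {v : ℂ}, v.re ≠ 0 → InSector (fun i => arg (d i)) i
      (arg (pencilParam (overlapPoint (L i) v))) := by
    intro i v hv
    rw [← log_im, log_pencilParam_overlapPoint (hL i) (by rintro rfl; simp at hv)]
    exact hL i
  have hswitch : ∀ b i {v v' : ℂ}, v.re ≠ 0 → v.im ≠ 0 → v'.re ≠ 0 → v'.im ≠ 0 →
      ((v / axisDir b).re < 0 ↔ (v' / axisDir b).re < 0) →
      h none (some b) (overlapPoint (L i) v) = h none (some b) (overlapPoint (L i) v') := by
    intro b i v v' hv hvi hv' hvi' hs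
    refine hnone (hmem0 i hv) (hmem i b hv hvi) (hsector i hv) _ hv' hvi' ?_
    rwa [rootParam_overlapPoint (hL i) (by rintro rfl; simp at hv)]
  let α : ι → K := fun i => h none (some false) (overlapPoint (L i) (1 + I))
  let τ : K := h (some false) (some true) (overlapPoint (L k) (1 - I))
  have h10 : ¬ (1 : ℝ) < 0 := zero_le_one.not_gt
  have hpos : ∀ {x}, x ∈ pencilCover d (some false) → x ∈ pencilCover d (some true) →
      ¬ (coordRatio 1 0 x).im < 0 → h (some false) (some true) x = 1 := by
    intro x hx hx' h0
    rw [hsome hx hx' k (1 + I) (by simp) (by simp) (by simpa [h10] using h0), hbase]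
  have hneg : ∀ {x}, x ∈ pencilCover d (some false) → x ∈ pencilCover d (some true) →
      (coordRatio 1 0 x).im < 0 → h (some false) (some true) x = τ := by
    intro x hx hx' h0
    exact hsome hx hx' k (1 - I) (by simp) (by simp) (by simpa using h0)
  have hcoc : ∀ i {v : ℂ}, v.re ≠ 0 → v.im ≠ 0 → h none (some false) (overlapPoint (L i) v) *
      (if v.re * v.im < 0 then τ else 1) = h none (some true) (overlapPoint (L i) v) := by
    intro i v hv hv'
    rw [← hmul none (some false) (some true) _ (hmem0 i hv) (hmem i _ hv hv') (hmem i _ hv hv')]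
    congr 1
    split_ifs with h0
    · rw [hneg (hmem i _ hv hv') (hmem i _ hv hv') (by rw [him]; linarith)]
    · rw [hpos (hmem i _ hv hv') (hmem i _ hv hv') (by rw [him]; linarith)]
  have hB : ∀ i, h none (some true) (overlapPoint (L i) (1 + I)) = α i := fun i => by
    simpa [h10] using (hcoc i (v := 1 + I) (by simp) (by simp)).symm
  have h2 : ∀ i, h none (some false) (overlapPoint (L i) (-1 + I)) * τ = α i := fun i => by
    have := hcoc i (v := -1 + I) (by simp) (by simp)
    rw [hswitch true i (v' := 1 + I) (by simp) (by simp) (by simp) (by simp)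
      (by simp [div_axisDir_re]), hB] at this
    simpa using this
  have h3 : ∀ i, h none (some false) (overlapPoint (L i) (-1 + I)) =
      h none (some true) (overlapPoint (L i) (-1 - I)) := fun i => by
    rw [← hcoc i (v := -1 - I) (by simp) (by simp), hswitch false i (v' := -1 - I) (by simp)
      (by simp) (by simp) (by simp) (by simp [div_axisDir_re])]
    simp
  have h4 : ∀ i, α i * τ = h none (some true) (overlapPoint (L i) (-1 - I)) := fun i => by
    have := hcoc i (v := 1 - I) (by simp) (by simp)
    rw [hswitch true i (v' := -1 - I) (by simp) (by simp) (by simp) (by simp)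
      (by simp [div_axisDir_re]), hswitch false i (v' := 1 + I) (by simp) (by simp) (by simp)
      (by simp) (by simp [div_axisDir_re])] at this
    simpa using this
  refine ⟨α, τ, hbase _ _, ?_, ?_, ?_⟩
  · have := h2 k
    rw [h3, ← h4, mul_assoc] at this
    exact mul_eq_left.1 this
  · intro b x i hx hx' hi
    split_ifs with h0
    · rw [hnone hx hx' hi (-1 - I) (by simp) (by simp)
        (by rw [iff_true_left h0]; cases b <;> simp [div_axisDir_re]), h4]
      cases b
      · rw [← h3, hswitch false i (v := -1 + I) (v' := -1 - I) (by simp) (by simp) (by simp) (by simp)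
          (by simp [div_axisDir_re])]
      · rfl
    · rw [mul_one, hnone hx hx' hi (1 + I) (by simp) (by simp)
        (by rw [iff_false_left h0]; cases b <;> simp [div_axisDir_re, h10])]
      cases b
      · rfl
      · exact hB i
  · intro x hx hx'
    split_ifs with h0
    · exact hneg hx hx' h0
    · exact hpos hx hx' h0

theorem fundamentalGroup_pencilCompl {m : ℕ} {d : Fin (m + 1) → ℂ} (hd : ∀ i, d i ≠ 0)
    (harg : Function.Injective fun i => arg (d i)) (hk : arg (d (Fin.last m)) = Real.pi)
    (x : pencilCompl d) :
    Nonempty (FundamentalGroup (pencilCompl d) x ≃* PresentedGroup (relAn (m + 1))) := by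
  obtain ⟨α, τ, hα, hτ, hgen, huniv⟩ := exists_generators_relAn m
  have hL : ∀ i, ∃ L : ℂ, InSector (fun i => arg (d i)) i L.im := by
    intro i
    obtain ⟨φ, hφ⟩ := exists_inSector (θ := fun i => arg (d i)) i (neg_pi_lt_arg _)
    exact ⟨φ * I, by simpa using hφ⟩
  choose L hL using hL
  have hmem : ∀ i {v : ℂ}, v.re ≠ 0 → v.im ≠ 0 → ∀ o, overlapPoint (L i) v ∈ pencilCover d o := by
    intro i v hv hv' o
    cases o with
    | none => exact overlapPoint_mem_none (hL i) hd (by rintro rfl; simp at hv)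
    | some b =>
      refine overlapPoint_mem_some (hL i) hd ?_
      rw [div_axisDir_re]
      split_ifs <;> assumption
  have hmem₁ : ∀ i o, overlapPoint (L i) (1 + I) ∈ pencilCover d o := fun i =>
    hmem i (by simp) (by simp)
  have hmem₂ : ∀ i o, overlapPoint (L i) (1 - I) ∈ pencilCover d o := fun i =>
    hmem i (by simp) (by simp)
  have hsub := pencilCover_subset hd
  let y : pencilCompl d :=
    ⟨overlapPoint (L (Fin.last m)) (1 + I), hsub none (hmem₁ _ _)⟩
  have hnone : ∀ i b, pencilCocycle d α τ none (some b) (overlapPoint (L i) (1 + I)) = α i := by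
    intro i b
    have hv : (1 + I : ℂ) ≠ 0 := by intro h; simpa using congrArg im h
    rw [pencilCocycle_none_some harg (hmem i (by simp) (by simp) none).1 (i := i),
      rootParam_overlapPoint (hL i) hv]
    · cases b <;> simp [div_axisDir_re]
    · rw [← log_im, log_pencilParam_overlapPoint (hL i) hv]
      exact hL i
  have hsome : ∀ i (v : ℂ), v.re ≠ 0 → v.im ≠ 0 →
      pencilCocycle d α τ (some false) (some true) (overlapPoint (L i) v) =
      if v.re * v.im < 0 then τ else 1 := by
    intro i v hv hv'
    rw [pencilCocycle_some_some hτ (hmem i hv hv' _) (hmem i hv hv' _)]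
    congr 1
    simp [overlapPoint, coordRatio_chartX, sq]
    constructor <;> intro <;> linarith
  have hframe : ∀ o, pencilFrame d α τ o y = 1 := by
    intro o
    cases o with
    | none => rfl
    | some b => simpa [hα, pencilCocycle, pencilFrame] using hnone (Fin.last m) b
  refine fundamentalGroup_of_universal_cocycle (y := y)
    (U := fun o : Option Bool => Subtype.val ⁻¹' pencilCover d o)
    (fun o => (isOpen_pencilCover d o).preimage continuous_subtype_val)
    (fun x => exists_mem_pencilCover hd harg x.2) (fun o => ?_)
    (hmem₁ _) (fun o o' x => pencilCocycle d α τ o o' x)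
    (fun o o' o'' x _ _ _ => pencilCocycle_mul o o' o'' _)
    (fun o o' x hx hx' => continuous_subtype_val.continuousAt.eventually
      (eventually_pencilCocycle hd harg hk hτ o o' hx hx'))
    (fun o o' => by simp [pencilCocycle, hframe]) ?_ ?_ x
  · have e : (Subtype.val ⁻¹' pencilCover d o : Set (pencilCompl d)) ≃ₜ pencilCover d o :=
      { toFun := fun z => ⟨z.1.1, z.2⟩
        invFun := fun z => ⟨⟨z.1, hsub o z.2⟩, z.2⟩
        left_inv := fun _ => rfl
        right_inv := fun _ => rfl }
    have := e.contractibleSpace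
    exact SimplyConnectedSpace.ofContractible _
  · rw [eq_top_iff, ← hgen, Subgroup.closure_le, Set.insert_subset_iff]
    constructor
    · exact Subgroup.subset_closure ⟨some false, some true,
        ⟨overlapPoint (L (Fin.last m)) (1 - I), hsub none (hmem₂ _ _)⟩,
        Set.mem_preimage.2 (hmem₂ _ _), Set.mem_preimage.2 (hmem₂ _ _), by simp [hsome]⟩
    · rintro _ ⟨i, rfl⟩
      exact Subgroup.subset_closure ⟨none, some false,
        ⟨overlapPoint (L i) (1 + I), hsub none (hmem₁ _ _)⟩,
        Set.mem_preimage.2 (hmem₁ _ _), Set.mem_preimage.2 (hmem₁ _ _), hnone i false⟩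
  · intro K _ h hmul hjoin hbase
    classical
    let h' : Option Bool → Option Bool → P2 → K := fun o o' z =>
      if hz : z ∈ pencilCompl d then h o o' ⟨z, hz⟩ else 1
    have hh : ∀ o o' (x : pencilCompl d), h' o o' x = h o o' x := fun o o' x => dif_pos x.2
    obtain ⟨α', τ', hα', hτ', h1, h2⟩ := exists_eq_of_cocycle hd (k := Fin.last m) hL (h := h')
      (fun o o' o'' x hx hx' hx'' => by
        have := hmul o o' o'' ⟨x, hsub o hx⟩ hx hx' hx''
        simpa only [← hh] using this)
      (fun o o' x x' hj => by
        have := hjoin o o' ⟨x, hsub o hj.source_mem.1⟩ ⟨x', hsub o hj.target_mem.1⟩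
          (JoinedIn.preimage_val
            (F := pencilCover d o ∩ pencilCover d o') (fun z hz => hsub o hz.1) hj)
        simpa only [← hh] using this)
      (fun o o' => (hh o o' y).trans (hbase o o'))
    obtain ⟨s, hsα, hsτ⟩ := huniv K α' τ' hα' hτ'
    have hself : ∀ o x, x ∈ Subtype.val ⁻¹' pencilCover d o → h o o x = 1 := fun o x hx =>
      mul_eq_left.1 (hmul o o o x hx hx hx)
    have hinv : ∀ o o' x, x ∈ Subtype.val ⁻¹' pencilCover d o →
        x ∈ Subtype.val ⁻¹' pencilCover d o' → s (pencilCocycle d α τ o o' x) = h o o' x →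
        s (pencilCocycle d α τ o' o x) = h o' o x := by
      intro o o' x hx hx' h0
      rw [← pencilCocycle_inv, map_inv, h0]
      exact inv_eq_of_mul_eq_one_right ((hmul o o' o x hx hx' hx).trans (hself o x hx))
    have hn : ∀ b x, x ∈ Subtype.val ⁻¹' pencilCover d none →
        x ∈ Subtype.val ⁻¹' pencilCover d (some b) →
        s (pencilCocycle d α τ none (some b) x) = h none (some b) x := by
      intro b x hx hx'
      obtain ⟨i, hi⟩ := exists_inSector_of_mem hd hk hx hx'
      rw [pencilCocycle_none_some harg hx.1 hi, map_mul, hsα, ← hh, h1 b x i hx hx' hi]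
      split_ifs <;> simp [hsτ]
    have hs : ∀ x, x ∈ Subtype.val ⁻¹' pencilCover d (some false) →
        x ∈ Subtype.val ⁻¹' pencilCover d (some true) →
        s (pencilCocycle d α τ (some false) (some true) x) = h (some false) (some true) x := by
      intro x hx hx'
      rw [pencilCocycle_some_some hτ hx hx', ← hh, h2 x hx hx']
      split_ifs <;> simp [hsτ]
    refine ⟨s, fun o o' x hx hx' => ?_⟩
    have hss : ∀ o, s (pencilCocycle d α τ o o x) = h o o x ∨ x.1 ∉ pencilCover d o := fun o => by
      by_cases hx : x.1 ∈ pencilCover d o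
      · exact Or.inl (by rw [pencilCocycle_self, map_one, hself o x hx])
      · exact Or.inr hx
    match o, o' with
    | none, none => exact (hss _).resolve_right (not_not.2 hx)
    | none, some b => exact hn b x hx hx'
    | some b, none => exact hinv _ _ x hx' hx (hn b x hx' hx)
    | some false, some false => exact (hss _).resolve_right (not_not.2 hx)
    | some false, some true => exact hs x hx hx'
    | some true, some false => exact hinv _ _ x hx' hx (hs x hx' hx)
    | some true, some true => exact (hss _).resolve_right (not_not.2 hx)

end PencilCocycle

section Twist

open Complex

section ProjectiveMap

variable {f : (Fin 3 → ℂ) → Fin 3 → ℂ}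

/-- The map of the projective plane induced by a homogeneous map without nontrivial zeros. -/
def projMap (f : (Fin 3 → ℂ) → Fin 3 → ℂ) (h0 : ∀ v, v ≠ 0 → f v ≠ 0) (x : P2) : P2 :=
  Projectivization.mk ℂ (f x.rep) (h0 _ x.rep_nonzero)

theorem projMap_mk (h0 : ∀ v, v ≠ 0 → f v ≠ 0) (hs : ∀ (a : ℂ) v, f (a • v) = a • f v)
    (v : Fin 3 → ℂ) (hv : v ≠ 0) :
    projMap f h0 (Projectivization.mk ℂ v hv) = Projectivization.mk ℂ (f v) (h0 v hv) := by
  obtain ⟨a, ha, h⟩ := exists_rep_mk v hv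
  rw [projMap, Projectivization.mk_eq_mk_iff']
  exact ⟨a, by rw [h, hs]⟩

theorem continuousAt_projMap (h0 : ∀ v, v ≠ 0 → f v ≠ 0) (hs : ∀ (a : ℂ) v, f (a • v) = a • f v)
    {x : P2} (hf : ContinuousAt f x.rep) : ContinuousAt (projMap f h0) x := by
  have h : x = Projectivization.mk' ℂ ⟨x.rep, x.rep_nonzero⟩ := x.mk_rep.symm
  rw [h, ← isOpenQuotientMap_mk.continuousAt_comp_iff]
  have : projMap f h0 ∘ (Projectivization.mk' ℂ : {v : Fin 3 → ℂ // v ≠ 0} → P2) =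
      Projectivization.mk' ℂ ∘ fun v => ⟨f v.1, h0 v.1 v.2⟩ := by
    ext1 v
    exact projMap_mk h0 hs v.1 v.2
  rw [this]
  refine isOpenQuotientMap_mk.continuous.continuousAt.comp ?_
  refine Topology.IsInducing.subtypeVal.continuousAt_iff.2 ?_
  exact ContinuousAt.comp (g := f) hf continuousAt_subtype_val

theorem projMap_projMap {f' : (Fin 3 → ℂ) → Fin 3 → ℂ} (h0 : ∀ v, v ≠ 0 → f v ≠ 0)
    (h0' : ∀ v, v ≠ 0 → f' v ≠ 0) (hs' : ∀ (a : ℂ) v, f' (a • v) = a • f' v)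
    (hff' : ∀ v, f' (f v) = v) (x : P2) : projMap f' h0' (projMap f h0 x) = x := by
  refine (projMap_mk h0' hs' _ _).trans ?_
  simp only [hff', Projectivization.mk_rep]

/-- Mutually inverse homogeneous maps induce homeomorphisms of subsets of the projective plane. -/
def projHomeomorph (f f' : (Fin 3 → ℂ) → Fin 3 → ℂ) (h0 : ∀ v, v ≠ 0 → f v ≠ 0)
    (h0' : ∀ v, v ≠ 0 → f' v ≠ 0) (hs : ∀ (a : ℂ) v, f (a • v) = a • f v)
    (hs' : ∀ (a : ℂ) v, f' (a • v) = a • f' v) (hff' : ∀ v, f' (f v) = v)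
    (hf'f : ∀ v, f (f' v) = v) {S S' : Set P2} (hS : ∀ x, projMap f h0 x ∈ S' ↔ x ∈ S)
    (hf : ∀ x ∈ S, ContinuousAt f x.rep) (hf' : ∀ x ∈ S', ContinuousAt f' x.rep) : S ≃ₜ S' where
  toFun x := ⟨projMap f h0 x, (hS _).2 x.2⟩
  invFun x := ⟨projMap f' h0' x, by
    rw [← hS, projMap_projMap h0' h0 hs hf'f]
    exact x.2⟩
  left_inv x := Subtype.ext (projMap_projMap h0 h0' hs' hff' x.1)
  right_inv x := Subtype.ext (projMap_projMap h0' h0 hs hf'f x.1)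
  continuous_toFun := Continuous.subtype_mk (continuous_iff_continuousAt.2 fun x =>
    (continuousAt_projMap h0 hs (hf x.1 x.2)).comp continuousAt_subtype_val) _
  continuous_invFun := Continuous.subtype_mk (continuous_iff_continuousAt.2 fun x =>
    (continuousAt_projMap h0' hs' (hf' x.1 x.2)).comp continuousAt_subtype_val) _

end ProjectiveMap

theorem mk_mem_pencilCompl {ι : Type} {d : ι → ℂ} (v : Fin 3 → ℂ) (hv : v ≠ 0) :
    Projectivization.mk ℂ v hv ∈ pencilCompl d ↔ ∀ i, v 0 * v 1 ≠ d i * v 2 ^ 2 := by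
  obtain ⟨a, ha, h⟩ := exists_rep_mk v hv
  simp only [pencilCompl, Set.mem_ofPred_eq, h, Pi.smul_apply, smul_eq_mul]
  refine forall_congr' fun i => not_congr ?_
  rw [← mul_right_inj' (b := v 0 * v 1) (pow_ne_zero 2 ha)]
  constructor <;> intro h <;> linear_combination h

/-- A real number determined by the absolute value of the parameter `x y / z²`. -/
def pencilModulus (v : Fin 3 → ℂ) : ℝ := ‖v 0 * v 1‖ / (‖v 0 * v 1‖ + ‖v 2‖ ^ 2)

/-- Rotation of the third coordinate by an angle depending on the modulus of `x y / z²`. -/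
def twist (κ ε : ℝ) (v : Fin 3 → ℂ) : Fin 3 → ℂ :=
  ![v 0, v 1, v 2 * exp ((κ + ε * pencilModulus v : ℝ) * I)]

theorem pencilModulus_twist (κ ε : ℝ) (v : Fin 3 → ℂ) :
    pencilModulus (twist κ ε v) = pencilModulus v := by
  simp only [pencilModulus, twist, Matrix.cons_val, norm_mul, norm_exp_ofReal_mul_I, mul_one]

theorem twist_twist (κ ε : ℝ) (v : Fin 3 → ℂ) : twist (-κ) (-ε) (twist κ ε v) = v := by
  ext j
  rw [twist, pencilModulus_twist]
  fin_cases j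
  · simp [twist]
  · simp [twist]
  · simp [twist, mul_assoc, ← exp_add, ← add_mul]
    ring_nf
    simp

theorem pencilModulus_smul {a : ℂ} (ha : a ≠ 0) (v : Fin 3 → ℂ) :
    pencilModulus (a • v) = pencilModulus v := by
  have h : 0 < ‖a‖ := norm_pos_iff.2 ha
  simp only [pencilModulus, Pi.smul_apply, smul_eq_mul, norm_mul]
  rw [← mul_div_mul_left (‖v 0‖ * ‖v 1‖) _ (pow_ne_zero 2 h.ne')]
  ring_nf

theorem twist_smul (κ ε : ℝ) (a : ℂ) (v : Fin 3 → ℂ) : twist κ ε (a • v) = a • twist κ ε v := by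
  rcases eq_or_ne a 0 with rfl | ha
  · ext j
    fin_cases j <;> simp [twist]
  · rw [twist, pencilModulus_smul ha]
    ext j
    fin_cases j <;> simp [twist, mul_assoc]

theorem continuousAt_twist (κ ε : ℝ) {v : Fin 3 → ℂ} (hv : v 0 * v 1 ≠ 0 ∨ v 2 ≠ 0) :
    ContinuousAt (twist κ ε) v := by
  have h : ‖v 0 * v 1‖ + ‖v 2‖ ^ 2 ≠ 0 := by
    rcases hv with h | h
    · have := norm_pos_iff.2 h
      positivity
    · have := norm_pos_iff.2 h
      positivity
  have hm : ContinuousAt pencilModulus v := by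
    refine ContinuousAt.div ?_ ?_ h <;> fun_prop
  rw [continuousAt_pi]
  intro j
  fin_cases j
  · exact continuousAt_apply 0 v
  · exact continuousAt_apply 1 v
  · change ContinuousAt (fun v => v 2 * exp ((κ + ε * pencilModulus v : ℝ) * I)) v
    exact (continuousAt_apply 2 v).mul (continuous_exp.continuousAt.comp
      ((continuous_ofReal.continuousAt.comp
        (continuousAt_const.add (continuousAt_const.mul hm))).mul continuousAt_const))

theorem mul_eq_iff_twist (κ ε : ℝ) (c : ℂ) (v : Fin 3 → ℂ) :
    twist κ ε v 0 * twist κ ε v 1 =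
      c * exp (-(2 * (κ + ε * (‖c‖ / (‖c‖ + 1))) : ℝ) * I) * twist κ ε v 2 ^ 2 ↔
    v 0 * v 1 = c * v 2 ^ 2 := by
  have key : ‖v 0 * v 1‖ = ‖c‖ * ‖v 2‖ ^ 2 →
      c * exp (-(2 * (κ + ε * (‖c‖ / (‖c‖ + 1))) : ℝ) * I) *
        (v 2 * exp ((κ + ε * pencilModulus v : ℝ) * I)) ^ 2 = c * v 2 ^ 2 := by
    intro h
    rcases eq_or_ne (v 2) 0 with h2 | h2
    · simp [h2]
    have hm : pencilModulus v = ‖c‖ / (‖c‖ + 1) := by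
      have := norm_pos_iff.2 h2
      have := norm_nonneg c
      rw [pencilModulus, h]
      field_simp
    rw [hm, mul_pow, ← exp_nat_mul]
    have h3 : exp (-(2 * (κ + ε * (‖c‖ / (‖c‖ + 1))) : ℝ) * I) *
        exp ((2 : ℕ) * ((κ + ε * (‖c‖ / (‖c‖ + 1)) : ℝ) * I)) = 1 := by
      rw [← exp_add, exp_eq_one_iff]
      exact ⟨0, by push_cast; ring⟩
    linear_combination c * v 2 ^ 2 * h3
  have hn : ∀ r : ℝ, ‖exp (-(r : ℂ) * I)‖ = 1 := fun r => by
    rw [← ofReal_neg, norm_exp_ofReal_mul_I]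
  simp only [twist, Matrix.cons_val]
  constructor
  · intro h
    rw [h, key]
    rw [h, norm_mul, norm_mul, hn, norm_pow, norm_mul, norm_exp_ofReal_mul_I, mul_one, mul_one]
  · intro h
    rw [h, key]
    rw [h, norm_mul, norm_pow]

theorem countable_setOf_exp_mul_eq {a : ℂ} (ha : a ≠ 0) (u : ℂ) :
    {r : ℝ | exp (r * a) = u}.Countable := by
  rcases Set.eq_empty_or_nonempty {r : ℝ | exp (r * a) = u} with h | ⟨r₀, h₀⟩
  · simp [h]
  refine (Set.countable_range fun n : ℤ => (r₀ + n * (2 * Real.pi * I) / a).re).mono fun r hr => ?_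
  obtain ⟨n, hn⟩ := exp_eq_exp_iff_exists_int.1 (hr.trans h₀.symm)
  refine ⟨n, ?_⟩
  have : (r : ℂ) = r₀ + n * (2 * Real.pi * I) / a := by
    field_simp
    linear_combination hn
  simp only [← this, ofReal_re]

theorem exists_rotation {m : ℕ} {c : Fin (m + 1) → ℂ} (hc : ∀ i, c i ≠ 0)
    (hinj : Function.Injective c) : ∃ κ ε : ℝ,
    (Function.Injective fun i =>
      arg (c i * exp (-(2 * (κ + ε * (‖c i‖ / (‖c i‖ + 1))) : ℝ) * I))) ∧
    arg (c (Fin.last m) *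
      exp (-(2 * (κ + ε * (‖c (Fin.last m)‖ / (‖c (Fin.last m)‖ + 1))) : ℝ) * I)) = Real.pi := by
  let t : Fin (m + 1) → ℝ := fun i => ‖c i‖ / (‖c i‖ + 1)
  have ht : ∀ {i j}, t i = t j → ‖c i‖ = ‖c j‖ := by
    intro i j h
    have h1 := norm_nonneg (c i)
    have h2 := norm_nonneg (c j)
    simp only [t] at h
    rw [div_eq_div_iff (by positivity) (by positivity)] at h
    linarith
  have hB : (⋃ (i) (j) (_ : t i ≠ t j),
      {r : ℝ | exp (r * (2 * (t j - t i) * I)) = c j * ‖c i‖ / (c i * ‖c j‖)}).Countable := by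
    refine Set.countable_iUnion fun i => Set.countable_iUnion fun j =>
      Set.countable_iUnion fun h => countable_setOf_exp_mul_eq ?_ _
    have : (t j - t i : ℂ) ≠ 0 := by exact_mod_cast sub_ne_zero.2 h.symm
    simp [this]
  obtain ⟨ε, hε⟩ := (hB.dense_compl ℝ).nonempty
  simp only [Set.mem_compl_iff, Set.mem_iUnion, Set.mem_ofPred_eq, not_exists] at hε
  let κ : ℝ := (arg (c (Fin.last m)) - 2 * ε * t (Fin.last m) - Real.pi) / 2
  refine ⟨κ, ε, fun i j hij => ?_, ?_⟩
  · have hn : ∀ i, ‖c i * exp (-(2 * (κ + ε * (‖c i‖ / (‖c i‖ + 1))) : ℝ) * I)‖ = ‖c i‖ := by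
      intro i
      rw [← ofReal_neg, norm_mul, norm_exp_ofReal_mul_I, mul_one]
    have hne : ∀ i, c i * exp (-(2 * (κ + ε * (‖c i‖ / (‖c i‖ + 1))) : ℝ) * I) ≠ 0 := fun i =>
      mul_ne_zero (hc i) (exp_ne_zero _)
    have hci : (‖c i‖ : ℂ) ≠ 0 := by simp [hc]
    have hcj : (‖c j‖ : ℂ) ≠ 0 := by simp [hc]
    have h := (arg_eq_arg_iff (hne i) (hne j)).1 hij
    rw [hn, hn] at h
    change (‖c j‖ / ‖c i‖ : ℂ) * (c i * exp (-(2 * (κ + ε * t i) : ℝ) * I)) =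
      c j * exp (-(2 * (κ + ε * t j) : ℝ) * I) at h
    by_cases htt : t i = t j
    · rw [htt, ht htt, div_self hcj, one_mul] at h
      exact hinj (mul_right_cancel₀ (exp_ne_zero _) h)
    · refine absurd ?_ (hε i j htt)
      have h1 : exp (-(2 * (κ + ε * t i) : ℝ) * I) = exp (-(2 * (κ + ε * t j) : ℝ) * I) *
          exp (ε * (2 * (t j - t i) * I)) := by
        rw [← exp_add]
        congr 1
        push_cast
        ring
      rw [h1] at h
      generalize exp (ε * (2 * (t j - t i) * I)) = E at h ⊢
      rw [eq_div_iff (mul_ne_zero (hc i) hcj)]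
      field_simp at h
      linear_combination h
  · change arg (c (Fin.last m) * exp (-(2 * (κ + ε * t (Fin.last m)) : ℝ) * I)) = Real.pi
    have h : c (Fin.last m) * exp (-(2 * (κ + ε * t (Fin.last m)) : ℝ) * I) =
        ‖c (Fin.last m)‖ * (-1) := by
      conv_lhs => rw [← norm_mul_exp_arg_mul_I (c (Fin.last m))]
      rw [← exp_pi_mul_I, mul_assoc, ← exp_add]
      congr 2
      simp only [κ]
      push_cast
      ring
    rw [h, arg_real_mul _ (norm_pos_iff.2 (hc _)), arg_neg_one]

theorem mul_ne_zero_or_of_mem {ι : Type} [Nonempty ι] {c : ι → ℂ} {x : P2}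
    (hx : x ∈ pencilCompl c) : x.rep 0 * x.rep 1 ≠ 0 ∨ x.rep 2 ≠ 0 := by
  by_contra! h
  exact hx (Classical.arbitrary ι) (by simp [h.1, h.2])

theorem exists_homeomorph_pencilCompl {m : ℕ} {c : Fin (m + 1) → ℂ} (hc : ∀ i, c i ≠ 0)
    (hinj : Function.Injective c) : ∃ d : Fin (m + 1) → ℂ, (∀ i, d i ≠ 0) ∧
      (Function.Injective fun i => arg (d i)) ∧ arg (d (Fin.last m)) = Real.pi ∧
      Nonempty (pencilCompl c ≃ₜ pencilCompl d) := by
  obtain ⟨κ, ε, h1, h2⟩ := exists_rotation hc hinj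
  refine ⟨_, fun i => mul_ne_zero (hc i) (exp_ne_zero _), h1, h2, ?_⟩
  have hinv : ∀ v, twist κ ε (twist (-κ) (-ε) v) = v := fun v => by
    simpa using twist_twist (-κ) (-ε) v
  have h0 : ∀ κ ε v, v ≠ 0 → twist κ ε v ≠ 0 := by
    intro κ ε v hv h
    apply hv
    rw [← twist_twist κ ε v, h]
    simpa using twist_smul (-κ) (-ε) 0 0
  refine ⟨projHomeomorph (twist κ ε) (twist (-κ) (-ε)) (h0 _ _) (h0 _ _) (twist_smul _ _)
    (twist_smul _ _) (twist_twist _ _) hinv (fun x => ?_)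
    (fun x hx => continuousAt_twist _ _ (mul_ne_zero_or_of_mem hx))
    (fun x hx => continuousAt_twist _ _ (mul_ne_zero_or_of_mem hx))⟩
  rw [projMap, mk_mem_pencilCompl]
  exact forall_congr' fun i => not_congr (mul_eq_iff_twist κ ε (c i) x.rep)

end Twist

section ConicForms

variable {V : Type*} [AddCommGroup V] [Module ℂ V]

open LinearMap (BilinForm)

theorem exists_linearEquiv_coordinates (hV : Module.finrank ℂ V = 3) {p q r : V}
    (h : ∀ a b c : ℂ, a • p + b • q + c • r = 0 → a = 0 ∧ b = 0 ∧ c = 0) :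
    ∃ A : V ≃ₗ[ℂ] (Fin 3 → ℂ), ∀ v, v = A v 0 • p + A v 1 • q + A v 2 • r := by
  have hli : LinearIndependent ℂ ![p, q, r] := by
    rw [Fintype.linearIndependent_iff]
    intro g hg
    rw [Fin.sum_univ_three] at hg
    obtain ⟨h0, h1, h2⟩ := h _ _ _ hg
    intro i
    fin_cases i <;> assumption
  have hs := (basisOfLinearIndependentOfCardEqFinrank hli (by simp [hV])).sum_equivFun
  refine ⟨(basisOfLinearIndependentOfCardEqFinrank hli (by simp [hV])).equivFun, fun v => ?_⟩
  conv_lhs => rw [← hs v]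
  simp [Fin.sum_univ_three]

variable {B : BilinForm ℂ V}

theorem apply_ne_zero_of_isotropic (hV : Module.finrank ℂ V = 3) (hsymm : ∀ u v, B u v = B v u)
    (hnd : ∀ v, v ≠ 0 → ∃ u, B v u ≠ 0) {p q : V} (hp0 : p ≠ 0) (hpq : ∀ a : ℂ, q ≠ a • p)
    (hp : B p p = 0) (hq : B q q = 0) : B p q ≠ 0 := by
  intro h
  obtain ⟨r, hr⟩ := hnd p hp0
  obtain ⟨A, hA⟩ := exists_linearEquiv_coordinates hV (p := p) (q := q) (r := r) (by
    intro a b c habc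
    have hc : c = 0 := by
      have := congrArg (B p) habc
      simpa [hp, h, hr] using this
    subst hc
    have hb : b = 0 := by
      by_contra hb
      refine hpq (-(b⁻¹ * a)) ?_
      have := congrArg (fun v => b⁻¹ • v) habc
      simp only [zero_smul, add_zero, smul_add, smul_smul, inv_mul_cancel₀ hb, one_smul,
        smul_zero] at this
      rw [neg_smul, eq_neg_iff_add_eq_zero, add_comm, this]
    subst hb
    simpa [hp0] using habc)
  have hu : B p r • q - B q r • p ≠ 0 := by
    intro hu
    refine hpq ((B p r)⁻¹ * B q r) ?_
    rw [mul_smul, ← sub_eq_zero.1 hu, smul_smul, inv_mul_cancel₀ hr, one_smul]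
  obtain ⟨u, hu⟩ := hnd _ hu
  apply hu
  rw [hA u]
  simp [hp, hq, h, hsymm q p]
  ring

theorem exists_isotropic_pair (hsymm : ∀ u v, B u v = B v u)
    (hnd : ∀ v, v ≠ 0 → ∃ u, B v u ≠ 0) {u w : V}
    (huw : ∀ a b : ℂ, a • u + b • w = 0 → a = 0 ∧ b = 0) :
    ∃ p q, B p p = 0 ∧ B q q = 0 ∧ B p q ≠ 0 := by
  obtain ⟨p, hp0, hp⟩ : ∃ p, p ≠ 0 ∧ B p p = 0 := by
    by_cases hw : B w w = 0
    · refine ⟨w, ?_, hw⟩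
      rintro rfl
      simpa using huw 0 1
    · obtain ⟨s, hs⟩ := IsAlgClosed.exists_pow_nat_eq (B u w ^ 2 - B u u * B w w) two_pos
      refine ⟨B w w • u + (s - B u w) • w, fun h => hw (huw _ _ h).1, ?_⟩
      simp [hsymm w u]
      linear_combination B w w * hs
  obtain ⟨w, hw⟩ := hnd p hp0
  refine ⟨p, (2 * B p w) • w - B w w • p, hp, ?_, ?_⟩
  · simp [hp, hsymm w p]
    ring
  · simp [hp, hw]

theorem exists_pencil_coordinates (hV : Module.finrank ℂ V = 3) {ι : Type*} [Nonempty ι]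
    {B : ι → BilinForm ℂ V} (hsymm : ∀ i u v, B i u v = B i v u)
    (hnd : ∀ i v, v ≠ 0 → ∃ u, B i v u ≠ 0) {p q : V} (hp : ∀ i, B i p p = 0)
    (hq : ∀ i, B i q q = 0) (hpq : ∀ i, B i p q ≠ 0)
    (htp : ∀ i j v, B i p v = 0 → B j p v = 0) (htq : ∀ i j v, B i q v = 0 → B j q v = 0) :
    ∃ (A : V ≃ₗ[ℂ] (Fin 3 → ℂ)) (c : ι → ℂ), (∀ i, c i ≠ 0) ∧
      ∀ i v, B i v v = 0 ↔ A v 0 * A v 1 = c i * A v 2 ^ 2 := by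
  have : FiniteDimensional ℂ V := Module.finite_of_finrank_eq_succ hV
  obtain ⟨k⟩ := ‹Nonempty ι›
  obtain ⟨r, hr, hr0⟩ := Submodule.exists_mem_ne_zero_of_ne_bot
    (LinearMap.ker_ne_bot_of_finrank_lt (f := (B k p).prod (B k q)) (by simp [hV]))
  replace hr : B k p r = 0 ∧ B k q r = 0 := Prod.mk_eq_zero.1 (LinearMap.mem_ker.1 hr)
  have hpr : ∀ i, B i p r = 0 := fun i => htp k i r hr.1
  have hqr : ∀ i, B i q r = 0 := fun i => htq k i r hr.2
  obtain ⟨A, hA⟩ := exists_linearEquiv_coordinates hV (p := p) (q := q) (r := r) (by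
    intro a b c habc
    have hb : b = 0 := by
      have := congrArg (B k p) habc
      simpa [hp, hpr, hpq] using this
    have ha : a = 0 := by
      have := congrArg (B k q) habc
      simpa [hq, hqr, hpq, hsymm k q p] using this
    subst ha hb
    simpa [hr0] using habc)
  have hrr : ∀ i, B i r r ≠ 0 := by
    intro i h
    obtain ⟨u, hu⟩ := hnd i r hr0
    apply hu
    rw [hA u]
    simp [h, hsymm i r p, hsymm i r q, hpr, hqr]
  refine ⟨A, fun i => -(B i r r / (2 * B i p q)), fun i => by simp [hrr, hpq], fun i v => ?_⟩
  have h1 : B i v v = 2 * B i p q * (A v 0 * A v 1) + B i r r * A v 2 ^ 2 := by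
    conv_lhs => rw [hA v]
    simp [hsymm i r p, hsymm i r q, hsymm i q p, hpr, hqr, hp, hq]
    ring
  have h2 := hpq i
  rw [h1]
  constructor
  · intro h
    field_simp
    linear_combination h
  · intro h
    rw [h]
    field_simp
    ring

theorem pderiv_pderiv_comm {σ R : Type*} [CommRing R] (i j : σ) (P : MvPolynomial σ R) :
    pderiv j (pderiv i P) = pderiv i (pderiv j P) := by
  classical
  have h : ⁅pderiv (R := R) j, pderiv i⁆ = 0 := MvPolynomial.derivation_ext fun k => by
    rw [Derivation.commutator_apply, pderiv_X, pderiv_X, Pi.single_apply, Pi.single_apply]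
    split_ifs <;> simp
  rw [← sub_eq_zero, ← Derivation.commutator_apply, h, Derivation.coe_zero, Pi.zero_apply]

theorem eval_eq_sum_of_isHomogeneous_one {R : MvPolynomial (Fin 3) ℂ} (hR : R.IsHomogeneous 1)
    (v : Fin 3 → ℂ) : eval v R = ∑ j, v j * eval 0 (pderiv j R) := by
  have h := congrArg (eval v) hR.sum_X_mul_pderiv
  rw [one_smul, map_sum] at h
  rw [← h]
  refine Finset.sum_congr rfl fun j _ => ?_
  have hj : (pderiv j R).IsHomogeneous 0 := hR.pderiv
  rw [← totalDegree_zero_iff_isHomogeneous, totalDegree_eq_zero_iff_eq_C] at hj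
  rw [map_mul, eval_X, hj, eval_C, eval_C]

theorem exists_bilinForm_of_smooth {P : MvPolynomial (Fin 3) ℂ} (hP : P.IsHomogeneous 2)
    (hs : ∀ v : Fin 3 → ℂ, v ≠ 0 → gradP P v ≠ 0) : ∃ B : BilinForm ℂ (Fin 3 → ℂ),
    (∀ u v, B u v = B v u) ∧ (∀ v, v ≠ 0 → ∃ u, B v u ≠ 0) ∧
    (∀ v, eval v P = 0 ↔ B v v = 0) ∧ ∀ u v, ∑ i, gradP P u i * v i = B u v := by
  let M : Matrix (Fin 3) (Fin 3) ℂ := fun i j => eval 0 (pderiv j (pderiv i P))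
  have hM : ∀ i j, M i j = M j i := fun i j => by
    simp only [M, pderiv_pderiv_comm i j P]
  have hgrad : ∀ u v, ∑ i, gradP P u i * v i = Matrix.toBilin' M u v := by
    intro u v
    rw [Matrix.toBilin'_apply, Finset.sum_comm]
    refine Finset.sum_congr rfl fun i _ => ?_
    rw [gradP, eval_eq_sum_of_isHomogeneous_one (hP.pderiv), Finset.sum_mul]
    exact Finset.sum_congr rfl fun j _ => by rw [hM j i]
  refine ⟨Matrix.toBilin' M, fun u v => ?_, fun v hv => ?_, fun v => ?_, hgrad⟩
  · rw [Matrix.toBilin'_apply, Matrix.toBilin'_apply, Finset.sum_comm]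
    refine Finset.sum_congr rfl fun i _ => Finset.sum_congr rfl fun j _ => ?_
    rw [hM]
    ring
  · obtain ⟨i, hi⟩ := Function.ne_iff.1 (hs v hv)
    refine ⟨Pi.single i 1, ?_⟩
    rw [← hgrad]
    simpa [Pi.single_apply] using hi
  · have h := congrArg (eval v) hP.sum_X_mul_pderiv
    rw [map_sum, map_nsmul] at h
    have h1 : Matrix.toBilin' M v v = 2 • eval v P := by
      rw [← h, ← hgrad]
      exact Finset.sum_congr rfl fun i _ => by rw [map_mul, eval_X, gradP, mul_comm]
    simp [h1]

end ConicForms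

section Arrangement

theorem nonempty_fundamentalGroup_mulEquiv {X Y : Type} [TopologicalSpace X] [TopologicalSpace Y]
    (e : X ≃ₜ Y) (x : X) : Nonempty (FundamentalGroup X x ≃* FundamentalGroup Y (e x)) :=
  ⟨(FundamentalGroupoidFunctor.equivOfHomotopyEquiv
    e.toHomotopyEquiv).fullyFaithfulFunctor.mulEquivEnd (X := ⟨x⟩)⟩

/-- Equality of the tangent lines, expressed through the polar forms of the two conics. -/
theorem apply_rep_eq_zero_of_tangentLineAt_eq {P P' : MvPolynomial (Fin 3) ℂ}
    {B B' : LinearMap.BilinForm ℂ (Fin 3 → ℂ)} (hB : ∀ u v, ∑ i, gradP P u i * v i = B u v)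
    (hB' : ∀ u v, ∑ i, gradP P' u i * v i = B' u v) {p : P2}
    (h : tangentLineAt P p = tangentLineAt P' p) {v : Fin 3 → ℂ} (hv : B p.rep v = 0) :
    B' p.rep v = 0 := by
  rcases eq_or_ne v 0 with rfl | hv0
  · exact map_zero _
  obtain ⟨a, ha, hrep⟩ := exists_rep_mk v hv0
  have h1 : Projectivization.mk ℂ v hv0 ∈ tangentLineAt P p := by
    simp only [tangentLineAt, Set.mem_ofPred_eq, hB, hrep, map_smul, hv, smul_zero]
  rw [h] at h1
  simpa only [tangentLineAt, Set.mem_ofPred_eq, hB', hrep, map_smul, smul_eq_mul, mul_eq_zero, ha,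
    false_or] using h1

theorem exists_pencil_of_arrangement {m : ℕ} {Q : Fin (m + 1) → Set P2}
    (hconic : ∀ i, IsSmoothConic (Q i)) {p q : P2} (hpq : p ≠ q)
    (htanp : ∀ i j, i ≠ j → TangentAt (Q i) (Q j) p)
    (htanq : ∀ i j, i ≠ j → TangentAt (Q i) (Q j) q) :
    ∃ (A : (Fin 3 → ℂ) ≃ₗ[ℂ] (Fin 3 → ℂ)) (c : Fin (m + 1) → ℂ), (∀ i, c i ≠ 0) ∧
      ∀ i x, x ∈ Q i ↔ A x.rep 0 * A x.rep 1 = c i * A x.rep 2 ^ 2 := by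
  have hV : Module.finrank ℂ (Fin 3 → ℂ) = 3 := by simp
  choose P hP hs hQ using hconic
  choose B hsymm hnd heval hgrad using fun i => exists_bilinForm_of_smooth (hP i) (hs i)
  have hmem : ∀ i x, x ∈ Q i ↔ B i x.rep x.rep = 0 := fun i x => by
    rw [hQ i, ← heval]
    rfl
  suffices H : ∃ u v, (∀ i, B i u u = 0) ∧ (∀ i, B i v v = 0) ∧ (∀ i, B i u v ≠ 0) ∧
      (∀ i j w, B i u w = 0 → B j u w = 0) ∧ ∀ i j w, B i v w = 0 → B j v w = 0 by
    obtain ⟨u, v, hu, hv, huv, htu, htv⟩ := H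
    obtain ⟨A, c, hc, hA⟩ := exists_pencil_coordinates hV hsymm hnd hu hv huv htu htv
    exact ⟨A, c, hc, fun i x => (hmem i x).trans (hA i _)⟩
  rcases m with _ | m
  · obtain ⟨u, v, hu, hv, huv⟩ := exists_isotropic_pair (hsymm 0) (hnd 0)
      (u := Pi.single 0 1) (w := Pi.single 1 1) fun a b h => by
        have h0 := congrFun h 0
        have h1 := congrFun h 1
        simp at h0 h1
        exact ⟨h0, h1⟩
    refine ⟨u, v, fun i => ?_, fun i => ?_, fun i => ?_, fun i j w h => ?_, fun i j w h => ?_⟩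
    · rwa [Subsingleton.elim (α := Fin 1) i 0]
    · rwa [Subsingleton.elim (α := Fin 1) i 0]
    · rwa [Subsingleton.elim (α := Fin 1) i 0]
    · rwa [Subsingleton.elim (α := Fin 1) j i]
    · rwa [Subsingleton.elim (α := Fin 1) j i]
  · have hp : ∀ i, B i p.rep p.rep = 0 := fun i => by
      obtain ⟨j, hj⟩ := exists_ne i
      exact (hmem i p).1 (htanp i j hj.symm).1
    have hq : ∀ i, B i q.rep q.rep = 0 := fun i => by
      obtain ⟨j, hj⟩ := exists_ne i
      exact (hmem i q).1 (htanq i j hj.symm).1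
    have hpq' : ∀ a : ℂ, q.rep ≠ a • p.rep := fun a h => hpq <| by
      rw [← p.mk_rep, ← q.mk_rep, eq_comm, Projectivization.mk_eq_mk_iff']
      exact ⟨a, h.symm⟩
    have htan : ∀ {y : P2}, (∀ i j, i ≠ j → TangentAt (Q i) (Q j) y) →
        ∀ i j w, B i y.rep w = 0 → B j y.rep w = 0 := fun hy i j w h => by
      rcases eq_or_ne i j with rfl | hij
      · exact h
      · exact apply_rep_eq_zero_of_tangentLineAt_eq (hgrad i) (hgrad j)
          ((hy i j hij).2.2 (P i) (P j) (hP i) (hs i) (hQ i) (hP j) (hs j) (hQ j)) h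
    exact ⟨p.rep, q.rep, hp, hq, fun i => apply_ne_zero_of_isotropic hV (hsymm i) (hnd i)
      p.rep_nonzero hpq' (hp i) (hq i), htan htanp, htan htanq⟩

/-- The complement of an arrangement with an equation `x y = c i z²` for each curve, in suitable
homogeneous coordinates, is homeomorphic to the standard pencil complement. -/
theorem nonempty_homeomorph_pencilCompl {ι : Type} {Q : ι → Set P2}
    (A : (Fin 3 → ℂ) ≃ₗ[ℂ] (Fin 3 → ℂ)) {c : ι → ℂ}
    (hA : ∀ i x, x ∈ Q i ↔ A x.rep 0 * A x.rep 1 = c i * A x.rep 2 ^ 2) :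
    Nonempty (↥(⋃ i, Q i)ᶜ ≃ₜ pencilCompl c) :=
  ⟨projHomeomorph A A.symm (fun _ => A.map_ne_zero_iff.2) (fun _ => A.symm.map_ne_zero_iff.2)
    (fun a v => map_smul A a v) (fun a v => map_smul A.symm a v) A.symm_apply_apply
    A.apply_symm_apply
    (fun x => by
      rw [projMap, mk_mem_pencilCompl]
      simp [hA])
    (fun _ _ => (LinearMap.continuous_of_finiteDimensional A.toLinearMap).continuousAt)
    fun _ _ => (LinearMap.continuous_of_finiteDimensional A.symm.toLinearMap).continuousAt⟩

end Arrangement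

/-- **Theorem (arrangement 𝒜ₙ).** If `Q₁, …, Qₙ` are pairwise distinct smooth conics, any two
of which meet exactly in two common points `p, q` and are tangent to each other at both `p`
and `q`, then `π₁(ℙ² ∖ (Q₁ ∪ ⋯ ∪ Qₙ))` is presented by `⟨a₁, …, aₙ | (a₁a₂⋯aₙ)² = e⟩`. -/
theorem fundamental_group_An (n : ℕ) (hn : 1 ≤ n) (Q : Fin n → Set P2)
    (hconic : ∀ i, IsSmoothConic (Q i))
    (hdist : ∀ i j : Fin n, i ≠ j → Q i ≠ Q j)
    (p q : P2) (hpq : p ≠ q)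
    (hint : ∀ i j : Fin n, i ≠ j → Q i ∩ Q j = {p, q})
    (htanp : ∀ i j : Fin n, i ≠ j → TangentAt (Q i) (Q j) p)
    (htanq : ∀ i j : Fin n, i ≠ j → TangentAt (Q i) (Q j) q)
    (x : ↥(⋃ i, Q i)ᶜ) :
    Nonempty (FundamentalGroup (↥(⋃ i, Q i)ᶜ) x ≃* PresentedGroup (relAn n)) := by
  obtain ⟨m, rfl⟩ := Nat.exists_eq_add_of_le' hn
  obtain ⟨A, c, hc, hA⟩ := exists_pencil_of_arrangement hconic hpq htanp htanq
  have hinj : Function.Injective c := fun i j hij => by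
    by_contra hne
    exact hdist i j hne (Set.ext fun y => by rw [hA, hA, hij])
  obtain ⟨e⟩ := nonempty_homeomorph_pencilCompl A hA
  obtain ⟨d, hd, harg, hπ, ⟨e'⟩⟩ := exists_homeomorph_pencilCompl hc hinj
  obtain ⟨φ⟩ := nonempty_fundamentalGroup_mulEquiv (e.trans e') x
  obtain ⟨ψ⟩ := fundamentalGroup_pencilCompl hd harg hπ (e.trans e' x)
  exact ⟨φ.trans ψ⟩
end
end

section
/- Let n ≥ 1 and let Q₁,…,Qₙ be pairwise distinct smooth conics in ℙ² for which there exist two distinct points p, q ∈ ℙ² such that for all i ≠ j one has Qᵢ ∩ Qⱼ = {p, q} and Qᵢ, Qⱼ are tangent both at p and at q. If n = 1, then the group π₁(ℙ² ∖ (Q₁ ∪ ⋯ ∪ Qₙ)) is abelian; if n ≥ 2, then this group is big. -/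
open MvPolynomial

noncomputable section

/-- A group is big if it contains a non-abelian free subgroup. -/
def IsBig (G : Type*) [Group G] : Prop :=
  ∃ H : Subgroup G, Nonempty (H ≃* FreeGroup (Fin 2))

section

open Set unitInterval

theorem IsSimplyConnected.homotopic_of_forall_mem {Y : Type*} [TopologicalSpace Y] {s : Set Y}
    (hs : IsSimplyConnected s) {x y : Y} (p q : Path x y) (hp : ∀ t, p t ∈ s)
    (hq : ∀ t, q t ∈ s) : p.Homotopic q := by
  have := hs.simplyConnectedSpace
  have hx : x ∈ s := by simpa using hp 0
  have hy : y ∈ s := by simpa using hp 1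
  let p' : Path (⟨x, hx⟩ : s) ⟨y, hy⟩ :=
    { toFun := fun t => ⟨p t, hp t⟩, source' := by simp, target' := by simp }
  let q' : Path (⟨x, hx⟩ : s) ⟨y, hy⟩ :=
    { toFun := fun t => ⟨q t, hq t⟩, source' := by simp, target' := by simp }
  exact (SimplyConnectedSpace.paths_homotopic p' q').map ⟨Subtype.val, continuous_subtype_val⟩

/-- A space covered by two simply connected open sets with path connected intersection is
simply connected. -/
theorem simplyConnectedSpace_of_isOpen_union {Y : Type*} [TopologicalSpace Y] {A B : Set Y}
    (hA : IsOpen A) (hB : IsOpen B) (hAB : A ∪ B = univ) (sA : IsSimplyConnected A)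
    (sB : IsSimplyConnected B) (hconn : IsPathConnected (A ∩ B)) : SimplyConnectedSpace Y := by
  obtain ⟨x₀, hx₀, hj⟩ := hconn
  have hc : ∀ y, ∃ c : Path x₀ y, (y ∈ A → ∀ t, c t ∈ A) ∧ (y ∈ B → ∀ t, c t ∈ B) := by
    intro y
    by_cases hyA : y ∈ A
    · by_cases hyB : y ∈ B
      · obtain ⟨c, hc⟩ := hj ⟨hyA, hyB⟩
        exact ⟨c, fun _ t => (hc t).1, fun _ t => (hc t).2⟩
      · obtain ⟨c, hc⟩ := sA.isPathConnected.joinedIn x₀ hx₀.1 y hyA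
        exact ⟨c, fun _ => hc, fun h => absurd h hyB⟩
    · have hyB : y ∈ B := (hAB.symm ▸ mem_univ y : y ∈ A ∪ B).resolve_left hyA
      obtain ⟨c, hc⟩ := sB.isPathConnected.joinedIn x₀ hx₀.2 y hyB
      exact ⟨c, fun h => absurd h hyA, fun _ => hc⟩
  choose c hcA hcB using hc
  have key : ∀ (y y' : Y) (s : Path y y'), (∀ t, s t ∈ A) ∨ (∀ t, s t ∈ B) →
      ((c y).trans s).Homotopic (c y') := by
    have mem_trans : ∀ {C : Set Y} {x y z : Y} (p : Path x y) (q : Path y z),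
        (∀ t, p t ∈ C) → (∀ t, q t ∈ C) → ∀ t, (p.trans q) t ∈ C := by
      intro C x y z p q hp hq t
      have : (p.trans q) t ∈ range (p.trans q) := mem_range_self t
      rw [Path.trans_range] at this
      rcases this with ⟨u, hu⟩ | ⟨u, hu⟩
      · exact hu ▸ hp u
      · exact hu ▸ hq u
    rintro y y' s (hs | hs)
    · exact sA.homotopic_of_forall_mem _ _
        (mem_trans _ _ (hcA y (by simpa using hs 0)) hs) (hcA y' (by simpa using hs 1))
    · exact sB.homotopic_of_forall_mem _ _
        (mem_trans _ _ (hcB y (by simpa using hs 0)) hs) (hcB y' (by simpa using hs 1))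
  have main : ∀ (a b : Y) (γ : Path a b), ((c a).trans γ).Homotopic (c b) := by
    intro a b γ
    obtain ⟨t, ht0, hmono, ⟨n, hn⟩, hsub⟩ := exists_monotone_Icc_subset_open_cover_unitInterval
      (c := fun i : Bool => γ ⁻¹' (if i then A else B))
      (fun i => by cases i <;> simp [hA.preimage γ.continuous, hB.preimage γ.continuous])
      (by
        intro u _
        have : γ u ∈ A ∪ B := hAB ▸ mem_univ _
        rcases this with h | h
        · exact mem_iUnion.2 ⟨true, by simpa using h⟩
        · exact mem_iUnion.2 ⟨false, by simpa using h⟩)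
    have step : ∀ k, ((c (γ 0)).trans (γ.subpath 0 (t k))).Homotopic (c (γ (t k))) := by
      intro k
      induction k with
      | zero =>
        rw [ht0, Path.subpath_self]
        exact ⟨Path.Homotopy.transRefl _⟩
      | succ k ih =>
        have h1 : ((c (γ (t k))).trans (γ.subpath (t k) (t (k + 1)))).Homotopic
            (c (γ (t (k + 1)))) := by
          apply key
          obtain ⟨i, hi⟩ := hsub k
          have hr := Path.range_subpath_of_le γ _ _ (hmono (Nat.le_succ k))
          have hmem : ∀ u, γ.subpath (t k) (t (k + 1)) u ∈ if i then A else B := by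
            intro u
            have : γ.subpath (t k) (t (k + 1)) u ∈ γ '' Icc (t k) (t (k + 1)) :=
              hr ▸ mem_range_self u
            obtain ⟨v, hv, hv'⟩ := this
            exact hv' ▸ hi hv
          cases i
          · exact Or.inr (by simpa using hmem)
          · exact Or.inl (by simpa using hmem)
        refine Path.Homotopic.trans ?_ h1
        have h2 := ih.hcomp (Path.Homotopic.refl (γ.subpath (t k) (t (k + 1))))
        refine Path.Homotopic.trans ?_ h2
        refine Path.Homotopic.trans ?_ (Path.Homotopic.symm ⟨Path.Homotopy.transAssoc _ _ _⟩)
        exact (Path.Homotopic.refl _).hcomp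
          (Path.Homotopic.symm ⟨Path.Homotopy.subpathTransSubpath γ _ _ _⟩)
    have h1 := step n
    rw [hn n le_rfl, Path.subpath_zero_one] at h1
    have : ∀ (a' b' : Y) (ha : a' = a) (hb : b' = b),
        ((c a').trans (γ.cast ha hb)).Homotopic (c b') → ((c a).trans γ).Homotopic (c b) := by
      rintro a' b' rfl rfl h
      simpa using h
    exact this _ _ _ _ h1
  rw [simply_connected_iff_paths_homotopic']
  refine ⟨⟨⟨x₀⟩, fun a b => ⟨(c a).symm.trans (c b)⟩⟩, ?_⟩
  intro x y p q
  have h : ((c x).trans p).Homotopic ((c x).trans q) := (main _ _ p).trans (main _ _ q).symm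
  rw [← Path.Homotopic.Quotient.eq] at h ⊢
  have h' := congrArg (fun r => (Path.Homotopic.Quotient.mk (c x).symm).trans r) h
  simpa [Path.Homotopic.Quotient.mk_trans, ← Path.Homotopic.Quotient.trans_assoc] using h'

open ComplexConjugate in
theorem Complex.mul_conj_add_mul_conj_ne_zero {y w : ℂ} (h : y ≠ 0 ∨ w ≠ 0) :
    y * conj y + w * conj w ≠ 0 := by
  rw [Complex.mul_conj, Complex.mul_conj]
  norm_cast
  rcases h with h | h
  · exact (add_pos_of_pos_of_nonneg (Complex.normSq_pos.2 h) (Complex.normSq_nonneg w)).ne'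
  · exact (add_pos_of_nonneg_of_pos (Complex.normSq_nonneg y) (Complex.normSq_pos.2 h)).ne'

/-- The affine quadric `x y + z ^ 2 = 1`. -/
abbrev AffineQuadric : Type := {v : ℂ × ℂ × ℂ // v.1 * v.2.1 + v.2.2 ^ 2 = 1}

/-- The complement of the line `y = 0`, `ε z = 1` in the affine quadric. -/
def quadricChart (ε : ℂ) : Set AffineQuadric := {v | v.1.2.1 ≠ 0 ∨ 1 - ε * v.1.2.2 ≠ 0}

open ComplexConjugate in
/-- For `ε = ±1`, the complement of the line `y = 0`, `ε z = 1` in the affine quadric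
is an affine plane. -/
def quadricChartHomeomorph (ε : ℂ) (hε : ε ^ 2 = 1) : quadricChart ε ≃ₜ ℂ × ℂ :=
  have hs : ∀ v : quadricChart ε,
      (((1 + ε * v.1.1.2.2) * conj v.1.1.2.1 + v.1.1.1 * conj (1 - ε * v.1.1.2.2)) /
        (v.1.1.2.1 * conj v.1.1.2.1 + (1 - ε * v.1.1.2.2) * conj (1 - ε * v.1.1.2.2)))
        * v.1.1.2.1 = 1 + ε * v.1.1.2.2 ∧
      (((1 + ε * v.1.1.2.2) * conj v.1.1.2.1 + v.1.1.1 * conj (1 - ε * v.1.1.2.2)) /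
        (v.1.1.2.1 * conj v.1.1.2.1 + (1 - ε * v.1.1.2.2) * conj (1 - ε * v.1.1.2.2)))
        * (1 - ε * v.1.1.2.2) = v.1.1.1 := by
    rintro ⟨⟨⟨x, y, z⟩, hv⟩, hW⟩
    have hD := Complex.mul_conj_add_mul_conj_ne_zero (y := y) (w := 1 - ε * z) hW
    simp only at hv ⊢
    constructor
    · rw [div_mul_eq_mul_div, div_eq_iff hD]
      linear_combination (conj (1 - ε * z)) * (hv + z ^ 2 * hε)
    · rw [div_mul_eq_mul_div, div_eq_iff hD]
      linear_combination (-conj y) * (hv + z ^ 2 * hε)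
  { toFun := fun v =>
      (((1 + ε * v.1.1.2.2) * conj v.1.1.2.1 + v.1.1.1 * conj (1 - ε * v.1.1.2.2)) /
        (v.1.1.2.1 * conj v.1.1.2.1 + (1 - ε * v.1.1.2.2) * conj (1 - ε * v.1.1.2.2)), v.1.1.2.1)
    invFun := fun p => ⟨⟨(p.1 * (2 - p.1 * p.2), p.2, ε * (p.1 * p.2 - 1)), by
        linear_combination (p.1 * p.2 - 1) ^ 2 * hε⟩, by
      by_cases h : p.2 = 0
      · right
        simp only [h]
        intro h'
        have : (2 : ℂ) = 0 := by linear_combination h' - hε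
        norm_num at this
      · exact Or.inl h⟩
    left_inv := by
      intro v
      obtain ⟨h1, h2⟩ := hs v
      refine Subtype.ext (Subtype.ext (Prod.ext ?_ (Prod.ext rfl ?_)))
      · simp only
        rw [h1]
        refine Eq.trans ?_ h2
        congr 1
        ring
      · simp only
        rw [h1]
        linear_combination v.1.1.2.2 * hε
    right_inv := by
      rintro ⟨s, t⟩
      have hD : t * conj t + (2 - s * t) * conj (2 - s * t) ≠ 0 := by
        apply Complex.mul_conj_add_mul_conj_ne_zero
        by_cases h : t = 0
        · right; simp [h]
        · exact Or.inl h
      have e : ∀ r : ℂ, ε * (ε * r) = r := fun r => by linear_combination r * hε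
      simp only [e]
      refine Prod.ext ?_ rfl
      rw [show (1 : ℂ) - (s * t - 1) = 2 - s * t by ring, div_eq_iff hD]
      ring
    continuous_toFun := by
      refine Continuous.prodMk (Continuous.div ?_ ?_ ?_) ?_
      · fun_prop
      · fun_prop
      · exact fun v => Complex.mul_conj_add_mul_conj_ne_zero v.2
      · fun_prop
    continuous_invFun := by fun_prop }

instance : SimplyConnectedSpace AffineQuadric := by
  have hW : ∀ ε : ℂ, ε ^ 2 = 1 → IsSimplyConnected (quadricChart ε) := fun ε hε =>
    (quadricChartHomeomorph ε hε).toHomotopyEquiv.simplyConnectedSpace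
  have hO : ∀ ε : ℂ, IsOpen (quadricChart ε) := fun ε => by
    refine IsOpen.union ?_ ?_
    · exact isOpen_ne_fun (by fun_prop) continuous_const
    · exact isOpen_ne_fun (by fun_prop) continuous_const
  have hinter : quadricChart 1 ∩ quadricChart (-1) = {v | v.1.2.1 ≠ 0} := by
    ext ⟨⟨x, y, z⟩, hv⟩
    simp only [quadricChart, mem_inter_iff, mem_ofPred_eq]
    refine ⟨fun ⟨h1, h2⟩ h => ?_, fun h => ⟨Or.inl h, Or.inl h⟩⟩
    have h1 := h1.resolve_left (not_not.2 h)
    have h2 := h2.resolve_left (not_not.2 h)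
    refine mul_ne_zero h1 h2 ?_
    simp only [h] at hv
    linear_combination -hv
  refine simplyConnectedSpace_of_isOpen_union (hO 1) (hO (-1)) ?_ (hW 1 (by norm_num))
    (hW (-1) (by norm_num)) ?_
  · ext v
    simp only [quadricChart, mem_union, mem_ofPred_eq, mem_univ, iff_true]
    by_cases h : 1 - 1 * v.1.2.2 = 0
    · right; right
      intro h'
      have : (2 : ℂ) = 0 := by linear_combination h + h'
      norm_num at this
    · exact Or.inl (Or.inr h)
  · rw [hinter]
    have h0 : IsPathConnected ({0}ᶜ : Set ℂ) :=
      isPathConnected_compl_singleton_of_one_lt_rank (by simp) 0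
    have : PathConnectedSpace ({0}ᶜ : Set ℂ) := isPathConnected_iff_pathConnectedSpace.1 h0
    let φ : ({0}ᶜ : Set ℂ) × ℂ → AffineQuadric := fun p =>
      ⟨((1 - p.2 ^ 2) / p.1.1, p.1.1, p.2), by
        have : p.1.1 ≠ 0 := p.1.2
        field_simp
        ring⟩
    have hφ : Continuous φ := by
      refine Continuous.subtype_mk (Continuous.prodMk (Continuous.div ?_ ?_ fun p => p.1.2) ?_) _
      all_goals fun_prop
    have := isPathConnected_range hφ
    convert this
    ext ⟨⟨x, y, z⟩, hv⟩
    refine ⟨fun h => ⟨(⟨y, h⟩, z), Subtype.ext (Prod.ext ?_ rfl)⟩, ?_⟩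
    · simp only [mem_ofPred_eq] at h
      simp only at hv
      simp only [φ]
      rw [div_eq_iff h]
      linear_combination -hv
    · rintro ⟨p, hp⟩
      have : p.1.1 = y := congrArg (fun v : AffineQuadric => v.1.2.1) hp
      exact fun h => p.1.2 (this.trans h)

/-- The bundle over `U ∪ V` with fiber the group `G` obtained by gluing two trivial bundles
along left multiplication by the locally constant function `c` on `U ∩ V`. -/
def gluedGroupBundle {Y G : Type*} [TopologicalSpace Y] [Group G] [TopologicalSpace G]
    [IsTopologicalGroup G] {U V : Set Y} (hU : IsOpen U) (hV : IsOpen V) (hUV : U ∪ V = univ)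
    (c : Y → G) (hc : ContinuousOn c (U ∩ V)) :
    FiberBundleCore Bool Y G where
  baseSet i := if i then V else U
  isOpen_baseSet i := by cases i <;> simpa
  indexAt y := by classical exact if y ∈ U then false else true
  mem_baseSet_at y := by
    by_cases h : y ∈ U
    · simp [h]
    · have : y ∈ U ∪ V := hUV ▸ mem_univ y
      simpa [h] using this
  coordChange i j y g := (if j then c y else 1) * (if i then (c y)⁻¹ else 1) * g
  coordChange_self i y _ g := by cases i <;> simp
  continuousOn_coordChange i j := by
    have h1 : ContinuousOn (fun p : Y × G => c p.1) ((U ∩ V) ×ˢ univ) :=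
      hc.comp continuousOn_fst fun p hp => hp.1
    have h2 : ContinuousOn (fun p : Y × G => (c p.1)⁻¹) ((U ∩ V) ×ˢ univ) :=
      hc.inv.comp continuousOn_fst fun p hp => hp.1
    cases i <;> cases j
    · simpa using continuousOn_snd
    · simpa using! h1.mul continuousOn_snd
    · simpa [inter_comm] using! h2.mul continuousOn_snd
    · simpa using continuousOn_snd
  coordChange_comp i j k y _ g := by
    cases j <;> simp

theorem FiberBundleCore.isCoveringMap_proj {ι B F : Type*} [TopologicalSpace B]
    [TopologicalSpace F] [DiscreteTopology F] (Z : FiberBundleCore ι B F) :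
    IsCoveringMap Z.proj :=
  FiberBundle.isCoveringMap (F := F) (E := Z.Fiber)

/-- The point of the fiber over `b` with coordinate `g` in the chart `i`. -/
def FiberBundleCore.fiberPoint {ι B F : Type*} [TopologicalSpace B]
    [TopologicalSpace F] (Z : FiberBundleCore ι B F) (i : ι) (b : B) (g : F) :
    Z.proj ⁻¹' {b} :=
  ⟨⟨b, Z.coordChange i (Z.indexAt b) b g⟩, rfl⟩

theorem FiberBundleCore.fiberPoint_coordChange {ι B F : Type*} [TopologicalSpace B]
    [TopologicalSpace F] (Z : FiberBundleCore ι B F) {i j : ι} {b : B}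
    (hi : b ∈ Z.baseSet i) (hj : b ∈ Z.baseSet j) (g : F) :
    Z.fiberPoint j b (Z.coordChange i j b g) = Z.fiberPoint i b g := by
  refine Subtype.ext ?_
  simp only [fiberPoint]
  rw [Z.coordChange_comp _ _ _ _ ⟨⟨hi, hj⟩, Z.mem_baseSet_at b⟩]

theorem FiberBundleCore.monodromy_fiberPoint {ι B F : Type*} [TopologicalSpace B]
    [TopologicalSpace F] [DiscreteTopology F] (Z : FiberBundleCore ι B F) {i : ι} {x y : B}
    (γ : Path x y) (hγ : ∀ t, γ t ∈ Z.baseSet i) (g : F) :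
    Z.isCoveringMap_proj.monodromy (.mk γ) (Z.fiberPoint i x g) = Z.fiberPoint i y g := by
  have hcont : Continuous fun t => (Z.localTriv i).toOpenPartialHomeomorph.symm (γ t, g) := by
    refine (Z.localTriv i).toOpenPartialHomeomorph.continuousOn_symm.comp_continuous
      (by fun_prop) fun t => ?_
    rw [Z.mem_localTriv_target]
    exact hγ t
  refine Z.isCoveringMap_proj.monodromy_eq_of_map_eq (.mk
    { toFun := fun t => (Z.localTriv i).toOpenPartialHomeomorph.symm (γ t, g)
      continuous_toFun := hcont
      source' := ?_
      target' := ?_ }) ?_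
  · simp [fiberPoint]
  · simp [fiberPoint]
  · rfl

/-- Detection of free groups in the fundamental group of a space covered by two open sets. -/
theorem exists_injective_freeGroup_hom {Y α : Type*} [TopologicalSpace Y] {U V : Set Y}
    (hU : IsOpen U) (hV : IsOpen V) (hUV : U ∪ V = univ) (c : Y → FreeGroup α)
    (hc : ∀ y ∈ U ∩ V, ∀ᶠ z in nhds y, c z = c y) {m : Y} (hm : m ∈ U ∩ V) (hcm : c m = 1)
    (l : α → Y) (hcl : ∀ a, c (l a) = FreeGroup.of a) (hlU : ∀ a, JoinedIn U m (l a))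
    (hlV : ∀ a, JoinedIn V m (l a)) :
    ∃ f : FreeGroup α →* FundamentalGroup Y m, Function.Injective f := by
  let _ : TopologicalSpace (FreeGroup α) := ⊥
  have : DiscreteTopology (FreeGroup α) := ⟨rfl⟩
  have hc1 : ContinuousOn c (U ∩ V) := fun y hy => by
    refine ContinuousAt.continuousWithinAt ?_
    rw [ContinuousAt, nhds_discrete (FreeGroup α), Filter.tendsto_pure]
    exact hc y hy
  let Z := gluedGroupBundle hU hV hUV c hc1
  have hZU : ∀ y ∈ U, y ∈ Z.baseSet false := fun y hy => hy
  have hZV : ∀ y ∈ V, y ∈ Z.baseSet true := fun y hy => hy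
  choose p hp using hlU
  choose q hq using hlV
  let γ : α → FundamentalGroup Y m := fun a =>
    Path.Homotopic.Quotient.trans (.mk (p a)) (.mk (q a).symm)
  have hγ : ∀ a g, Z.isCoveringMap_proj.monodromyPerm m (γ a) (Z.fiberPoint false m g) =
      Z.fiberPoint false m (FreeGroup.of a * g) := fun a g => by
    rw [IsCoveringMap.coe_monodromyPerm]
    simp only [γ]
    rw [IsCoveringMap.monodromy_trans_apply,
      Z.monodromy_fiberPoint (p a) (fun t => hZU _ (hp a t)),
      ← Z.fiberPoint_coordChange (hZU _ (by simpa using hp a 1)) (hZV _ (by simpa using hq a 1)),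
      Z.monodromy_fiberPoint (q a).symm (fun t => hZV _ (hq a _)),
      ← Z.fiberPoint_coordChange (hZU _ hm.1) (hZV _ hm.2)]
    simp [Z, gluedGroupBundle, hcl, hcm]
  have hlift : ∀ w g, Z.isCoveringMap_proj.monodromyPerm m (FreeGroup.lift γ w)
      (Z.fiberPoint false m g) = Z.fiberPoint false m (w * g) := fun w => by
    induction w using FreeGroup.induction_on with
    | C1 =>
      intro g
      rw [map_one, map_one, one_mul, Equiv.Perm.one_apply]
    | of a => simpa using hγ a
    | inv_of a _ =>
      intro g
      rw [map_inv, map_inv, Equiv.Perm.inv_eq_iff_eq, FreeGroup.lift_apply_of, hγ]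
      simp
    | mul v w hv hw =>
      intro g
      rw [map_mul, map_mul, Equiv.Perm.mul_apply, hw, hv, mul_assoc]
  refine ⟨FreeGroup.lift γ, fun v w hvw => ?_⟩
  have h1 : Z.fiberPoint false m (v * 1) = Z.fiberPoint false m (w * 1) := by
    rw [← hlift, ← hlift, hvw]
  have h2 := congrArg (fun e => e.1.2) h1
  simp only [FiberBundleCore.fiberPoint, Z, gluedGroupBundle, hm.1, if_true, mul_one] at h2
  simpa using! h2

theorem Complex.joinedIn_compl_of_finite {S : Set ℂ} (hS : S.Finite) {ε : ℝ} (hε : |ε| = 1)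
    {x x' : ℝ} (hx : x ∉ Complex.re '' S) (hx' : x' ∉ Complex.re '' S) {T : Set ℂ}
    (hT : ∀ z : ℂ, 0 < ε * z.im ∨ z.re = x ∨ z.re = x' → z ∈ T) :
    JoinedIn (Sᶜ ∩ T) (x : ℂ) (x' : ℂ) := by
  obtain ⟨M, hM⟩ := (hS.image fun s => |s.im|).bddAbove
  have hM' : ∀ s ∈ S, |s.im| < |M| + 1 := fun s hs =>
    ((hM (mem_image_of_mem _ hs)).trans (le_abs_self M)).trans_lt (lt_add_one _)
  have hεε : ε * ε = 1 := by rw [← abs_mul_abs_self, hε, one_mul]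
  have hvert : ∀ y : ℝ, y ∉ Complex.re '' S → (y = x ∨ y = x') →
      JoinedIn (Sᶜ ∩ T) (y : ℂ) ⟨y, ε * (|M| + 1)⟩ := fun y hy hyx => by
    refine JoinedIn.of_segment_subset fun z hz => ?_
    have hre : z.re = y := by
      obtain ⟨a, b, -, -, hab, rfl⟩ := hz
      simp [← add_mul, hab]
    exact ⟨fun hzS => hy ⟨z, hzS, hre⟩, hT z (Or.inr (by simpa [hre] using hyx))⟩
  have hhor : JoinedIn (Sᶜ ∩ T) ⟨x, ε * (|M| + 1)⟩ ⟨x', ε * (|M| + 1)⟩ := by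
    refine JoinedIn.of_segment_subset fun z hz => ?_
    have him : z.im = ε * (|M| + 1) := by
      obtain ⟨a, b, -, -, hab, rfl⟩ := hz
      simp [← add_mul, hab]
    refine ⟨fun hzS => ?_, hT z (Or.inl ?_)⟩
    · have := hM' z hzS
      rw [him, abs_mul, hε, one_mul, abs_of_pos (by positivity)] at this
      exact this.false
    · rw [him, ← mul_assoc, hεε]
      positivity
  exact ((hvert x hx (Or.inl rfl)).trans hhor).trans (hvert x' hx' (Or.inr rfl)).symm

theorem JoinedIn.subtype_preimage {Y : Type*} [TopologicalSpace Y] {s t : Set Y} {x y : s}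
    (h : JoinedIn (s ∩ t) (x : Y) y) : JoinedIn (Subtype.val ⁻¹' t) x y := by
  obtain ⟨γ, hγ⟩ := h
  exact ⟨{ toFun := fun u => ⟨γ u, (hγ u).1⟩, source' := by simp, target' := by simp },
    fun u => (hγ u).2⟩

/-- The fundamental group of the complement of a finite set containing `±1` in the complex
plane contains a free group of rank two. -/
theorem Complex.exists_injective_freeGroup_hom_compl {S : Set ℂ} (hS : S.Finite)
    (h1 : (1 : ℂ) ∈ S) (h2 : (-1 : ℂ) ∈ S) :
    ∃ (m : ↥Sᶜ) (f : FreeGroup (Fin 2) →* FundamentalGroup ↥Sᶜ m), Function.Injective f := by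
  have hR := hS.image Complex.re
  obtain ⟨xl, hxl, hxlS⟩ := (Set.Iio_infinite (-1 : ℝ)).exists_notMem_finite hR
  obtain ⟨xm, hxm, hxmS⟩ :=
    (Set.Ioo_infinite (show (-1 : ℝ) < 1 by norm_num)).exists_notMem_finite hR
  obtain ⟨xr, hxr, hxrS⟩ := (Set.Ioi_infinite (1 : ℝ)).exists_notMem_finite hR
  rw [mem_Iio] at hxl
  rw [mem_Ioi] at hxr
  rw [mem_Ioo] at hxm
  have hmem : ∀ x : ℝ, x ∉ Complex.re '' S → (x : ℂ) ∈ Sᶜ := fun x hx h => hx ⟨x, h, by simp⟩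
  let T : ℝ → Set ℂ := fun ε => {z | 0 < ε * z.im ∨ (z.re ≠ 1 ∧ z.re ≠ -1)}
  have hT : ∀ ε, IsOpen (T ε) := fun ε => by
    have hc : Continuous fun z : ℂ => ε * z.im := by fun_prop
    refine (isOpen_lt continuous_const hc).union (IsOpen.inter ?_ ?_)
    · exact isOpen_ne_fun (by fun_prop) (by fun_prop)
    · exact isOpen_ne_fun (by fun_prop) (by fun_prop)
  have hTT : ∀ z ∈ T 1 ∩ T (-1), z.re ≠ 1 ∧ z.re ≠ -1 := by
    rintro z ⟨h | h, h' | h'⟩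
    · exfalso; linarith
    all_goals assumption
  let y : Fin 2 → ↥Sᶜ := ![⟨xl, hmem _ hxlS⟩, ⟨xr, hmem _ hxrS⟩]
  have hj : ∀ ε : ℝ, |ε| = 1 → ∀ a,
      JoinedIn (Subtype.val ⁻¹' T ε) (⟨xm, hmem _ hxmS⟩ : ↥Sᶜ) (y a) := fun ε hε a => by
    refine JoinedIn.subtype_preimage ?_
    fin_cases a
    · refine Complex.joinedIn_compl_of_finite hS hε hxmS hxlS fun z hz => ?_
      rcases hz with hz | hz | hz
      · exact Or.inl hz
      · exact Or.inr ⟨by rw [hz]; linarith, by rw [hz]; linarith⟩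
      · exact Or.inr ⟨by rw [hz]; linarith, by rw [hz]; linarith⟩
    · refine Complex.joinedIn_compl_of_finite hS hε hxmS hxrS fun z hz => ?_
      rcases hz with hz | hz | hz
      · exact Or.inl hz
      · exact Or.inr ⟨by rw [hz]; linarith, by rw [hz]; linarith⟩
      · exact Or.inr ⟨by rw [hz]; linarith, by rw [hz]; linarith⟩
  refine ⟨⟨xm, hmem _ hxmS⟩, exists_injective_freeGroup_hom
    ((hT 1).preimage continuous_subtype_val) ((hT (-1)).preimage continuous_subtype_val) ?_
    (fun z => if z.1.re < -1 then FreeGroup.of 0 else if z.1.re < 1 then 1 else FreeGroup.of 1)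
    ?_ ?_ ?_ y ?_ (hj 1 (by simp)) (hj (-1) (by simp))⟩
  · refine eq_univ_of_forall fun z => ?_
    by_contra h
    simp only [mem_union, mem_preimage, not_or, T, mem_ofPred_eq] at h
    obtain ⟨⟨ha, hb⟩, hc, -⟩ := h
    have him : z.1.im = 0 := by linarith
    refine z.2 ?_
    by_cases h : z.1.re = 1
    · convert h1
      exact Complex.ext h him
    · convert h2
      exact Complex.ext (by simpa using! fun h' => hb ⟨h, h'⟩) (by simpa using him)
  · intro z hz
    obtain ⟨hz1, hz2⟩ := hTT z.1 hz
    have hcont : Continuous fun w : ↥Sᶜ => w.1.re := by fun_prop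
    rcases hz1.lt_or_gt with h | h
    · rcases hz2.lt_or_gt with h' | h'
      · filter_upwards [hcont.continuousAt.eventually_lt_const h'] with w hw
        simp [hw, h']
      · filter_upwards [hcont.continuousAt.eventually_lt_const h,
          hcont.continuousAt.eventually_const_lt h'] with w hw hw'
        simp [hw, h, hw'.not_gt, h'.not_gt]
    · filter_upwards [hcont.continuousAt.eventually_const_lt h] with w hw
      have e1 : ¬ w.1.re < -1 := by linarith
      have e2 : ¬ z.1.re < -1 := by linarith
      simp [e1, e2, hw.not_gt, h.not_gt]
  · exact ⟨Or.inr ⟨by simpa using hxm.2.ne, by simpa using! hxm.1.ne'⟩,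
      Or.inr ⟨by simpa using hxm.2.ne, by simpa using! hxm.1.ne'⟩⟩
  · simp [hxm.1.not_gt, hxm.2]
  · intro a
    fin_cases a
    · simp [y, hxl]
    · have e1 : ¬ xr < -1 := by linarith
      simp [y, e1, hxr.not_gt]

/-- The points of an invariant set at which a quadratic function takes the value one, with its
action of `±1`. -/
def unitLevel (F : (Fin 3 → ℂ) → ℂ) (hF : ∀ (a : ℂ) v, F (a • v) = a ^ 2 * F v)
    (O : Set (Fin 3 → ℂ)) (hO : ∀ a : ℂ, a ≠ 0 → ∀ v ∈ O, a • v ∈ O) :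
    SubMulAction ℤˣ (Fin 3 → ℂ) where
  carrier := {v | v ∈ O ∧ F v = 1}
  smul_mem' u v hv := by
    obtain ⟨h1, h2⟩ := hv
    rcases Int.units_eq_one_or u with rfl | rfl
    · simpa using ⟨h1, h2⟩
    · have : (-1 : ℤˣ) • v = (-1 : ℂ) • v := by simp
      rw [this]
      exact ⟨hO _ (by simp) v h1, by rw [hF, h2]; norm_num⟩

theorem ne_zero_of_mem_unitLevel {F : (Fin 3 → ℂ) → ℂ}
    {hF : ∀ (a : ℂ) v, F (a • v) = a ^ 2 * F v} {O : Set (Fin 3 → ℂ)}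
    {hO : ∀ a : ℂ, a ≠ 0 → ∀ v ∈ O, a • v ∈ O} (v : unitLevel F hF O hO) : v.1 ≠ 0 := by
  intro h
  have h1 : F 0 = 0 := by simpa using hF 0 0
  have h2 := v.2.2
  rw [h, h1] at h2
  exact zero_ne_one h2

/-- The projection from the unit level set to the projective plane. -/
def unitLevelProj {F : (Fin 3 → ℂ) → ℂ}
    {hF : ∀ (a : ℂ) v, F (a • v) = a ^ 2 * F v} {O : Set (Fin 3 → ℂ)}
    {hO : ∀ a : ℂ, a ≠ 0 → ∀ v ∈ O, a • v ∈ O} {X : Set P2}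
    (hX : ∀ v (hv : v ≠ 0), Projectivization.mk ℂ v hv ∈ X ↔ v ∈ O) (v : unitLevel F hF O hO) :
    X :=
  ⟨Projectivization.mk ℂ v.1 (ne_zero_of_mem_unitLevel v), (hX _ _).2 v.2.1⟩

theorem Projectivization.isQuotientMap_mk :
    Topology.IsQuotientMap fun v : {v : Fin 3 → ℂ // v ≠ 0} =>
      (Projectivization.mk ℂ v.1 v.2 : P2) :=
  @isQuotientMap_quotient_mk' _ _ (projectivizationSetoid ℂ (Fin 3 → ℂ))

open Filter Topology in
theorem isOpen_setOf_exists_smul_mem_unitLevel {F : (Fin 3 → ℂ) → ℂ}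
    (hF : ∀ (a : ℂ) v, F (a • v) = a ^ 2 * F v) {O : Set (Fin 3 → ℂ)} (hFc : Continuous F)
    (hOo : IsOpen O) {W : Set (Fin 3 → ℂ)} (hW : IsOpen W)
    (hO : ∀ a : ℂ, a ≠ 0 → ∀ v ∈ O, a • v ∈ O) :
    IsOpen {v : Fin 3 → ℂ | ∃ a : ℂ, a ≠ 0 ∧ a • v ∈ W ∧ a • v ∈ unitLevel F hF O hO} := by
  rw [isOpen_iff_eventually]
  rintro v ⟨a, ha, haW, haO, haF⟩
  have hsm : ContinuousAt (fun w : Fin 3 → ℂ => a • w) v := by fun_prop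
  have h1 : ContinuousAt (fun w : Fin 3 → ℂ => F (a • w)) v := by fun_prop
  have h2 : ContinuousAt (fun w : Fin 3 → ℂ => (F (a • w) ^ (((2 : ℕ) : ℂ)⁻¹))⁻¹) v := by
    refine ContinuousAt.inv₀ (h1.cpow continuousAt_const ?_) ?_
    · simp [haF]
    · simp [haF]
  have h3 : ContinuousAt
      (fun w : Fin 3 → ℂ => (F (a • w) ^ (((2 : ℕ) : ℂ)⁻¹))⁻¹ • (a • w)) v := h2.smul hsm
  have h4 : ∀ᶠ w in 𝓝 v, (F (a • w) ^ (((2 : ℕ) : ℂ)⁻¹))⁻¹ • (a • w) ∈ W :=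
    h3.eventually_mem (hW.mem_nhds (by simpa [haF] using haW))
  filter_upwards [h4, hsm.eventually_mem (hOo.mem_nhds haO),
    h1.eventually_ne (y := 0) (by simp [haF])] with w hw1 hw2 hw3
  have hs : (F (a • w) ^ (((2 : ℕ) : ℂ)⁻¹)) ^ 2 = F (a • w) :=
    Complex.cpow_nat_inv_pow _ two_ne_zero
  have hs0 : (F (a • w) ^ (((2 : ℕ) : ℂ)⁻¹))⁻¹ ≠ 0 := by
    refine inv_ne_zero fun h => hw3 ?_
    rw [← hs, h]
    simp
  refine ⟨(F (a • w) ^ (((2 : ℕ) : ℂ)⁻¹))⁻¹ * a, mul_ne_zero hs0 ha, ?_, ?_⟩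
  · rwa [mul_smul]
  · rw [mul_smul]
    refine ⟨hO _ hs0 _ hw2, ?_⟩
    rw [hF, inv_pow, hs, inv_mul_cancel₀ hw3]

theorem unitLevelProj_isQuotientCoveringMap {F : (Fin 3 → ℂ) → ℂ}
    (hF : ∀ (a : ℂ) v, F (a • v) = a ^ 2 * F v) {O : Set (Fin 3 → ℂ)} (hFc : Continuous F)
    (hOo : IsOpen O) (hFO : ∀ v ∈ O, F v ≠ 0)
    (hO : ∀ a : ℂ, a ≠ 0 → ∀ v ∈ O, a • v ∈ O) {X : Set P2}
    (hX : ∀ v (hv : v ≠ 0), Projectivization.mk ℂ v hv ∈ X ↔ v ∈ O) :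
    IsQuotientCoveringMap (unitLevelProj (F := F) (hF := hF) (hO := hO) hX) ℤˣ := by
  have hcont : Continuous (unitLevelProj (F := F) (hF := hF) (hO := hO) hX) := by
    refine Continuous.subtype_mk (Projectivization.isQuotientMap_mk.continuous.comp
      (Continuous.subtype_mk continuous_subtype_val ne_zero_of_mem_unitLevel)) _
  have hsurj : Function.Surjective (unitLevelProj (F := F) (hF := hF) (hO := hO) hX) := by
    rintro ⟨x, hx⟩
    induction x using Projectivization.ind with
    | h v hv =>
      have hvO := (hX v hv).1 hx
      obtain ⟨s, hs⟩ := IsAlgClosed.exists_pow_nat_eq (F v) two_pos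
      have hs0 : s ≠ 0 := fun h => hFO v hvO (by rw [← hs, h]; simp)
      refine ⟨⟨s⁻¹ • v, hO _ (inv_ne_zero hs0) _ hvO, ?_⟩, Subtype.ext ?_⟩
      · rw [hF, inv_pow, hs, inv_mul_cancel₀ (hFO v hvO)]
      · exact (Projectivization.mk_eq_mk_iff' ℂ _ _ _ _).2 ⟨s⁻¹, rfl⟩
  have hopen : IsOpenMap (unitLevelProj (F := F) (hF := hF) (hO := hO) hX) := by
    rintro _ ⟨W, hW, rfl⟩
    have h1 := isOpen_setOf_exists_smul_mem_unitLevel hF hFc hOo hW hO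
    refine ⟨Subtype.val '' (unitLevelProj hX '' (Subtype.val ⁻¹' W)), ?_,
      preimage_image_eq _ Subtype.val_injective⟩
    rw [← Projectivization.isQuotientMap_mk.isOpen_preimage]
    convert h1.preimage (continuous_subtype_val (p := fun v : Fin 3 → ℂ => v ≠ 0)) using 1
    ext ⟨v, hv⟩
    simp only [mem_preimage, mem_image, exists_exists_and_eq_and, mem_ofPred_eq]
    constructor
    · rintro ⟨w, hwW, hw⟩
      obtain ⟨a, ha⟩ := (Projectivization.mk_eq_mk_iff' ℂ _ _ _ _).1 hw
      refine ⟨a, ?_, by rwa [ha], by rw [ha]; exact w.2⟩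
      rintro rfl
      exact ne_zero_of_mem_unitLevel w (by rw [← ha, zero_smul])
    · rintro ⟨a, ha, haW, haO⟩
      exact ⟨⟨_, haO⟩, haW, (Projectivization.mk_eq_mk_iff' ℂ _ _ _ _).2 ⟨a, rfl⟩⟩
  refine { hopen.isQuotientMap hcont hsurj with
    continuous_const_smul := ?_, apply_eq_iff_mem_orbit := ?_, disjoint := ?_ }
  · intro u
    refine Continuous.subtype_mk ?_ _
    exact continuous_subtype_val.const_smul u
  · intro v w
    rw [Subtype.ext_iff]
    refine (Projectivization.mk_eq_mk_iff' ℂ _ _ _ _).trans ⟨?_, ?_⟩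
    · rintro ⟨a, ha⟩
      have h1 : a ^ 2 = 1 := by
        have := hF a w.1
        rwa [ha, v.2.2, w.2.2, mul_one, eq_comm] at this
      rcases (sq_eq_sq_iff_eq_or_eq_neg.1 (h1.trans (one_pow 2).symm)) with rfl | rfl
      · exact ⟨1, Subtype.ext (by simpa using ha)⟩
      · exact ⟨-1, Subtype.ext (by simpa using ha)⟩
    · rintro ⟨u, hu⟩
      have hu := congrArg Subtype.val hu
      rcases Int.units_eq_one_or u with rfl | rfl
      · exact ⟨1, by simpa using hu⟩
      · exact ⟨-1, by simpa using hu⟩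
  · intro v
    have hv := ne_zero_of_mem_unitLevel v
    refine ⟨Subtype.val ⁻¹' Metric.ball v.1 ‖v.1‖, continuous_subtype_val.continuousAt.preimage_mem_nhds
      (Metric.ball_mem_nhds _ (norm_pos_iff.2 hv)), fun u hu => ?_⟩
    rcases Int.units_eq_one_or u with rfl | rfl
    · rfl
    · exfalso
      obtain ⟨_, ⟨w, hw, rfl⟩, hw'⟩ := hu
      have e : ((-1 : ℤˣ) • w).1 = -w.1 := by simp
      simp only [mem_preimage, Metric.mem_ball, dist_eq_norm, e] at hw hw'
      have h2 : ‖(w.1 - v.1) + (-w.1 - v.1)‖ = 2 * ‖v.1‖ := by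
        rw [show (w.1 - v.1) + (-w.1 - v.1) = (-2 : ℂ) • v.1 by module, norm_smul]
        simp
      have := norm_add_le (w.1 - v.1) (-w.1 - v.1)
      linarith

theorem Finsupp.exists_eq_single_add_single_of_degree_eq_two {ι : Type*} {d : ι →₀ ℕ}
    (hd : d.degree = 2) : ∃ i j, d = Finsupp.single i 1 + Finsupp.single j 1 := by
  classical
  have h : Multiset.card (Finsupp.toMultiset d) = 2 := by
    rw [Finsupp.card_toMultiset, ← hd]
    rfl
  obtain ⟨i, j, hij⟩ := Multiset.card_eq_two.1 h
  refine ⟨i, j, ?_⟩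
  rw [← Finsupp.toMultiset_toFinsupp d, hij]
  simp [← Multiset.singleton_add]

theorem MvPolynomial.IsHomogeneous.eval_add_and_eval_smul {P : MvPolynomial (Fin 3) ℂ}
    (hP : P.IsHomogeneous 2) :
    (∀ v w, eval (v + w) P = eval v P + eval w P + ∑ i, gradP P v i * w i) ∧
      ∀ (a : ℂ) (v : Fin 3 → ℂ), eval (a • v) P = a ^ 2 * eval v P := by
  unfold gradP
  rw [P.as_sum]
  refine Finset.sum_induction _ (fun P : MvPolynomial (Fin 3) ℂ =>
    (∀ v w, eval (v + w) P = eval v P + eval w P + ∑ i, eval v (pderiv i P) * w i) ∧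
      ∀ (a : ℂ) (v : Fin 3 → ℂ), eval (a • v) P = a ^ 2 * eval v P) ?_ ?_ ?_
  · rintro p q ⟨h1, h2⟩ ⟨h3, h4⟩
    refine ⟨fun v w => ?_, fun a v => ?_⟩
    · simp only [map_add, h1, h3, add_mul, Finset.sum_add_distrib]
      ring
    · simp only [map_add, h2, h4]
      ring
  · simp
  · intro d hd
    have hdeg : d.degree = 2 := by
      have := hP (mem_support_iff.1 hd)
      rwa [Finsupp.degree_eq_weight_one]
    obtain ⟨i, j, hij⟩ := Finsupp.exists_eq_single_add_single_of_degree_eq_two hdeg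
    have hmon : monomial d (coeff d P) = C (coeff d P) * (X i * X j) := by
      rw [X, X, monomial_mul, C_mul_monomial, ← hij, one_mul, mul_one]
    rw [hmon]
    generalize coeff d P = c
    refine ⟨fun v w => ?_, fun a v => ?_⟩
    · simp only [map_mul, eval_C, eval_X, Pi.add_apply, Derivation.leibniz, pderiv_C, pderiv_X,
        map_add, smul_eq_mul, mul_zero, add_zero, add_mul, Finset.sum_add_distrib, mul_add]
      simp [Pi.single_apply, apply_ite (eval v)]
      ring
    · simp only [map_mul, eval_C, eval_X, Pi.smul_apply, smul_eq_mul]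
      ring

/-- The quadratic form defined by a homogeneous polynomial of degree two. -/
def MvPolynomial.IsHomogeneous.quadraticForm {P : MvPolynomial (Fin 3) ℂ}
    (hP : P.IsHomogeneous 2) : QuadraticForm ℂ (Fin 3 → ℂ) :=
  have hpol : ∀ v w, QuadraticMap.polar (fun v => eval v P) v w = ∑ i, gradP P v i * w i :=
    fun v w => by rw [QuadraticMap.polar, hP.eval_add_and_eval_smul.1]; ring
  QuadraticMap.ofPolar (fun v => eval v P)
    (fun a v => by rw [hP.eval_add_and_eval_smul.2, sq, smul_eq_mul])
    (fun v v' w => by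
      rw [QuadraticMap.polar_comm, hpol, QuadraticMap.polar_comm _ v, hpol,
        QuadraticMap.polar_comm _ v', hpol]
      simp [mul_add, Finset.sum_add_distrib])
    (fun a v w => by
      rw [QuadraticMap.polar_comm, hpol, QuadraticMap.polar_comm _ v, hpol]
      simp only [Pi.smul_apply, smul_eq_mul, Finset.mul_sum]
      exact Finset.sum_congr rfl fun i _ => by ring)

@[simp]
theorem MvPolynomial.IsHomogeneous.quadraticForm_apply {P : MvPolynomial (Fin 3) ℂ}
    (hP : P.IsHomogeneous 2) (v : Fin 3 → ℂ) : hP.quadraticForm v = eval v P := rfl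

theorem MvPolynomial.IsHomogeneous.polar_quadraticForm {P : MvPolynomial (Fin 3) ℂ}
    (hP : P.IsHomogeneous 2) (v w : Fin 3 → ℂ) :
    QuadraticMap.polar hP.quadraticForm v w = ∑ i, gradP P v i * w i := by
  rw [QuadraticMap.polar]
  simp only [quadraticForm_apply, hP.eval_add_and_eval_smul.1]
  ring

theorem MvPolynomial.IsHomogeneous.eq_zero_of_polar_eq_zero {P : MvPolynomial (Fin 3) ℂ}
    (hP : P.IsHomogeneous 2) (hP' : ∀ v : Fin 3 → ℂ, v ≠ 0 → gradP P v ≠ 0) (v : Fin 3 → ℂ)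
    (hv : ∀ w, QuadraticMap.polar hP.quadraticForm v w = 0) : v = 0 := by
  by_contra h
  refine hP' v h (_root_.funext fun i => ?_)
  have := hv (Pi.single i 1)
  rw [hP.polar_quadraticForm] at this
  simpa [Pi.single_apply] using this

theorem mk_mem_zeroLocusP2_iff {P : MvPolynomial (Fin 3) ℂ} (hP : P.IsHomogeneous 2)
    (v : Fin 3 → ℂ) (hv : v ≠ 0) :
    (Projectivization.mk ℂ v hv : P2) ∈ zeroLocusP2 P ↔ eval v P = 0 := by
  obtain ⟨a, ha⟩ := Projectivization.exists_smul_eq_mk_rep ℂ v hv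
  change eval (Projectivization.mk ℂ v hv).rep P = 0 ↔ _
  rw [← ha, Units.smul_def, hP.eval_add_and_eval_smul.2]
  simp

theorem mk_mem_tangentLineAt_iff {P : MvPolynomial (Fin 3) ℂ} (hP : P.IsHomogeneous 2) (p : P2)
    (v : Fin 3 → ℂ) (hv : v ≠ 0) :
    (Projectivization.mk ℂ v hv : P2) ∈ tangentLineAt P p ↔
      QuadraticMap.polar hP.quadraticForm p.rep v = 0 := by
  obtain ⟨a, ha⟩ := Projectivization.exists_smul_eq_mk_rep ℂ v hv
  change ∑ i, gradP P p.rep i * (Projectivization.mk ℂ v hv).rep i = 0 ↔ _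
  rw [← hP.polar_quadraticForm, ← ha, Units.smul_def, QuadraticMap.polar_smul_right]
  simp

theorem exists_eq_smul_add_smul_add_smul {e f r : Fin 3 → ℂ}
    (h : LinearIndependent ℂ ![e, f, r]) (v : Fin 3 → ℂ) :
    ∃ x y z : ℂ, v = x • e + y • f + z • r := by
  have h1 := h.span_eq_top_of_card_eq_finrank' (by simp)
  have h2 : v ∈ Submodule.span ℂ (range ![e, f, r]) := h1 ▸ Submodule.mem_top
  obtain ⟨c, hc⟩ := (Submodule.mem_span_range_iff_exists_fun ℂ).1 h2
  exact ⟨c 0, c 1, c 2, by rw [← hc, Fin.sum_univ_three]; rfl⟩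

namespace QuadraticForm

variable {Q : QuadraticForm ℂ (Fin 3 → ℂ)}

theorem map_smul_add_smul_add_smul {e f r : Fin 3 → ℂ} (he : Q e = 0) (hf : Q f = 0)
    (her : QuadraticMap.polar Q e r = 0) (hfr : QuadraticMap.polar Q f r = 0) (x y z : ℂ) :
    Q (x • e + y • f + z • r) = QuadraticMap.polar Q e f * (x * y) + Q r * z ^ 2 := by
  rw [QuadraticMap.map_add Q, QuadraticMap.map_add Q]
  simp only [QuadraticMap.polar_add_left, QuadraticMap.polar_smul_left,
    QuadraticMap.polar_smul_right, QuadraticMap.map_smul, he, hf, her, hfr, smul_eq_mul]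
  ring

theorem polar_smul_add_smul_add_smul {e f r : Fin 3 → ℂ} (v : Fin 3 → ℂ) (x y z : ℂ) :
    QuadraticMap.polar Q v (x • e + y • f + z • r) = x * QuadraticMap.polar Q v e +
      y * QuadraticMap.polar Q v f + z * QuadraticMap.polar Q v r := by
  simp only [QuadraticMap.polar_add_right, QuadraticMap.polar_smul_right, smul_eq_mul]

theorem polar_ne_zero_of_linearIndependent
    (hQ : ∀ v, (∀ w, QuadraticMap.polar Q v w = 0) → v = 0) {e f : Fin 3 → ℂ}
    (he : Q e = 0) (hf : Q f = 0) (hef : LinearIndependent ℂ ![e, f]) :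
    QuadraticMap.polar Q e f ≠ 0 := by
  intro h
  obtain ⟨g, hg⟩ := exists_linearIndependent_snoc_of_lt_finrank hef (by simp)
  have hg' : LinearIndependent ℂ ![e, f, g] := by
    have : Fin.snoc ![e, f] g = ![e, f, g] := by simp
    rwa [this] at hg
  have hfe : QuadraticMap.polar Q f e = 0 := by rw [QuadraticMap.polar_comm, h]
  have h0 : QuadraticMap.polar Q f g • e + (-QuadraticMap.polar Q e g) • f = 0 := by
    refine hQ _ fun w => ?_
    obtain ⟨x, y, z, rfl⟩ := exists_eq_smul_add_smul_add_smul hg' w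
    simp only [polar_smul_add_smul_add_smul, QuadraticMap.polar_add_left,
      QuadraticMap.polar_smul_left, QuadraticMap.polar_self, he, hf, h, hfe, smul_eq_mul]
    simp
    ring
  have h1 := LinearIndependent.pair_iff.1 hef _ _ h0
  refine hef.ne_zero 0 (hQ _ fun w => ?_)
  obtain ⟨x, y, z, rfl⟩ := exists_eq_smul_add_smul_add_smul hg' w
  simp [QuadraticMap.polar_self, he, h, neg_eq_zero.1 h1.2]

theorem linearIndependent_of_polar {e f r : Fin 3 → ℂ} (he : Q e = 0) (hf : Q f = 0)
    (hef : QuadraticMap.polar Q e f ≠ 0) (hr : r ≠ 0)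
    (her : QuadraticMap.polar Q e r = 0) (hfr : QuadraticMap.polar Q f r = 0) :
    LinearIndependent ℂ ![e, f, r] := by
  rw [Fintype.linearIndependent_iff]
  intro g hg
  rw [Fin.sum_univ_three] at hg
  have hg' : g 0 • e + g 1 • f + g 2 • r = 0 := hg
  have e1 : g 1 = 0 := by
    have : QuadraticMap.polar Q e (g 0 • e + g 1 • f + g 2 • r) = 0 := by rw [hg']; simp
    rw [polar_smul_add_smul_add_smul, QuadraticMap.polar_self, he, her] at this
    simpa [hef] using this
  have e0 : g 0 = 0 := by
    have : QuadraticMap.polar Q f (g 0 • e + g 1 • f + g 2 • r) = 0 := by rw [hg']; simp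
    rw [polar_smul_add_smul_add_smul, QuadraticMap.polar_self, hf, hfr,
      QuadraticMap.polar_comm Q f e] at this
    simpa [hef] using this
  have e2 : g 2 = 0 := by
    rw [e0, e1] at hg'
    simpa [hr] using hg'
  intro i
  fin_cases i <;> assumption

theorem exists_ne_zero_polar_eq_zero (Q : QuadraticForm ℂ (Fin 3 → ℂ)) (e f : Fin 3 → ℂ) :
    ∃ r, r ≠ 0 ∧ QuadraticMap.polar Q e r = 0 ∧ QuadraticMap.polar Q f r = 0 := by
  have h := LinearMap.ker_ne_bot_of_finrank_lt
    (f := (Q.polarBilin e).prod (Q.polarBilin f)) (by simp)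
  obtain ⟨r, hr, hr0⟩ := Submodule.exists_mem_ne_zero_of_ne_bot h
  rw [LinearMap.mem_ker, LinearMap.prod_apply, Function.prod_apply, Prod.mk_eq_zero] at hr
  exact ⟨r, hr0, hr⟩

theorem exists_linearEquiv_apply_eq_sum_sq
    (hQ : ∀ v, (∀ w, QuadraticMap.polar Q v w = 0) → v = 0) :
    ∃ φ : (Fin 3 → ℂ) ≃ₗ[ℂ] (Fin 3 → ℂ), ∀ v, Q v = φ v 0 ^ 2 + φ v 1 ^ 2 + φ v 2 ^ 2 := by
  have h1 := QuadraticForm.equivalent_weightedSumSquares_of_isAlgClosed Q (fun v hv => hQ v fun w => ?_)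
  · have h2 : ∀ k, k = 3 → QuadraticMap.Equivalent Q
        (QuadraticMap.weightedSumSquares ℂ (1 : Fin k → ℂ)) →
        ∃ φ : (Fin 3 → ℂ) ≃ₗ[ℂ] (Fin 3 → ℂ), ∀ v, Q v = φ v 0 ^ 2 + φ v 1 ^ 2 + φ v 2 ^ 2 := by
      rintro k rfl ⟨φ⟩
      refine ⟨φ.toLinearEquiv, fun v => ?_⟩
      rw [← φ.map_app v, QuadraticMap.weightedSumSquares_apply, Fin.sum_univ_three]
      simp [sq]
    exact h2 _ (by simp) h1
  · have := hv w
    rw [QuadraticMap.associated_apply] at this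
    rw [QuadraticMap.polar]
    simpa using this

end QuadraticForm

theorem IsCoveringMap.fundamentalGroup_map_injective {E X : Type*} [TopologicalSpace E]
    [TopologicalSpace X] {p : E → X} (hp : IsCoveringMap p) (e : E) :
    Function.Injective (FundamentalGroup.map ⟨p, hp.continuous⟩ e) :=
  fun _ _ h => hp.injective_path_homotopic_map e e h

theorem FundamentalGroup.map_injective_of_leftInverse {X Y : Type*} [TopologicalSpace X]
    [TopologicalSpace Y] (f : C(X, Y)) (g : C(Y, X)) (hgf : ∀ x, g (f x) = x) (x : X) :
    Function.Injective (FundamentalGroup.map f x) := by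
  intro a b h
  obtain ⟨γ, rfl⟩ := Path.Homotopic.Quotient.mk_surjective a
  obtain ⟨γ', rfl⟩ := Path.Homotopic.Quotient.mk_surjective b
  have h1 : (γ.map f.continuous).Homotopic (γ'.map f.continuous) :=
    Path.Homotopic.Quotient.eq.1 h
  obtain ⟨H⟩ := h1.map g
  refine Path.Homotopic.Quotient.eq.2 ⟨?_⟩
  have e : ∀ δ : Path x x,
      ((δ.map f.continuous).map g.continuous).toContinuousMap = δ.toContinuousMap := fun δ => by
    ext t
    simp [hgf]
  unfold Path.Homotopy at H ⊢
  rw [e, e] at H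
  exact H

theorem IsBig.of_injective {G : Type*} [Group G] (f : FreeGroup (Fin 2) →* G)
    (hf : Function.Injective f) : IsBig G :=
  ⟨f.range, ⟨(f.ofInjective hf).symm⟩⟩

theorem Complex.finite_setOf_add_mul_add_mul_sq_eq_zero {a : ℂ} (ha : a ≠ 0) (b c : ℂ) :
    {t : ℂ | a + b * t + c * t ^ 2 = 0}.Finite := by
  have hp : (Polynomial.C a + Polynomial.C b * Polynomial.X +
      Polynomial.C c * Polynomial.X ^ 2 : Polynomial ℂ) ≠ 0 := fun h => ha <| by
    simpa using congrArg (Polynomial.eval 0) h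
  refine (Polynomial.finite_setOfPred_isRoot hp).subset fun t ht => ?_
  simpa [Polynomial.IsRoot] using ht

theorem pathConnectedSpace_of_mk_mem_iff {ι : Type*} [Finite ι] {X : Set P2}
    (q : ι → QuadraticForm ℂ (Fin 3 → ℂ))
    (hX : ∀ v (hv : v ≠ 0), Projectivization.mk ℂ v hv ∈ X ↔ ∀ i, q i v ≠ 0) [Nonempty ι]
    [Nonempty X] : PathConnectedSpace X := by
  have hne : ∀ v, (∀ i, q i v ≠ 0) → v ≠ 0 := by
    rintro _ h rfl
    exact h (Classical.arbitrary ι) (by simp)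
  refine ⟨inferInstance, ?_⟩
  rintro ⟨x, hx⟩ ⟨y, hy⟩
  induction x using Projectivization.ind with
  | h v hv =>
  induction y using Projectivization.ind with
  | h w hw =>
  have hv' := (hX v hv).1 hx
  have hw' := (hX w hw).1 hy
  let T : Set ℂ := {t | ∃ i, q i (v + t • (w - v)) = 0}
  have hT : T.Finite := by
    have : T = ⋃ i, {t : ℂ | q i v + QuadraticMap.polar (q i) v (w - v) * t +
        q i (w - v) * t ^ 2 = 0} := by
      ext t
      simp only [T, mem_ofPred_eq, mem_iUnion, QuadraticMap.map_add (q _),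
        QuadraticMap.polar_smul_right, QuadraticMap.map_smul, smul_eq_mul]
      refine exists_congr fun i => ?_
      rw [← sub_eq_zero (b := (0 : ℂ)), ← sub_eq_zero (b := (0 : ℂ))]
      ring_nf
    rw [this]
    exact finite_iUnion fun i => Complex.finite_setOf_add_mul_add_mul_sq_eq_zero (hv' i) _ _
  have hTc : IsPathConnected Tᶜ :=
    hT.countable.isPathConnected_compl_of_one_lt_rank (by simp)
  have : PathConnectedSpace ↥Tᶜ := isPathConnected_iff_pathConnectedSpace.1 hTc
  have hTi : ∀ t : ↥Tᶜ, ∀ i, q i (v + t.1 • (w - v)) ≠ 0 := fun t i h => t.2 ⟨i, h⟩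
  let g : ↥Tᶜ → X := fun t => ⟨Projectivization.mk ℂ (v + t.1 • (w - v)) (hne _ (hTi t)),
    (hX _ _).2 (hTi t)⟩
  have hg : Continuous g := by
    have h1 : Continuous fun t : ↥Tᶜ => v + t.1 • (w - v) := by fun_prop
    exact Continuous.subtype_mk (Projectivization.isQuotientMap_mk.continuous.comp
      (Continuous.subtype_mk h1 fun t => hne _ (hTi t))) _
  have h0 : (0 : ℂ) ∈ Tᶜ := by
    rintro ⟨i, hi⟩
    exact hv' i (by simpa using hi)
  have h1 : (1 : ℂ) ∈ Tᶜ := by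
    rintro ⟨i, hi⟩
    exact hw' i (by simpa using hi)
  have h2 := (PathConnectedSpace.joined (⟨0, h0⟩ : ↥Tᶜ) ⟨1, h1⟩).map hg
  convert h2 using 1
  · simp [g]
  · simp [g]

theorem exists_injective_freeGroup_hom_of_normal_form {ι : Type*} [Finite ι] {X : Set P2}
    (q : ι → QuadraticForm ℂ (Fin 3 → ℂ)) (hq : ∀ i, Continuous (q i))
    (hX : ∀ v (hv : v ≠ 0), Projectivization.mk ℂ v hv ∈ X ↔ ∀ i, q i v ≠ 0)
    {e f r : Fin 3 → ℂ} (hlin : LinearIndependent ℂ ![e, f, r]) {b c : ι → ℂ}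
    (hb : ∀ i, b i ≠ 0)
    (hform : ∀ i x y z, q i (x • e + y • f + z • r) = b i * (x * y + c i * z ^ 2))
    {i₀ i₁ : ι} (hc : c i₀ - c i₁ = 1) :
    ∃ (x : X) (φ : FreeGroup (Fin 2) →* FundamentalGroup X x), Function.Injective φ := by
  let B := basisOfLinearIndependentOfCardEqFinrank hlin (by simp)
  have hB : ⇑B = ![e, f, r] := coe_basisOfLinearIndependentOfCardEqFinrank _ _
  have he : B.coord 2 e = 0 := by
    rw [show e = B 0 by rw [hB]; rfl]; simp
  have hf : B.coord 2 f = 0 := by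
    rw [show f = B 1 by rw [hB]; rfl]; simp
  have hr : B.coord 2 r = 1 := by
    rw [show r = B 2 by rw [hB]; rfl]; simp
  have hζ : ∀ x y z : ℂ, B.coord 2 (x • e + y • f + z • r) = z := fun x y z => by
    rw [map_add, map_add, map_smul, map_smul, map_smul, he, hf, hr]
    simp
  have hζc : Continuous (B.coord 2) := LinearMap.continuous_of_finiteDimensional _
  generalize B.coord 2 = ζ at hζ hζc
  let S : Set ℂ := {z | ∃ i, 1 + (c i - c i₀) * z ^ 2 = 0}
  have hS : S.Finite := by
    have : S = ⋃ i, {t : ℂ | 1 + 0 * t + (c i - c i₀) * t ^ 2 = 0} := by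
      ext t
      simp [S]
    rw [this]
    exact finite_iUnion fun i => Complex.finite_setOf_add_mul_add_mul_sq_eq_zero one_ne_zero _ _
  have hc' : 1 + (c i₁ - c i₀) = 0 := by linear_combination -hc
  obtain ⟨m, φ, hφ⟩ := Complex.exists_injective_freeGroup_hom_compl hS
    ⟨i₁, by simpa using hc'⟩ ⟨i₁, by simpa using hc'⟩
  let F : (Fin 3 → ℂ) → ℂ := fun v => q i₀ v / b i₀
  let O : Set (Fin 3 → ℂ) := {v | ∀ i, q i v ≠ 0}
  have hF : ∀ (a : ℂ) v, F (a • v) = a ^ 2 * F v := fun a v => by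
    simp only [F, QuadraticMap.map_smul, smul_eq_mul]
    ring
  have hO : ∀ a : ℂ, a ≠ 0 → ∀ v ∈ O, a • v ∈ O := fun a ha v hv i => by
    rw [QuadraticMap.map_smul, smul_eq_mul]
    exact mul_ne_zero (mul_ne_zero ha ha) (hv i)
  have hOo : IsOpen O := by
    have : O = ⋂ i, {v | q i v ≠ 0} := by
      ext v
      simp [O]
    rw [this]
    exact isOpen_iInter_of_finite fun i => isOpen_ne_fun (hq i) continuous_const
  have hFO : ∀ v ∈ O, F v ≠ 0 := fun v hv => div_ne_zero (hv i₀) (hb i₀)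
  have hcov := (unitLevelProj_isQuotientCoveringMap hF ((hq i₀).div_const _) hOo hFO hO
    hX).isCoveringMap
  let s : C(↥Sᶜ, unitLevel F hF O hO) :=
    { toFun := fun t => ⟨(1 - c i₀ * t.1 ^ 2) • e + (1 : ℂ) • f + t.1 • r, fun i => by
          rw [hform]
          refine mul_ne_zero (hb i) fun h => t.2 ⟨i, ?_⟩
          linear_combination h, by
          simp only [F, hform]
          rw [mul_div_cancel_left₀ _ (hb i₀)]
          ring⟩
      continuous_toFun := by fun_prop }
  let g : C(unitLevel F hF O hO, ↥Sᶜ) :=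
    { toFun := fun v => ⟨ζ v.1, by
        rintro ⟨i, hi⟩
        obtain ⟨x, y, z, hxyz⟩ := exists_eq_smul_add_smul_add_smul hlin v.1
        have h1 := v.2.1 i
        have h2 := v.2.2
        simp only [F] at h2
        rw [hxyz, hform, mul_div_cancel_left₀ _ (hb i₀)] at h2
        rw [hxyz, hform] at h1
        rw [hxyz, hζ] at hi
        refine h1 ?_
        linear_combination b i * hi + b i * h2⟩
      continuous_toFun := by fun_prop }
  refine ⟨_, ((FundamentalGroup.map ⟨_, hcov.continuous⟩ (s m)).comp
    (FundamentalGroup.map s m)).comp φ, ?_⟩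
  rw [MonoidHom.coe_comp, MonoidHom.coe_comp]
  exact ((hcov.fundamentalGroup_map_injective _).comp
    (FundamentalGroup.map_injective_of_leftInverse s g (fun t => Subtype.ext (hζ _ _ _)) m)).comp hφ

theorem fundamentalGroup_mul_comm_of_mk_mem_iff {X : Set P2}
    (q : QuadraticForm ℂ (Fin 3 → ℂ)) (hqc : Continuous q)
    (hX : ∀ v (hv : v ≠ 0), Projectivization.mk ℂ v hv ∈ X ↔ q v ≠ 0)
    (hq : ∀ v, (∀ w, QuadraticMap.polar q v w = 0) → v = 0) (x : X)
    (a b : FundamentalGroup X x) : a * b = b * a := by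
  obtain ⟨φ, hφ⟩ := QuadraticForm.exists_linearEquiv_apply_eq_sum_sq hq
  let O : Set (Fin 3 → ℂ) := {v | q v ≠ 0}
  have hF : ∀ (a : ℂ) v, q (a • v) = a ^ 2 * q v := fun a v => by
    simp only [QuadraticMap.map_smul, smul_eq_mul]
    ring
  have hO : ∀ a : ℂ, a ≠ 0 → ∀ v ∈ O, a • v ∈ O := fun a ha v hv => by
    change q (a • v) ≠ 0
    rw [hF]
    exact mul_ne_zero (pow_ne_zero 2 ha) hv
  have hcov := unitLevelProj_isQuotientCoveringMap hF hqc
    (isOpen_ne_fun hqc continuous_const) (fun _ hv => hv) hO hX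
  have hφc : Continuous φ := LinearMap.continuous_of_finiteDimensional φ.toLinearMap
  have hφc' : Continuous φ.symm := LinearMap.continuous_of_finiteDimensional φ.symm.toLinearMap
  have hI := Complex.I_sq
  let Φ : unitLevel q hF O hO ≃ₜ AffineQuadric :=
    { toFun := fun v => ⟨(φ v.1 0 + Complex.I * φ v.1 1, φ v.1 0 - Complex.I * φ v.1 1,
          φ v.1 2), by
        have := v.2.2
        rw [hφ] at this
        linear_combination this - φ v.1 1 ^ 2 * hI⟩
      invFun := fun w => ⟨φ.symm ![(w.1.1 + w.1.2.1) / 2,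
          -(Complex.I * (w.1.1 - w.1.2.1)) / 2, w.1.2.2], by
        have : q (φ.symm ![(w.1.1 + w.1.2.1) / 2,
            -(Complex.I * (w.1.1 - w.1.2.1)) / 2, w.1.2.2]) = 1 := by
          rw [hφ]
          simp only [LinearEquiv.apply_symm_apply]
          simp
          linear_combination w.2 + (w.1.1 - w.1.2.1) ^ 2 / 4 * hI
        exact ⟨by simp [O, this], this⟩⟩
      left_inv := fun v => by
        refine Subtype.ext ?_
        simp only
        rw [LinearEquiv.symm_apply_eq]
        ext i
        fin_cases i
        · simp
        · simp
          linear_combination -φ v.1 1 * hI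
        · simp
      right_inv := fun w => by
        refine Subtype.ext (Prod.ext ?_ (Prod.ext ?_ ?_))
        · simp
          linear_combination -(w.1.1 - w.1.2.1) / 2 * hI
        · simp
          linear_combination (w.1.1 - w.1.2.1) / 2 * hI
        · simp
      continuous_toFun := by fun_prop
      continuous_invFun := by fun_prop }
  have : SimplyConnectedSpace (unitLevel q hF O hO) :=
    Φ.toHomotopyEquiv.simplyConnectedSpace
  obtain ⟨y, hy⟩ := hcov.surjective x
  let E := hcov.fundamentalGroupEquiv (x := x) ⟨y, hy⟩
  refine E.injective ?_
  rw [map_mul, map_mul, mul_comm]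

theorem mk_mem_compl_iUnion_iff {ι : Type*} {Q : ι → Set P2} {P : ι → MvPolynomial (Fin 3) ℂ}
    (hP : ∀ i, (P i).IsHomogeneous 2) (hQ : ∀ i, Q i = zeroLocusP2 (P i)) (v : Fin 3 → ℂ)
    (hv : v ≠ 0) :
    (Projectivization.mk ℂ v hv : P2) ∈ (⋃ i, Q i)ᶜ ↔ ∀ i, (hP i).quadraticForm v ≠ 0 := by
  simp only [mem_compl_iff, mem_iUnion, not_exists, hQ, mk_mem_zeroLocusP2_iff (hP _),
    (hP _).quadraticForm_apply, ne_eq]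

theorem eq_zero_of_mk_mem_pair {p q : P2} {r : Fin 3 → ℂ}
    (hlin : LinearIndependent ℂ ![p.rep, q.rep, r]) {x y z : ℂ}
    (hv : x • p.rep + y • q.rep + z • r ≠ 0)
    (h : (Projectivization.mk ℂ _ hv : P2) ∈ ({p, q} : Set P2)) : z = 0 := by
  rw [Fintype.linearIndependent_iff] at hlin
  rcases h with h | h
  · obtain ⟨a, ha⟩ := (Projectivization.mk_eq_mk_iff' ℂ _ _ hv p.rep_nonzero).1 (h.trans p.mk_rep.symm)
    refine hlin ![x - a, y, z] ?_ 2
    rw [Fin.sum_univ_three]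
    simp only [Matrix.cons_val, sub_smul, ha]
    abel
  · obtain ⟨a, ha⟩ := (Projectivization.mk_eq_mk_iff' ℂ _ _ hv q.rep_nonzero).1 (h.trans q.mk_rep.symm)
    refine hlin ![x, y - a, z] ?_ 2
    rw [Fin.sum_univ_three]
    simp only [Matrix.cons_val, sub_smul, ha]
    abel

theorem exists_normal_form_of_tangentAt {ι : Type*} {Q : ι → Set P2}
    {P : ι → MvPolynomial (Fin 3) ℂ} (hP : ∀ i, (P i).IsHomogeneous 2)
    (hP' : ∀ i, ∀ v : Fin 3 → ℂ, v ≠ 0 → gradP (P i) v ≠ 0) (hQ : ∀ i, Q i = zeroLocusP2 (P i))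
    {p q : P2} (hpq : p ≠ q) {i₀ i₁ : ι} (hi : i₀ ≠ i₁) (hint : Q i₀ ∩ Q i₁ = {p, q})
    (htanp : ∀ i j, i ≠ j → TangentAt (Q i) (Q j) p)
    (htanq : ∀ i j, i ≠ j → TangentAt (Q i) (Q j) q) :
    ∃ (e f r : Fin 3 → ℂ) (b c : ι → ℂ), LinearIndependent ℂ ![e, f, r] ∧ (∀ i, b i ≠ 0) ∧
      (∀ i x y z, (hP i).quadraticForm (x • e + y • f + z • r) = b i * (x * y + c i * z ^ 2)) ∧
      c i₀ - c i₁ = 1 := by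
  have hef : LinearIndependent ℂ ![p.rep, q.rep] := by
    have := Projectivization.independent_iff.1 ((Projectivization.independent_pair_iff_ne p q).2 hpq)
    rwa [show Projectivization.rep ∘ ![p, q] = ![p.rep, q.rep] by
      ext i : 1
      fin_cases i <;> rfl] at this
  have hzero : ∀ {s : P2}, (∀ i j, i ≠ j → TangentAt (Q i) (Q j) s) →
      ∀ i, (hP i).quadraticForm s.rep = 0 := fun {s} hs i => by
    have : s ∈ Q i := by
      by_cases h : i = i₀
      · exact h ▸ (hs i₀ i₁ hi).1
      · exact (hs i i₀ h).1
    rw [hQ] at this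
    exact this
  have hpolar : ∀ {s : P2}, (∀ i j, i ≠ j → TangentAt (Q i) (Q j) s) → ∀ r, r ≠ 0 →
      QuadraticMap.polar (hP i₀).quadraticForm s.rep r = 0 →
      ∀ i, QuadraticMap.polar (hP i).quadraticForm s.rep r = 0 := fun {s} hs r hr h i => by
    by_cases hii : i₀ = i
    · exact hii ▸ h
    · have := (hs i₀ i hii).2.2 (P i₀) (P i) (hP _) (hP' _) (hQ _) (hP _) (hP' _) (hQ _)
      rwa [← mk_mem_tangentLineAt_iff (hP i) s r hr, ← this, mk_mem_tangentLineAt_iff (hP i₀)]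
  have he := hzero htanp
  have hf := hzero htanq
  have hb : ∀ i, QuadraticMap.polar (hP i).quadraticForm p.rep q.rep ≠ 0 := fun i =>
    QuadraticForm.polar_ne_zero_of_linearIndependent ((hP i).eq_zero_of_polar_eq_zero (hP' i))
      (he i) (hf i) hef
  obtain ⟨r, hr, her₀, hfr₀⟩ := QuadraticForm.exists_ne_zero_polar_eq_zero
    (hP i₀).quadraticForm p.rep q.rep
  have her := hpolar htanp r hr her₀
  have hfr := hpolar htanq r hr hfr₀
  have hform : ∀ i x y z, (hP i).quadraticForm (x • p.rep + y • q.rep + z • r) =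
      QuadraticMap.polar (hP i).quadraticForm p.rep q.rep * (x * y) +
        (hP i).quadraticForm r * z ^ 2 := fun i =>
    QuadraticForm.map_smul_add_smul_add_smul (he i) (hf i) (her i) (hfr i)
  have hlin := QuadraticForm.linearIndependent_of_polar (he i₀) (hf i₀) (hb i₀) hr her₀ hfr₀
  let c : ι → ℂ := fun i => (hP i).quadraticForm r /
    QuadraticMap.polar (hP i).quadraticForm p.rep q.rep
  have hform' : ∀ i x y z, (hP i).quadraticForm (x • p.rep + y • q.rep + z • r) =
      QuadraticMap.polar (hP i).quadraticForm p.rep q.rep * (x * y + c i * z ^ 2) :=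
    fun i x y z => by
      rw [hform]
      have := hb i
      simp only [c]
      field_simp
  have hc : c i₀ - c i₁ ≠ 0 := fun h => by
    have hv : (1 : ℂ) • p.rep + (-c i₀) • q.rep + (1 : ℂ) • r ≠ 0 := fun h0 => by
      rw [Fintype.linearIndependent_iff] at hlin
      exact one_ne_zero (hlin ![1, -c i₀, 1] (by rw [Fin.sum_univ_three]; exact h0) 0)
    refine one_ne_zero (eq_zero_of_mk_mem_pair hlin hv ?_)
    rw [← hint, hQ, hQ]
    refine ⟨(mk_mem_zeroLocusP2_iff (hP i₀) _ hv).2 ?_, (mk_mem_zeroLocusP2_iff (hP i₁) _ hv).2 ?_⟩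
    · rw [← (hP i₀).quadraticForm_apply, hform']
      ring
    · rw [← (hP i₁).quadraticForm_apply, hform', ← sub_eq_zero.1 h]
      ring
  obtain ⟨t, ht⟩ := IsAlgClosed.exists_pow_nat_eq (c i₀ - c i₁)⁻¹ two_pos
  have ht0 : t ≠ 0 := by
    rintro rfl
    exact inv_ne_zero hc (by rw [← ht]; simp)
  refine ⟨p.rep, q.rep, t • r, fun i => QuadraticMap.polar (hP i).quadraticForm p.rep q.rep,
    fun i => c i * t ^ 2, ?_, hb, fun i x y z => ?_, ?_⟩
  · refine QuadraticForm.linearIndependent_of_polar (he i₀) (hf i₀) (hb i₀) (smul_ne_zero ht0 hr)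
      ?_ ?_
    · rw [QuadraticMap.polar_smul_right, her₀, smul_zero]
    · rw [QuadraticMap.polar_smul_right, hfr₀, smul_zero]
  · rw [smul_smul, hform']
    ring
  · rw [← sub_mul, ht, mul_inv_cancel₀ hc]

end

/-- **Corollary.** For the arrangement `𝒜ₙ`, the fundamental group of the complement is
abelian for `n = 1` and big for `n ≥ 2`. -/
theorem fundamental_group_An_abelian_or_big (n : ℕ) (hn : 1 ≤ n) (Q : Fin n → Set P2)
    (hconic : ∀ i, IsSmoothConic (Q i))
    (hdist : ∀ i j : Fin n, i ≠ j → Q i ≠ Q j)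
    (p q : P2) (hpq : p ≠ q)
    (hint : ∀ i j : Fin n, i ≠ j → Q i ∩ Q j = {p, q})
    (htanp : ∀ i j : Fin n, i ≠ j → TangentAt (Q i) (Q j) p)
    (htanq : ∀ i j : Fin n, i ≠ j → TangentAt (Q i) (Q j) q)
    (x : ↥(⋃ i, Q i)ᶜ) :
    (n = 1 → ∀ a b : FundamentalGroup (↥(⋃ i, Q i)ᶜ) x, a * b = b * a) ∧
    (2 ≤ n → IsBig (FundamentalGroup (↥(⋃ i, Q i)ᶜ) x)) := by
  choose P hP hP' hQ using hconic
  have hX := mk_mem_compl_iUnion_iff hP hQ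
  have hcont : ∀ i, Continuous (hP i).quadraticForm := fun i => MvPolynomial.continuous_eval (P i)
  constructor
  · rintro rfl
    exact fundamentalGroup_mul_comm_of_mk_mem_iff (hP 0).quadraticForm (hcont 0)
      (fun v hv => (hX v hv).trans Fin.forall_fin_one)
      ((hP 0).eq_zero_of_polar_eq_zero (hP' 0)) x
  · intro h2
    have hi : (⟨0, hn⟩ : Fin n) ≠ ⟨1, h2⟩ := by simp
    obtain ⟨e, f, r, b, c, hlin, hb, hform, hc⟩ :=
      exists_normal_form_of_tangentAt hP hP' hQ hpq hi (hint _ _ hi) htanp htanq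
    obtain ⟨y, φ, hφ⟩ := exists_injective_freeGroup_hom_of_normal_form
      (fun i => (hP i).quadraticForm) hcont hX hlin hb hform hc
    have : Nonempty (Fin n) := ⟨⟨0, hn⟩⟩
    have : Nonempty ↥(⋃ i, Q i)ᶜ := ⟨x⟩
    have := pathConnectedSpace_of_mk_mem_iff (fun i => (hP i).quadraticForm) hX
    let E := FundamentalGroup.fundamentalGroupMulEquivOfPathConnected y x
    exact IsBig.of_injective (E.toMonoidHom.comp φ) (E.injective.comp hφ)
end
end
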